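/- For every l ∈ ℕ there is a constant C_{p,l} > 0 (depending only on p, l and ψ) such that the normalized curvature satisfies ‖k̃(·,τ) − 1‖_{C^l[0,2π]} ≤ C_{p,l}·e^{−(3p−1)τ} for all τ ≥ 0; in particular, no smallness condition on ψ is required and the normalized flow starting from the curvature of any simple closed convex curve converges exponentially to the constant 1 in every C^l norm at rate 3p−1. -/

import Mathlib

open Real MeasureTheory Filter Set

/-- The `n`-th Fourier coefficient of a `2π`-periodic function `f : ℝ → ℝ`:
`f̂(n) = (1/2π) ∫₀^{2π} f(θ) e^{-inθ} dθ`. -/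
noncomputable def fCoeff (f : ℝ → ℝ) (n : ℤ) : ℂ :=
  (1 / (2 * Real.pi)) * ∫ θ in (0:ℝ)..(2 * Real.pi),
    (f θ : ℂ) * Complex.exp (-(Complex.I * n * θ))

/-- The seminorm `‖f‖₂ = max{sup_n n²|Re f̂(n)|, sup_n n²|Im f̂(n)|}`. -/
noncomputable def seminorm2 (f : ℝ → ℝ) : ℝ :=
  max (⨆ n : ℤ, (n : ℝ)^2 * |(fCoeff f n).re|)
      (⨆ n : ℤ, (n : ℝ)^2 * |(fCoeff f n).im|)

/-- The `C^l[0,2π]` norm: `max_{0 ≤ j ≤ l} sup_{θ ∈ [0,2π]} |f^{(j)}(θ)|`. -/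
noncomputable def ClNorm (l : ℕ) (f : ℝ → ℝ) : ℝ :=
  ⨆ j : Fin (l + 1), ⨆ θ : Set.Icc (0:ℝ) (2 * Real.pi),
    |iteratedDeriv (j : ℕ) f (θ : ℝ)|

/-- `k : ℝ × [0,T) → ℝ` is a smooth, `2π`-periodic (in space), strictly positive solution of the
`p`-curve shortening equation
`∂k/∂t = k²(k^{p-1} ∂²k/∂θ² + (p-1) k^{p-2} (∂k/∂θ)² + (1/p) k^p)`
with initial datum `ψ` (smooth, strictly positive, `2π`-periodic), blow-up time `T`
(i.e. `sup_θ k(θ,t) → ∞` as `t → T⁻`), such that `k(·,t)` is the curvature of a simple closed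
convex curve for each `t`, i.e. `∫₀^{2π} e^{iθ}/k(θ,t) dθ = 0`. -/
def IsPCSF (p : ℕ) (T : ℝ) (k : ℝ → ℝ → ℝ) (ψ : ℝ → ℝ) : Prop :=
  ContDiffOn ℝ (⊤ : ℕ∞) (fun q : ℝ × ℝ => k q.1 q.2) (Set.univ ×ˢ Set.Ico 0 T) ∧
  (∀ θ t, k (θ + 2 * Real.pi) t = k θ t) ∧
  (∀ θ : ℝ, ∀ t ∈ Set.Ico (0:ℝ) T, 0 < k θ t) ∧
  (∀ θ : ℝ, ∀ t ∈ Set.Ico (0:ℝ) T,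
    HasDerivAt (fun s => k θ s)
      ((k θ t)^2 * ((k θ t)^(p - 1) * deriv (deriv (fun x => k x t)) θ
        + ((p : ℝ) - 1) * (k θ t)^(p - 2) * (deriv (fun x => k x t) θ)^2
        + (1 / (p : ℝ)) * (k θ t)^p)) t) ∧
  (∀ θ, k θ 0 = ψ θ) ∧
  ContDiff ℝ (⊤ : ℕ∞) ψ ∧ (∀ θ, 0 < ψ θ) ∧ (∀ θ, ψ (θ + 2 * Real.pi) = ψ θ) ∧
  Filter.Tendsto (fun t => ⨆ θ : Set.Icc (0:ℝ) (2 * Real.pi), k (θ : ℝ) t)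
    (nhdsWithin T (Set.Iio T)) Filter.atTop ∧
  (∀ t ∈ Set.Ico (0:ℝ) T,
    (∫ θ in (0:ℝ)..(2 * Real.pi), Complex.exp (Complex.I * θ) / (k θ t)) = 0)

/-- The original time `t` corresponding to the rescaled time `τ`:
`t = T(1 - e^{-(p+1)τ})`, i.e. `τ = -(1/(p+1))·log(1 - t/T)`. -/
noncomputable def tOf (p : ℕ) (T τ : ℝ) : ℝ := T * (1 - Real.exp (-((p : ℝ) + 1) * τ))

/-- The normalized curvature `k̃(θ,τ) = ((p+1)/p)^{1/(p+1)} (T-t)^{1/(p+1)} k(θ,t)`,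
with `t = T(1 - e^{-(p+1)τ})`. -/
noncomputable def ktilde (p : ℕ) (T : ℝ) (k : ℝ → ℝ → ℝ) (θ τ : ℝ) : ℝ :=
  (((p : ℝ) + 1) / (p : ℝ)) ^ ((1 : ℝ) / ((p : ℝ) + 1))
    * (T - tOf p T τ) ^ ((1 : ℝ) / ((p : ℝ) + 1)) * k θ (tOf p T τ)


namespace PC
open scoped ContDiff Topology
def SM (I : Set ℝ) (g : ℝ → ℝ → ℝ) : Prop :=
  ContDiffOn ℝ (⊤ : ℕ∞) (fun q : ℝ × ℝ => g q.1 q.2) (Set.univ ×ˢ I)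
noncomputable def dx (g : ℝ → ℝ → ℝ) : ℝ → ℝ → ℝ := fun θ t => deriv (fun x => g x t) θ
noncomputable def dt (g : ℝ → ℝ → ℝ) : ℝ → ℝ → ℝ := fun θ t => deriv (fun s => g θ s) t
def Per (I : Set ℝ) (g : ℝ → ℝ → ℝ) : Prop := ∀ θ, ∀ t ∈ I, g (θ + 2 * π) t = g θ t
variable {I : Set ℝ} {g f : ℝ → ℝ → ℝ}
lemma SM.contDiff (hg : SM I g) {t : ℝ} (ht : t ∈ I) :
    ContDiff ℝ (⊤ : ℕ∞) (fun x => g x t) := by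
  have h1 : ContDiffOn ℝ (⊤ : ℕ∞) (fun x : ℝ => ((x, t) : ℝ × ℝ)) Set.univ := by
    apply ContDiff.contDiffOn; fun_prop
  have := ContDiffOn.comp hg h1 (fun x _ => ⟨trivial, ht⟩)
  exact contDiffOn_univ.1 this
lemma SM.hdx (hg : SM I g) {t : ℝ} (ht : t ∈ I) (θ : ℝ) :
    HasDerivAt (fun x => g x t) (dx g θ t) θ :=
  ((hg.contDiff ht).differentiable (by simp)).differentiableAt.hasDerivAt
lemma SM.cont (hg : SM I g) {t : ℝ} (ht : t ∈ I) : Continuous (fun x => g x t) :=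
  (hg.contDiff ht).continuous
lemma SM.contOn (hg : SM I g) : ContinuousOn (fun q : ℝ × ℝ => g q.1 q.2) (Set.univ ×ˢ I) :=
  ContDiffOn.continuousOn hg
lemma SM.contDiffAt (hI : IsOpen I) (hg : SM I g) {t : ℝ} (ht : t ∈ I) (θ : ℝ) :
    ContDiffAt ℝ (⊤ : ℕ∞) (fun q : ℝ × ℝ => g q.1 q.2) (θ, t) :=
  ContDiffOn.contDiffAt hg ((isOpen_univ.prod hI).mem_nhds ⟨trivial, ht⟩)
lemma SM.hdt (hI : IsOpen I) (hg : SM I g) {t : ℝ} (ht : t ∈ I) (θ : ℝ) :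
    HasDerivAt (fun s => g θ s) (dt g θ t) t := by
  have h := (hg.contDiffAt hI ht θ).differentiableAt (by simp)
  have h2 : DifferentiableAt ℝ (fun s : ℝ => ((θ, s) : ℝ × ℝ)) t := by fun_prop
  have h3 := DifferentiableAt.comp t h h2
  exact h3.hasDerivAt
lemma SM.dx (hI : UniqueDiffOn ℝ I) (hg : SM I g) : SM I (dx g) := by
  have hU : UniqueDiffOn ℝ ((Set.univ : Set ℝ) ×ˢ I) := uniqueDiffOn_univ.prod hI
  have h1 : ContDiffOn ℝ (⊤ : ℕ∞)
      (fun q => fderivWithin ℝ (fun q : ℝ × ℝ => g q.1 q.2) (Set.univ ×ˢ I) q ((1 : ℝ), (0 : ℝ)))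
      (Set.univ ×ˢ I) :=
    (ContDiffOn.fderivWithin hg hU (by simp)).clm_apply contDiffOn_const
  refine h1.congr ?_
  rintro ⟨θ, t⟩ ⟨-, ht⟩
  have h2 := ((hg.differentiableOn (by simp)) (θ, t) ⟨trivial, ht⟩).hasFDerivWithinAt
  have h3 : HasDerivWithinAt (fun x : ℝ => ((x, t) : ℝ × ℝ)) ((1 : ℝ), (0 : ℝ)) Set.univ θ := by
    apply HasDerivAt.hasDerivWithinAt
    exact (hasDerivAt_id θ).prodMk (hasDerivAt_const θ t)
  have hm : Set.MapsTo (fun x : ℝ => ((x, t) : ℝ × ℝ)) Set.univ (Set.univ ×ˢ I) :=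
    fun x _ => ⟨trivial, ht⟩
  have h4 := HasFDerivWithinAt.comp_hasDerivWithinAt θ h2 h3 hm
  exact (hasDerivWithinAt_univ.1 h4).deriv
lemma SM.dx_eq (hI : IsOpen I) (hg : SM I g) {t : ℝ} (ht : t ∈ I) (θ : ℝ) :
    PC.dx g θ t = fderiv ℝ (fun q : ℝ × ℝ => g q.1 q.2) (θ, t) ((1 : ℝ), (0 : ℝ)) := by
  have h2 := ((hg.contDiffAt hI ht θ).differentiableAt (by simp)).hasFDerivAt
  have h3 : HasDerivAt (fun x : ℝ => ((x, t) : ℝ × ℝ)) ((1 : ℝ), (0 : ℝ)) θ :=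
    (hasDerivAt_id θ).prodMk (hasDerivAt_const θ t)
  exact (HasFDerivAt.comp_hasDerivAt θ h2 h3).deriv
lemma SM.dt_eq (hI : IsOpen I) (hg : SM I g) {t : ℝ} (ht : t ∈ I) (θ : ℝ) :
    PC.dt g θ t = fderiv ℝ (fun q : ℝ × ℝ => g q.1 q.2) (θ, t) ((0 : ℝ), (1 : ℝ)) := by
  have h2 := ((hg.contDiffAt hI ht θ).differentiableAt (by simp)).hasFDerivAt
  have h3 : HasDerivAt (fun x : ℝ => ((θ, x) : ℝ × ℝ)) ((0 : ℝ), (1 : ℝ)) t :=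
    (hasDerivAt_const t θ).prodMk (hasDerivAt_id t)
  exact (HasFDerivAt.comp_hasDerivAt t h2 h3).deriv
lemma SM.dt (hI : IsOpen I) (hg : SM I g) : SM I (dt g) := by
  have h1 : ContDiffOn ℝ (⊤ : ℕ∞)
      (fun q => fderiv ℝ (fun q : ℝ × ℝ => g q.1 q.2) q ((0 : ℝ), (1 : ℝ)))
      (Set.univ ×ˢ I) :=
    (ContDiffOn.fderiv_of_isOpen hg (isOpen_univ.prod hI) (by simp)).clm_apply contDiffOn_const
  refine h1.congr ?_
  rintro ⟨θ, t⟩ ⟨-, ht⟩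
  exact hg.dt_eq hI ht θ
lemma SM.dt_dx (hI : IsOpen I) (hg : SM I g) {t : ℝ} (ht : t ∈ I) (θ : ℝ) :
    PC.dt (PC.dx g) θ t = PC.dx (PC.dt g) θ t := by
  rw [(hg.dx hI.uniqueDiffOn).dt_eq hI ht, (hg.dt hI).dx_eq hI ht]
  set F := fun q : ℝ × ℝ => g q.1 q.2
  have hU : (Set.univ ×ˢ I : Set (ℝ × ℝ)) ∈ 𝓝 (θ, t) :=
    (isOpen_univ.prod hI).mem_nhds ⟨trivial, ht⟩
  have e1 : (fun q : ℝ × ℝ => PC.dx g q.1 q.2) =ᶠ[𝓝 (θ, t)]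
      fun q => fderiv ℝ F q ((1 : ℝ), (0 : ℝ)) := by
    filter_upwards [hU] with q hq
    exact hg.dx_eq hI hq.2 q.1
  have e2 : (fun q : ℝ × ℝ => PC.dt g q.1 q.2) =ᶠ[𝓝 (θ, t)]
      fun q => fderiv ℝ F q ((0 : ℝ), (1 : ℝ)) := by
    filter_upwards [hU] with q hq
    exact hg.dt_eq hI hq.2 q.1
  rw [e1.fderiv_eq, e2.fderiv_eq]
  have hd : DifferentiableAt ℝ (fderiv ℝ F) (θ, t) := by
    have : ContDiffAt ℝ (⊤ : ℕ∞) (fderiv ℝ F) (θ, t) :=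
      (hg.contDiffAt hI ht θ).fderiv_right (by simp)
    exact this.differentiableAt (by simp)
  rw [fderiv_clm_apply hd (by fun_prop), fderiv_clm_apply hd (by fun_prop)]
  have hs : IsSymmSndFDerivAt ℝ F (θ, t) :=
    (hg.contDiffAt hI ht θ).isSymmSndFDerivAt (by simpa using (WithTop.coe_le_coe.2 le_top : ((2:ℕ∞):WithTop ℕ∞) ≤ ((⊤:ℕ∞):WithTop ℕ∞)))
  simpa using hs.eq ((0 : ℝ), (1 : ℝ)) ((1 : ℝ), (0 : ℝ))
lemma hasDerivAt_integral_param {E : Type*} [NormedAddCommGroup E] [NormedSpace ℝ E]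
    {g g' : ℝ → ℝ → E} (hI : IsOpen I)
    (hg' : ContinuousOn (fun q : ℝ × ℝ => g' q.1 q.2) (Set.univ ×ˢ I))
    (hgc : ∀ t ∈ I, Continuous (fun x => g x t))
    (h : ∀ θ, ∀ t ∈ I, HasDerivAt (fun s => g θ s) (g' θ t) t) {t : ℝ} (ht : t ∈ I) (a b : ℝ) :
    HasDerivAt (fun s => ∫ θ in a..b, g θ s) (∫ θ in a..b, g' θ t) t := by
  obtain ⟨ε, hε, hball⟩ := Metric.isOpen_iff.1 hI t ht
  have hsub : Metric.closedBall t (ε / 2) ⊆ I :=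
    (Metric.closedBall_subset_ball (by linarith)).trans hball
  have hK : IsCompact (Set.uIcc a b ×ˢ Metric.closedBall t (ε / 2)) :=
    isCompact_uIcc.prod (isCompact_closedBall _ _)
  obtain ⟨C, hC⟩ := hK.exists_bound_of_continuousOn
    (hg'.mono (Set.prod_mono (Set.subset_univ _) hsub))
  have hc' : ∀ s ∈ I, Continuous (fun x => g' x s) := by
    intro s hs
    have h1 : ContinuousOn (fun x : ℝ => ((x, s) : ℝ × ℝ)) Set.univ := by fun_prop
    have := ContinuousOn.comp hg' h1 (fun x _ => ⟨trivial, hs⟩)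
    exact continuousOn_univ.1 this
  refine (intervalIntegral.hasDerivAt_integral_of_dominated_loc_of_deriv_le
    (F := fun s θ => g θ s) (F' := fun s θ => g' θ s)
    (bound := fun _ => C) (Metric.closedBall_mem_nhds t (half_pos hε)) ?_ ?_ ?_ ?_ ?_ ?_).2
  · filter_upwards [hI.mem_nhds ht] with s hs
    exact (hgc s hs).aestronglyMeasurable
  · exact (hgc t ht).intervalIntegrable _ _
  · exact (hc' t ht).aestronglyMeasurable
  · refine Eventually.of_forall fun θ hθ s hs => ?_
    exact hC (θ, s) ⟨Set.uIoc_subset_uIcc hθ, hs⟩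
  · exact intervalIntegrable_const
  · exact Eventually.of_forall fun θ _ s hs => h θ s (hsub hs)
lemma SM.hasDerivAt_integral (hI : IsOpen I) (hg : SM I g) {t : ℝ} (ht : t ∈ I) (a b : ℝ) :
    HasDerivAt (fun s => ∫ θ in a..b, g θ s) (∫ θ in a..b, PC.dt g θ t) t :=
  hasDerivAt_integral_param hI (hg.dt hI).contOn (fun _ hs => hg.cont hs)
    (fun θ _ hs => hg.hdt hI hs θ) ht a b
lemma SM.add (hf : SM I f) (hg : SM I g) : SM I (fun θ t => f θ t + g θ t) :=
  ContDiffOn.add hf hg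
lemma SM.sub (hf : SM I f) (hg : SM I g) : SM I (fun θ t => f θ t - g θ t) :=
  ContDiffOn.sub hf hg
lemma SM.mul (hf : SM I f) (hg : SM I g) : SM I (fun θ t => f θ t * g θ t) :=
  ContDiffOn.mul hf hg
lemma SM.pow (hf : SM I f) (n : ℕ) : SM I (fun θ t => f θ t ^ n) :=
  ContDiffOn.pow hf n
lemma SM.cst (c : ℝ) : SM I (fun _ _ => c) := contDiffOn_const
lemma SM.cmul (c : ℝ) (hf : SM I f) : SM I (fun θ t => c * f θ t) := (SM.cst c).mul hf
lemma SM.inv (hf : SM I f) (h0 : ∀ θ, ∀ t ∈ I, f θ t ≠ 0) : SM I (fun θ t => (f θ t)⁻¹) :=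
  ContDiffOn.inv hf (fun q hq => h0 q.1 q.2 hq.2)
lemma SM.log (hf : SM I f) (h0 : ∀ θ, ∀ t ∈ I, f θ t ≠ 0) :
    SM I (fun θ t => Real.log (f θ t)) :=
  ContDiffOn.log hf (fun q hq => h0 q.1 q.2 hq.2)
lemma SM.mono {I' : Set ℝ} (hf : SM I f) (h : I' ⊆ I) : SM I' f :=
  ContDiffOn.mono hf (Set.prod_mono le_rfl h)
lemma Per.dx (hg : Per I g) : Per I (dx g) := by
  intro θ t ht
  have : (fun x => g x t) = fun x => g (x + 2 * π) t := by
    funext x; exact (hg x t ht).symm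
  unfold PC.dx
  conv_rhs => rw [this]
  exact (deriv_comp_add_const (fun x => g x t) (2 * π) θ).symm
lemma Per.dt (hI : IsOpen I) (hg : Per I g) : Per I (dt g) := by
  intro θ t ht
  unfold PC.dt
  apply Filter.EventuallyEq.deriv_eq
  filter_upwards [hI.mem_nhds ht] with s hs using hg θ s hs
lemma ibp {a b a' b' : ℝ → ℝ} (ha : ∀ x, HasDerivAt a (a' x) x) (hb : ∀ x, HasDerivAt b (b' x) x)
    (ha' : Continuous a') (hb' : Continuous b')
    (hpa : a (2 * π) = a 0) (hpb : b (2 * π) = b 0) :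
    ∫ x in (0:ℝ)..(2 * π), a x * b' x = - ∫ x in (0:ℝ)..(2 * π), a' x * b x := by
  rw [intervalIntegral.integral_mul_deriv_eq_deriv_mul (fun x _ => ha x) (fun x _ => hb x)
    (ha'.intervalIntegrable _ _) (hb'.intervalIntegrable _ _), hpa, hpb]
  ring
end PC
namespace PC
open scoped ContDiff Topology
structure Flow (p : ℕ) (I : Set ℝ) (k H : ℝ → ℝ → ℝ) : Prop where
  io : IsOpen I
  hp : 1 ≤ p
  sm : SM I k
  per : Per I k
  pos : ∀ θ, ∀ t ∈ I, 0 < k θ t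
  smH : SM I H
  perH : Per I H
  eq : ∀ θ, ∀ t ∈ I, dt k θ t = k θ t ^ 2 * H θ t
def V (p : ℕ) (k : ℝ → ℝ → ℝ) : ℝ → ℝ → ℝ := fun θ t => k θ t ^ p
lemma Per.apply0 {I : Set ℝ} {g : ℝ → ℝ → ℝ} (h : Per I g) {t : ℝ} (ht : t ∈ I) :
    g (2 * π) t = g 0 t := by
  have := h 0 t ht
  simpa using this
lemma Per.mul {I : Set ℝ} {f g : ℝ → ℝ → ℝ} (hf : Per I f) (hg : Per I g) :
    Per I (fun θ t => f θ t * g θ t) := fun θ t ht => by simp only [hf θ t ht, hg θ t ht]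
lemma Per.pow {I : Set ℝ} {f : ℝ → ℝ → ℝ} (hf : Per I f) (n : ℕ) :
    Per I (fun θ t => f θ t ^ n) := fun θ t ht => by simp only [hf θ t ht]
namespace Flow
variable {p : ℕ} {I : Set ℝ} {k H : ℝ → ℝ → ℝ} (h : Flow p I k H)
include h
lemma smV : SM I (V p k) := h.sm.pow p
lemma perV : Per I (V p k) := h.per.pow p
lemma smV1 : SM I (dx (V p k)) := h.smV.dx h.io.uniqueDiffOn
lemma smV2 : SM I (dx (dx (V p k))) := h.smV1.dx h.io.uniqueDiffOn
lemma smV3 : SM I (dx (dx (dx (V p k)))) := h.smV2.dx h.io.uniqueDiffOn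
lemma hk {t : ℝ} (ht : t ∈ I) (θ : ℝ) :
    HasDerivAt (fun s => k θ s) (k θ t ^ 2 * H θ t) t := by
  have := h.sm.hdt h.io ht θ
  rwa [h.eq θ t ht] at this
lemma hpow (n : ℕ) {t : ℝ} (ht : t ∈ I) (θ : ℝ) :
    HasDerivAt (fun s => k θ s ^ n) (n * (k θ t ^ (n + 1) * H θ t)) t := by
  refine ((h.hk ht θ).pow n).congr_deriv ?_
  rcases n with _ | n
  · simp
  · simp; ring
lemma dtV {t : ℝ} (ht : t ∈ I) (θ : ℝ) :
    dt (V p k) θ t = p * (k θ t ^ (p + 1) * H θ t) := (h.hpow p ht θ).deriv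
lemma hinv {t : ℝ} (ht : t ∈ I) (θ : ℝ) :
    HasDerivAt (fun s => (k θ s)⁻¹) (- H θ t) t := by
  refine ((h.hk ht θ).inv (h.pos θ t ht).ne').congr_deriv ?_
  have := (h.pos θ t ht).ne'
  field_simp
lemma smInv : SM I (fun θ t => (k θ t)⁻¹) := h.sm.inv fun θ t ht => (h.pos θ t ht).ne'
lemma hint_pow (n : ℕ) {t : ℝ} (ht : t ∈ I) :
    HasDerivAt (fun s => ∫ θ in (0:ℝ)..(2*π), k θ s ^ n)
      (n * ∫ θ in (0:ℝ)..(2*π), k θ t ^ (n+1) * H θ t) t := by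
  have := hasDerivAt_integral_param (g := fun θ s => k θ s ^ n)
    (g' := fun θ t => n * (k θ t ^ (n + 1) * H θ t)) h.io
    (((h.sm.pow (n+1)).mul h.smH).cmul n).contOn
    (fun s hs => (h.sm.pow n).cont hs) (fun θ s hs => h.hpow n hs θ) ht 0 (2*π)
  rwa [intervalIntegral.integral_const_mul] at this
lemma hint_log {t : ℝ} (ht : t ∈ I) :
    HasDerivAt (fun s => ∫ θ in (0:ℝ)..(2*π), Real.log (k θ s))
      (∫ θ in (0:ℝ)..(2*π), k θ t * H θ t) t := by
  refine hasDerivAt_integral_param (g := fun θ s => Real.log (k θ s))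
    (g' := fun θ t => (k θ t * H θ t)) h.io (h.sm.mul h.smH).contOn
    (fun s hs => (h.sm.log fun θ t ht => (h.pos θ t ht).ne').cont hs) (fun θ s hs => ?_) ht _ _
  refine ((h.hk hs θ).log (h.pos θ s hs).ne').congr_deriv ?_
  have := (h.pos θ s hs).ne'
  field_simp
lemma hint_inv {φ : ℝ → ℝ} (hφ : Continuous φ) {t : ℝ} (ht : t ∈ I) (a b : ℝ) :
    HasDerivAt (fun s => ∫ θ in a..b, φ θ * (k θ s)⁻¹)
      (- ∫ θ in a..b, φ θ * H θ t) t := by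
  have := hasDerivAt_integral_param (g := fun θ s => φ θ * (k θ s)⁻¹)
    (g' := fun θ t => (φ θ * (-H θ t))) h.io
    ((hφ.comp continuous_fst).continuousOn.mul h.smH.contOn.neg)
    (fun s hs => hφ.mul (h.smInv.cont hs)) (fun θ s hs => (h.hinv hs θ).const_mul _) ht a b
  simpa [intervalIntegral.integral_neg] using this
lemma hint_E {t : ℝ} (ht : t ∈ I) :
    HasDerivAt (fun s => ∫ θ in (0:ℝ)..(2*π), ((V p k θ s)^2 - (dx (V p k) θ s)^2) / 2)
      (p * ∫ θ in (0:ℝ)..(2*π),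
        (V p k θ t + dx (dx (V p k)) θ t) * (k θ t ^ (p+1) * H θ t)) t := by
  have hd : ∀ s ∈ I, ∀ θ, HasDerivAt (fun s => dx (V p k) θ s) (dx (dt (V p k)) θ s) s := by
    intro s hs θ
    have := h.smV1.hdt h.io hs θ
    rwa [h.smV.dt_dx h.io hs θ] at this
  have smt : SM I (dt (V p k)) := h.smV.dt h.io
  have smtx : SM I (dx (dt (V p k))) := smt.dx h.io.uniqueDiffOn
  have := hasDerivAt_integral_param
    (g := fun θ s => ((V p k θ s)^2 - (dx (V p k) θ s)^2) / 2)
    (g' := fun θ s => V p k θ s * dt (V p k) θ s - dx (V p k) θ s * dx (dt (V p k)) θ s) h.io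
    ((h.smV.mul smt).sub (h.smV1.mul smtx)).contOn
    (fun s hs => (((h.smV.cont hs).pow 2).sub ((h.smV1.cont hs).pow 2)).div_const 2)
    (fun θ s hs => by
      refine ((((h.smV.hdt h.io hs θ).pow 2).sub ((hd s hs θ).pow 2)).div_const 2).congr_deriv ?_
      simp; ring) ht 0 (2*π)
  refine this.congr_deriv ?_
  have pt : Per I (dt (V p k)) := h.perV.dt h.io
  have e := ibp (fun x => h.smV1.hdx ht x) (fun x => smt.hdx ht x) (h.smV2.cont ht)
    (smtx.cont ht) (h.perV.dx.apply0 ht) (pt.apply0 ht)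
  rw [intervalIntegral.integral_sub, e, sub_neg_eq_add, ← intervalIntegral.integral_add,
    ← intervalIntegral.integral_const_mul]
  · congr 1; funext θ
    rw [h.dtV ht]; ring
  · exact (((h.smV.cont ht).mul (smt.cont ht))).intervalIntegrable _ _
  · exact (((h.smV2.cont ht).mul (smt.cont ht))).intervalIntegrable _ _
  · exact (((h.smV.cont ht).mul (smt.cont ht))).intervalIntegrable _ _
  · exact (((h.smV1.cont ht).mul (smtx.cont ht))).intervalIntegrable _ _
lemma int_vv {t : ℝ} (ht : t ∈ I) :
    ∫ θ in (0:ℝ)..(2*π), V p k θ t * (V p k θ t + dx (dx (V p k)) θ t)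
     = 2 * ∫ θ in (0:ℝ)..(2*π), ((V p k θ t)^2 - (dx (V p k) θ t)^2) / 2 := by
  have e := ibp (fun x => h.smV.hdx ht x) (fun x => h.smV1.hdx ht x) (h.smV1.cont ht)
    (h.smV2.cont ht) (h.perV.apply0 ht) (h.perV.dx.apply0 ht)
  have e1 : ∫ θ in (0:ℝ)..(2*π), V p k θ t * (V p k θ t + dx (dx (V p k)) θ t)
      = (∫ θ in (0:ℝ)..(2*π), V p k θ t * V p k θ t)
        + ∫ θ in (0:ℝ)..(2*π), V p k θ t * dx (dx (V p k)) θ t := by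
    rw [← intervalIntegral.integral_add]
    · congr 1; funext θ; ring
    · exact (((h.smV.cont ht).mul (h.smV.cont ht))).intervalIntegrable _ _
    · exact (((h.smV.cont ht).mul (h.smV2.cont ht))).intervalIntegrable _ _
  rw [e1, e, ← intervalIntegral.integral_const_mul, ← sub_eq_add_neg,
    ← intervalIntegral.integral_sub]
  · congr 1; funext θ; ring
  · exact (((h.smV.cont ht).mul (h.smV.cont ht))).intervalIntegrable _ _
  · exact (((h.smV1.cont ht).mul (h.smV1.cont ht))).intervalIntegrable _ _
end Flow
end PC
namespace PC
open scoped ContDiff Topology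
lemma two_pi_pos' : (0:ℝ) < 2 * π := by positivity
lemma exists_max {g : ℝ → ℝ → ℝ} {t0 t1 : ℝ} (h01 : t0 ≤ t1)
    (hc : ContinuousOn (fun q : ℝ × ℝ => g q.1 q.2) (Set.univ ×ˢ Icc t0 t1))
    (hp : Per (Icc t0 t1) g) :
    ∃ θ0, ∃ s ∈ Icc t0 t1, ∀ θ, ∀ t ∈ Icc t0 t1, g θ t ≤ g θ0 s := by
  have hK : IsCompact (Icc 0 (2 * π) ×ˢ Icc t0 t1) := isCompact_Icc.prod isCompact_Icc
  obtain ⟨⟨θ0, s⟩, ⟨_, hs⟩, hm⟩ := hK.exists_isMaxOn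
    ⟨(0, t0), ⟨⟨le_rfl, two_pi_pos'.le⟩, ⟨le_rfl, h01⟩⟩⟩
    (hc.mono (Set.prod_mono (Set.subset_univ _) le_rfl))
  refine ⟨θ0, s, hs, fun θ t ht => ?_⟩
  have hper : Function.Periodic (fun x => g x t) (2 * π) := fun x => hp x t ht
  obtain ⟨y, hy, hxy⟩ := hper.exists_mem_Ico₀ two_pi_pos' θ
  have := hm (show (y, t) ∈ Icc 0 (2 * π) ×ˢ Icc t0 t1 from ⟨⟨hy.1, hy.2.le⟩, ht⟩)
  have hxy' : g θ t = g y t := hxy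
  rw [hxy']; exact this
lemma deriv_nonneg_of_left_max {f : ℝ → ℝ} {f' a t : ℝ} (hf : HasDerivAt f f' t) (hat : a < t)
    (hm : ∀ s ∈ Icc a t, f s ≤ f t) : 0 ≤ f' := by
  have h1 := (hasDerivAt_iff_tendsto_slope.1 hf).mono_left
    (nhdsWithin_mono t (show Iio t ⊆ {t}ᶜ from fun x hx => (ne_of_lt hx)))
  refine ge_of_tendsto h1 ?_
  filter_upwards [Ioo_mem_nhdsLT hat] with s hs
  rw [slope_def_field]
  exact div_nonneg_of_nonpos (sub_nonpos.2 (hm s ⟨hs.1.le, hs.2.le⟩)) (by linarith [hs.2])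
lemma second_deriv_max {f f1 : ℝ → ℝ} {f2 x : ℝ} (h1 : ∀ x, HasDerivAt f (f1 x) x)
    (h2 : HasDerivAt f1 f2 x) (hm : ∀ y, f y ≤ f x) : f1 x = 0 ∧ f2 ≤ 0 := by
  have hmax : IsLocalMax f x := Filter.Eventually.of_forall hm
  have h0 : f1 x = 0 := hmax.hasDerivAt_eq_zero (h1 x)
  refine ⟨h0, ?_⟩
  by_contra! hlt
  have hd : deriv f = f1 := funext fun y => (h1 y).deriv
  have hmin : IsLocalMin f x := isLocalMin_of_deriv_deriv_pos (by rw [hd, h2.deriv]; exact hlt)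
    (by rw [hd]; exact h0) (h1 x).continuousAt
  have hconst : f =ᶠ[𝓝 x] fun _ => f x := by
    filter_upwards [hmin] with y hy using le_antisymm (hm y) hy
  have : deriv f =ᶠ[𝓝 x] fun _ => 0 := by
    have := hconst.deriv
    filter_upwards [this] with y hy
    rw [hy]; simp
  have h3 : deriv (deriv f) x = 0 := by rw [this.deriv_eq]; simp
  rw [hd, h2.deriv] at h3
  linarith
namespace Flow
variable {p : ℕ} {I : Set ℝ} {k H : ℝ → ℝ → ℝ} (h : Flow p I k H)
include h
lemma grad (hH : ∀ θ, ∀ t ∈ I, p * H θ t = V p k θ t + dx (dx (V p k)) θ t) {t0 t1 M : ℝ}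
    (hI : Icc t0 t1 ⊆ I) (h01 : t0 ≤ t1) (hM : ∀ θ, ∀ t ∈ Icc t0 t1, V p k θ t ≤ M)
    (h0 : ∀ θ, V p k θ t0 ^ 2 + dx (V p k) θ t0 ^ 2 ≤ M ^ 2) :
    ∀ θ, ∀ t ∈ Icc t0 t1, V p k θ t ^ 2 + dx (V p k) θ t ^ 2 ≤ M ^ 2 := by
  have key : ∀ ε > 0, ∀ θ, ∀ t ∈ Icc t0 t1,
      V p k θ t ^ 2 + dx (V p k) θ t ^ 2 ≤ M ^ 2 + ε * (t - t0) := by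
    intro ε hε
    set u := V p k with hu
    have smw : SM I (fun θ t => u θ t ^ 2 + dx u θ t ^ 2) := (h.smV.pow 2).add (h.smV1.pow 2)
    have hc : ContinuousOn (fun q : ℝ × ℝ => (u q.1 q.2 ^ 2 + dx u q.1 q.2 ^ 2) - ε * (q.2 - t0))
        (Set.univ ×ˢ Icc t0 t1) :=
      (smw.contOn.mono (Set.prod_mono le_rfl hI)).sub (by fun_prop)
    obtain ⟨θs, s, hs, hmax⟩ := exists_max (g := fun θ t => (u θ t ^ 2 + dx u θ t ^ 2) - ε * (t - t0))
      h01 hc (fun θ t ht => by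
        simp only [hu, h.perV θ t (hI ht), h.perV.dx θ t (hI ht)])
    suffices hsuf : u θs s ^ 2 + dx u θs s ^ 2 - ε * (s - t0) ≤ M ^ 2 by
      intro θ t ht
      have := hmax θ t ht
      linarith
    have hupos : 0 ≤ u θs s := (pow_pos (h.pos θs s (hI hs)) p).le
    rcases hs.1.eq_or_lt with heq | hlt
    · rw [← heq]; simpa using h0 θs
    have hsI := hI hs
    have hx1 : ∀ x, HasDerivAt (fun x => u x s ^ 2 + dx u x s ^ 2)
        (2 * dx u x s * (u x s + dx (dx u) x s)) x := by
      intro x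
      refine (((h.smV.hdx hsI x).pow 2).add ((h.smV1.hdx hsI x).pow 2)).congr_deriv ?_
      simp; ring
    have hx2 : HasDerivAt (fun x => 2 * dx u x s * (u x s + dx (dx u) x s))
        (2 * dx (dx u) θs s * (u θs s + dx (dx u) θs s)
          + 2 * dx u θs s * (dx u θs s + dx (dx (dx u)) θs s)) θs := by
      refine (((h.smV1.hdx hsI θs).const_mul 2).mul
        ((h.smV.hdx hsI θs).add (h.smV2.hdx hsI θs))).congr_deriv ?_
      simp only [Pi.add_apply, ← hu]
    obtain ⟨e1, e2⟩ := second_deriv_max hx1 hx2 (fun y => by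
      have := hmax y s hs; linarith)
    rcases mul_eq_zero.1 e1 with e3 | e3
    · have e4 : dx u θs s = 0 := by linarith
      rw [e4]
      have := hM θs s hs
      nlinarith [mul_pos hε (sub_pos.2 hlt)]
    exfalso
    have smt : SM I (dt u) := h.smV.dt h.io
    have hdtu : ∀ x, dt u x s = k x s ^ (p+1) * (u x s + dx (dx u) x s) := by
      intro x
      rw [hu, h.dtV hsI x, ← hH x s hsI]; ring
    have hxt : dx (dt u) θs s = k θs s ^ (p+1) * (dx u θs s + dx (dx (dx u)) θs s) := by
      have : HasDerivAt (fun x => dt u x s)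
          (k θs s ^ (p+1) * (dx u θs s + dx (dx (dx u)) θs s)) θs := by
        have h1 : HasDerivAt (fun x => k x s ^ (p+1) * (u x s + dx (dx u) x s)) _ θs :=
          (((h.sm.pow (p+1)).hdx hsI θs)).mul ((h.smV.hdx hsI θs).add (h.smV2.hdx hsI θs))
        rw [e3, mul_zero, zero_add] at h1
        exact h1.congr_of_eventuallyEq (Filter.Eventually.of_forall hdtu)
      exact this.deriv
    have ht1 : HasDerivAt (fun t => (u θs t ^ 2 + dx u θs t ^ 2) - ε * (t - t0))
        (2 * u θs s * dt u θs s + 2 * dx u θs s * dx (dt u) θs s - ε) s := by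
      have hd := h.smV1.hdt h.io hsI θs
      rw [h.smV.dt_dx h.io hsI θs] at hd
      refine ((((h.smV.hdt h.io hsI θs).pow 2).add (hd.pow 2)).sub
        (((hasDerivAt_id s).sub_const t0).const_mul ε)).congr_deriv ?_
      simp [← hu]
    have := deriv_nonneg_of_left_max ht1 hlt (fun t ht => by
      have := hmax θs t ⟨ht.1, ht.2.trans hs.2⟩; simpa using this)
    rw [hdtu, e3, mul_zero, mul_zero, zero_add, hxt] at this
    rw [e3, mul_zero, zero_add] at e2
    have hkp : 0 < k θs s ^ (p+1) := pow_pos (h.pos θs s hsI) _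
    nlinarith
  intro θ t ht
  refine le_of_forall_pos_le_add fun δ hδ => ?_
  have h1 := key (δ / (t - t0 + 1)) (by have := ht.1; positivity [show 0 < t - t0 + 1 by linarith]) θ t ht
  have h2 : δ / (t - t0 + 1) * (t - t0) ≤ δ := by
    have h3 : 0 < t - t0 + 1 := by linarith [ht.1]
    rw [div_mul_eq_mul_div, div_le_iff₀ h3]; nlinarith [ht.1]
  linarith
end Flow
lemma cos_compare {u u1 : ℝ → ℝ} {M x0 : ℝ} (hM : 0 < M) (hu : ∀ x, HasDerivAt u (u1 x) x)
    (hpos : ∀ x, 0 < u x)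
    (hg : ∀ x, u x ^ 2 + u1 x ^ 2 ≤ M ^ 2) (h0 : u x0 = M) {x : ℝ} (hx : |x - x0| ≤ π / 2) :
    M * Real.cos (x - x0) ≤ u x := by
  have key : ∀ N > M, N * Real.cos (|x - x0| + Real.arccos (M / N)) ≤ u x := by
    intro N hN
    have hN0 : 0 < N := hM.trans hN
    have huN : ∀ y, u y ≤ M := fun y => by
      have := hg y
      exact abs_le_of_sq_le_sq' (by nlinarith [sq_nonneg (u1 y)]) hM.le |>.2
    have hd : ∀ y ∈ (Set.univ : Set ℝ), HasDerivWithinAt (fun y => Real.arccos (u y / N))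
        (-(1 / √(1 - (u y / N) ^ 2)) * (u1 y / N)) Set.univ y := by
      intro y _
      have h1 : u y / N ≠ 1 := by
        have : u y / N < 1 := (div_lt_one hN0).2 ((huN y).trans_lt hN)
        exact this.ne
      have h2 : u y / N ≠ -1 := by
        have : 0 < u y / N := div_pos (hpos y) hN0
        linarith
      exact ((Real.hasDerivAt_arccos h2 h1).comp y ((hu y).div_const N)).hasDerivWithinAt
    have hb : ∀ y ∈ (Set.univ : Set ℝ), ‖-(1 / √(1 - (u y / N) ^ 2)) * (u1 y / N)‖ ≤ 1 := by
      intro y _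
      have h1 : u y / N < 1 := (div_lt_one hN0).2 ((huN y).trans_lt hN)
      have h2 : 0 < u y / N := div_pos (hpos y) hN0
      have h3 : 0 < 1 - (u y / N) ^ 2 := by nlinarith
      rw [norm_mul, norm_neg, Real.norm_eq_abs, Real.norm_eq_abs,
        abs_of_pos (by positivity : 0 < 1 / √(1 - (u y / N) ^ 2)), one_div, inv_mul_eq_div,
        div_le_one (Real.sqrt_pos.2 h3)]
      apply Real.abs_le_sqrt
      have := hg y
      rw [div_pow, div_pow, le_sub_iff_add_le, ← add_div, div_le_one (by positivity)]
      nlinarith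
    have hl := Convex.norm_image_sub_le_of_norm_hasDerivWithin_le hd hb convex_univ
      (Set.mem_univ x0) (Set.mem_univ x)
    simp only [Real.norm_eq_abs, one_mul, h0] at hl
    have h4 : Real.arccos (u x / N) ≤ |x - x0| + Real.arccos (M / N) := by
      have := (abs_le.1 hl).2; linarith
    have h5 : u x = N * Real.cos (Real.arccos (u x / N)) := by
      rw [Real.cos_arccos]
      · field_simp
      · have : 0 < u x / N := div_pos (hpos x) hN0
        linarith
      · exact ((div_lt_one hN0).2 ((huN x).trans_lt hN)).le
    have h6 : Real.arccos (M / N) ≤ π / 2 :=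
      Real.arccos_le_pi_div_two.2 (div_pos hM hN0).le
    rw [h5]
    refine mul_le_mul_of_nonneg_left ?_ hN0.le
    exact Real.cos_le_cos_of_nonneg_of_le_pi (Real.arccos_nonneg _) (by linarith) h4
  have hlim : Tendsto (fun N => N * Real.cos (|x - x0| + Real.arccos (M / N))) (𝓝[>] M)
      (𝓝 (M * Real.cos (|x - x0| + Real.arccos (M / M)))) := by
    apply Filter.Tendsto.mono_left _ nhdsWithin_le_nhds
    have : ContinuousAt (fun N => N * Real.cos (|x - x0| + Real.arccos (M / N))) M := by
      have h1 : ContinuousAt (fun N => M / N) M := continuousAt_const.div continuousAt_id hM.ne'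
      have h2 : ContinuousAt (fun N => Real.arccos (M / N)) M :=
        Real.continuous_arccos.continuousAt.comp h1
      exact continuousAt_id.mul (Real.continuous_cos.continuousAt.comp (continuousAt_const.add h2))
    exact this
  have := le_of_tendsto hlim (by filter_upwards [self_mem_nhdsWithin] with N hN using key N hN)
  rwa [div_self hM.ne', Real.arccos_one, add_zero, Real.cos_abs] at this
end PC
namespace PC
open scoped ContDiff Topology
noncomputable def F (p : ℕ) (k : ℝ → ℝ → ℝ) : ℝ → ℝ → ℝ :=
  fun θ t => (1 / (p:ℝ)) * (V p k θ t + dx (dx (V p k)) θ t)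
structure UF (p : ℕ) (T : ℝ) (k : ℝ → ℝ → ℝ) : Prop where
  hT : 0 < T
  fl : Flow p (Ioo 0 T) k (F p k)
  ccos : ∀ t ∈ Ioo 0 T, ∫ θ in (0:ℝ)..(2*π), Real.cos θ * (k θ t)⁻¹ = 0
  csin : ∀ t ∈ Ioo 0 T, ∫ θ in (0:ℝ)..(2*π), Real.sin θ * (k θ t)⁻¹ = 0
  blow : ∀ M, ∃ t1 ∈ Ioo 0 T, ∀ t ∈ Ioo t1 T, ∃ θ, M < k θ t
lemma int_shift {f : ℝ → ℝ} (hf : Function.Periodic f (2 * π)) (a b : ℝ)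
    (hab : b = a + 2 * π) :
    ∫ θ in a..b, f θ = ∫ θ in (0:ℝ)..(2*π), f θ := by
  subst hab
  have := hf.intervalIntegral_add_eq a 0
  simpa using this
lemma closing_shift {r : ℝ → ℝ} (hr : Continuous r)
    (hc : ∫ θ in (0:ℝ)..(2*π), Real.cos θ * r θ = 0)
    (hs : ∫ θ in (0:ℝ)..(2*π), Real.sin θ * r θ = 0) (θ0 : ℝ) :
    ∫ θ in (0:ℝ)..(2*π), Real.cos (θ - θ0) * r θ = 0 := by
  have : ∀ θ, Real.cos (θ - θ0) * r θ
      = Real.cos θ0 * (Real.cos θ * r θ) + Real.sin θ0 * (Real.sin θ * r θ) := by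
    intro θ; rw [Real.cos_sub]; ring
  simp_rw [this]
  rw [intervalIntegral.integral_add, intervalIntegral.integral_const_mul,
    intervalIntegral.integral_const_mul, hc, hs]
  · simp
  · exact Continuous.intervalIntegrable (by fun_prop) _ _
  · exact Continuous.intervalIntegrable (by fun_prop) _ _
lemma abscos_int {r : ℝ → ℝ} (hr : Continuous r) (hper : Function.Periodic r (2 * π))
    {K θ0 : ℝ} (hcl : ∫ θ in (0:ℝ)..(2*π), Real.cos (θ - θ0) * r θ = 0)
    (hnear : ∀ θ, |θ - θ0| ≤ π / 2 → Real.cos (θ - θ0) * r θ ≤ 1 / K) :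
    (∫ θ in (θ0 - π/2)..(θ0 + π/2), Real.cos (θ - θ0) * r θ) ≤ π / K ∧
    (∫ θ in (θ0 + π/2)..(θ0 + 3*π/2), -Real.cos (θ - θ0) * r θ) ≤ π / K := by
  have hpi := Real.pi_pos
  have hc : Continuous (fun θ => Real.cos (θ - θ0) * r θ) := by fun_prop
  have h1 : (∫ θ in (θ0 - π/2)..(θ0 + π/2), Real.cos (θ - θ0) * r θ) ≤ π / K := by
    have : (∫ θ in (θ0 - π/2)..(θ0 + π/2), Real.cos (θ - θ0) * r θ)
        ≤ ∫ θ in (θ0 - π/2)..(θ0 + π/2), 1 / K := by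
      apply intervalIntegral.integral_mono_on (by linarith) (hc.intervalIntegrable _ _)
        intervalIntegrable_const
      intro x hx
      exact hnear x (abs_le.2 ⟨by linarith [hx.1], by linarith [hx.2]⟩)
    refine this.trans_eq ?_
    rw [intervalIntegral.integral_const]; simp; ring
  refine ⟨h1, ?_⟩
  have hp : Function.Periodic (fun θ => Real.cos (θ - θ0) * r θ) (2 * π) := by
    intro θ
    simp only
    rw [hper θ, show θ + 2 * π - θ0 = (θ - θ0) + 2 * π by ring, Real.cos_add_two_pi]
  have h2 := int_shift hp (θ0 - π/2) (θ0 + 3*π/2) (by ring)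
  rw [hcl, ← intervalIntegral.integral_add_adjacent_intervals
    (hc.intervalIntegrable _ (θ0 + π/2)) (hc.intervalIntegrable _ _)] at h2
  have h3 : (∫ θ in (θ0 + π/2)..(θ0 + 3*π/2), -Real.cos (θ - θ0) * r θ)
      = - ∫ θ in (θ0 + π/2)..(θ0 + 3*π/2), Real.cos (θ - θ0) * r θ := by
    rw [← intervalIntegral.integral_neg]; simp
  rw [h3]; linarith
lemma concave_pos_lower {g : ℝ → ℝ} {t0 T : ℝ} (hg : ConcaveOn ℝ (Ico t0 T) g)
    (hpos : ∀ t ∈ Ico t0 T, 0 < g t) {t : ℝ} (ht : t ∈ Ico t0 T) :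
    g t0 * (T - t) / (T - t0) ≤ g t := by
  rcases ht.1.eq_or_lt with rfl | hlt
  · rw [mul_div_assoc, div_self (by linarith [ht.2]), mul_one]
  have key : ∀ s ∈ Ioo t T, g t0 * (s - t) / (s - t0) ≤ g t := by
    intro s hs
    have h1 := hg.slope_anti_adjacent ⟨le_rfl, by linarith [ht.2]⟩
      (⟨by linarith [hs.1], hs.2⟩ : s ∈ Ico t0 T) hlt hs.1
    have hs0 := hpos s ⟨by linarith [hs.1], hs.2⟩
    rw [div_le_div_iff₀ (by linarith [hs.1]) (by linarith)] at h1
    rw [div_le_iff₀ (by linarith [hs.1])]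
    nlinarith [mul_pos hs0 (sub_pos.2 hlt)]
  have hc : ContinuousAt (fun s => g t0 * (s - t) / (s - t0)) T := by
    apply ContinuousAt.div (by fun_prop) (by fun_prop); linarith [ht.2]
  exact le_of_tendsto (hc.tendsto.mono_left (nhdsWithin_le_nhds (s := Iio T)))
    (by filter_upwards [Ioo_mem_nhdsLT ht.2] with s hs using key s hs)
namespace UF
variable {p : ℕ} {T : ℝ} {k : ℝ → ℝ → ℝ} (h : UF p T k)
include h
lemma pH (θ t : ℝ) : p * F p k θ t = V p k θ t + dx (dx (V p k)) θ t := by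
  have := h.fl.hp
  unfold F; field_simp
lemma rper {t : ℝ} (ht : t ∈ Ioo 0 T) : Function.Periodic (fun θ => (k θ t)⁻¹) (2*π) := by
  intro θ; simp only; rw [h.fl.per θ t ht]
lemma good : ∃ K0 > 0, ∀ t ∈ Ico (T/2) T, ∃ s ∈ Icc (T/2) t, ∃ θ0,
    (∀ θ, ∀ x ∈ Icc (T/2) t, k θ x ≤ k θ0 s) ∧
    (K0 ≤ k θ0 s → (∀ θ, ∀ x ∈ Icc (T/2) t, V p k θ x ^ 2 + dx (V p k) θ x ^ 2 ≤ ((k θ0 s)^p)^2) ∧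
      ∀ θ, |θ - θ0| ≤ π / 2 → k θ0 s * Real.cos (θ - θ0) ≤ k θ s) := by
  have hT := h.hT
  have hfl := h.fl
  have hsub : ∀ t ∈ Ico (T/2) T, Icc (T/2) t ⊆ Ioo 0 T := fun t ht x hx =>
    ⟨by linarith [hx.1], by linarith [hx.2, ht.2]⟩
  have smw : SM (Ioo 0 T) (fun θ t => V p k θ t ^ 2 + dx (V p k) θ t ^ 2) :=
    (hfl.smV.pow 2).add (hfl.smV1.pow 2)
  have hs0 := hsub (T/2) ⟨le_rfl, by linarith⟩
  obtain ⟨a, b, -, hab⟩ := exists_max (g := fun θ t => V p k θ t ^ 2 + dx (V p k) θ t ^ 2)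
    (le_refl (T/2)) (smw.contOn.mono (Set.prod_mono le_rfl hs0))
    (fun θ t ht => by simp only [hfl.perV θ t (hs0 ht), hfl.perV.dx θ t (hs0 ht)])
  set B := V p k a b ^ 2 + dx (V p k) a b ^ 2 with hB
  have hB0 : 0 ≤ B := by positivity
  refine ⟨B + 1, by positivity, fun t ht => ?_⟩
  obtain ⟨θ0, s, hs, hm⟩ := exists_max ht.1 (hfl.sm.contOn.mono (Set.prod_mono le_rfl (hsub t ht)))
    (fun θ x hx => hfl.per θ x (hsub t ht hx))
  refine ⟨s, hs, θ0, hm, fun hK => ?_⟩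
  set K := k θ0 s with hKdef
  have hK1 : 1 ≤ K := by linarith
  have hKp : K ≤ K ^ p := le_self_pow₀ hK1 (by have := hfl.hp; omega)
  have hp1 : 1 ≤ p := hfl.hp
  have hg := hfl.grad (fun θ t _ => h.pH θ t) (hsub t ht) ht.1 (M := K ^ p)
    (fun θ x hx => pow_le_pow_left₀ (hfl.pos θ x (hsub t ht hx)).le (hm θ x hx) p)
    (fun θ => (hab θ (T/2) ⟨le_rfl, le_rfl⟩).trans (by nlinarith))
  refine ⟨hg, fun θ hθ => ?_⟩
  have hsI := hsub t ht hs
  have hK0 : 0 < K := by linarith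
  have := cos_compare (u := fun x => V p k x s) (pow_pos hK0 p) (fun x => hfl.smV.hdx hsI x)
    (fun x => pow_pos (hfl.pos x s hsI) p) (fun x => hg x s hs) (x0 := θ0) rfl hθ
  have hc0 : 0 ≤ Real.cos (θ - θ0) :=
    Real.cos_nonneg_of_neg_pi_div_two_le_of_le (by linarith [(abs_le.1 hθ).1]) (abs_le.1 hθ).2
  have hc1 := Real.cos_le_one (θ - θ0)
  have h2 : Real.cos (θ - θ0) ^ p ≤ Real.cos (θ - θ0) := pow_le_of_le_one hc0 hc1 (by omega)
  have h3 : (K * Real.cos (θ - θ0)) ^ p ≤ k θ s ^ p := by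
    rw [mul_pow]
    exact (mul_le_mul_of_nonneg_left h2 (by positivity)).trans this
  exact le_of_pow_le_pow_left₀ (by omega) (hfl.pos θ s hsI).le h3
end UF
end PC
namespace PC
open scoped ContDiff Topology
lemma cs_w {w a b : ℝ → ℝ} {x y : ℝ} (hxy : x ≤ y) (hw : Continuous w) (ha : Continuous a)
    (hb : Continuous b) (hw0 : ∀ θ, 0 ≤ w θ) :
    (∫ θ in x..y, w θ * a θ * b θ) ^ 2
      ≤ (∫ θ in x..y, w θ * a θ ^ 2) * ∫ θ in x..y, w θ * b θ ^ 2 := by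
  have key : ∀ z : ℝ, 0 ≤ (∫ θ in x..y, w θ * a θ ^ 2) * (z * z)
      + (2 * ∫ θ in x..y, w θ * a θ * b θ) * z + ∫ θ in x..y, w θ * b θ ^ 2 := by
    intro z
    have h1 : 0 ≤ ∫ θ in x..y, w θ * (z * a θ + b θ) ^ 2 :=
      intervalIntegral.integral_nonneg hxy fun θ _ => mul_nonneg (hw0 θ) (sq_nonneg _)
    have h2 : ∫ θ in x..y, w θ * (z * a θ + b θ) ^ 2
        = (∫ θ in x..y, (z*z) * (w θ * a θ ^ 2)) + (∫ θ in x..y, (2 * z) * (w θ * a θ * b θ))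
          + ∫ θ in x..y, w θ * b θ ^ 2 := by
      rw [← intervalIntegral.integral_add, ← intervalIntegral.integral_add]
      · congr 1; funext θ; ring
      all_goals exact Continuous.intervalIntegrable (by fun_prop) _ _
    rw [h2, intervalIntegral.integral_const_mul, intervalIntegral.integral_const_mul] at h1
    linarith
  have := discrim_le_zero key
  unfold discrim at this
  nlinarith
namespace UF
variable {p : ℕ} {T : ℝ} {k : ℝ → ℝ → ℝ} (h : UF p T k)
include h
lemma energy : ∃ E E' : ℝ → ℝ, ∀ t ∈ Ioo 0 T, HasDerivAt E (E' t) t ∧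
    (∫ θ in (0:ℝ)..(2*π), k θ t ^ p * F p k θ t = (2 / p) * E t) ∧
    4 * E t ^ 2 ≤ (∫ θ in (0:ℝ)..(2*π), k θ t ^ (p-1)) * E' t := by
  have hfl := h.fl
  have hp1 : 1 ≤ p := hfl.hp
  have hp0 : (0:ℝ) < p := by exact_mod_cast hp1
  refine ⟨_, _, fun t ht => ⟨hfl.hint_E ht, ?_, ?_⟩⟩
  · have := hfl.int_vv ht
    rw [div_mul_eq_mul_div, ← this, eq_div_iff hp0.ne', mul_comm,
      ← intervalIntegral.integral_const_mul]
    congr 1; funext θ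
    rw [← h.pH]; unfold V; ring
  · have e1 : ∫ θ in (0:ℝ)..(2*π), k θ t ^ p * F p k θ t
        = (2 / p) * ∫ θ in (0:ℝ)..(2*π), ((V p k θ t)^2 - (dx (V p k) θ t)^2) / 2 := by
      have := hfl.int_vv ht
      rw [div_mul_eq_mul_div, ← this, eq_div_iff hp0.ne', mul_comm,
        ← intervalIntegral.integral_const_mul]
      congr 1; funext θ
      rw [← h.pH]; unfold V; ring
    have hck := hfl.sm.cont ht
    have hcF := hfl.smH.cont ht
    have c := cs_w (w := fun θ => k θ t ^ (p-1)) (a := fun _ => 1) (b := fun θ => k θ t * F p k θ t)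
      two_pi_pos'.le (by fun_prop) (by fun_prop) (by fun_prop)
      (fun θ => pow_nonneg (hfl.pos θ t ht).le _)
    have e2 : ∀ θ, k θ t ^ (p-1) * 1 * (k θ t * F p k θ t) = k θ t ^ p * F p k θ t := by
      intro θ
      obtain ⟨m, rfl⟩ : ∃ m, p = m + 1 := ⟨p - 1, by omega⟩
      simp; ring
    simp only [e2] at c
    rw [e1] at c
    have e3 : (p:ℝ) * ∫ θ in (0:ℝ)..(2*π),
        (V p k θ t + dx (dx (V p k)) θ t) * (k θ t ^ (p+1) * F p k θ t)
        = p ^ 2 * ∫ θ in (0:ℝ)..(2*π), k θ t ^ (p-1) * (k θ t * F p k θ t) ^ 2 := by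
      rw [← intervalIntegral.integral_const_mul, ← intervalIntegral.integral_const_mul]
      congr 1; funext θ
      rw [← h.pH]
      obtain ⟨m, rfl⟩ : ∃ m, p = m + 1 := ⟨p - 1, by omega⟩
      simp; ring
    rw [e3]
    simp only [one_pow, mul_one] at c
    set E := ∫ θ in (0:ℝ)..(2*π), ((V p k θ t)^2 - (dx (V p k) θ t)^2) / 2
    have : (2 / (p:ℝ) * E) ^ 2 * p ^ 2 = 4 * E ^ 2 := by field_simp; ring
    rw [← this]
    calc _ ≤ _ := mul_le_mul_of_nonneg_right c (by positivity)
      _ = _ := by ring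
lemma abscos {s θ0 : ℝ} (hs : s ∈ Ioo 0 T)
    (hc : ∀ θ, |θ - θ0| ≤ π / 2 → k θ0 s * Real.cos (θ - θ0) ≤ k θ s) :
    (∫ θ in (θ0 - π/2)..(θ0 + π/2), Real.cos (θ - θ0) * (k θ s)⁻¹) ≤ π / k θ0 s ∧
    (∫ θ in (θ0 + π/2)..(θ0 + 3*π/2), -Real.cos (θ - θ0) * (k θ s)⁻¹)
      ≤ π / k θ0 s := by
  have hfl := h.fl
  refine abscos_int (hfl.smInv.cont hs) (h.rper hs)
    (closing_shift (hfl.smInv.cont hs) (h.ccos s hs) (h.csin s hs) θ0) fun θ hθ => ?_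
  have h1 := hfl.pos θ s hs
  have h2 := hfl.pos θ0 s hs
  rw [← div_eq_mul_inv, div_le_div_iff₀ h1 h2]
  linarith [hc θ hθ]
lemma typeI_aux : ∃ g : ℝ → ℝ, ∃ c > 0, ConcaveOn ℝ (Ico (T/2) T) g ∧ (∀ t ∈ Ico (T/2) T, 0 < g t) ∧
    ∀ s ∈ Ico (T/2) T, ∀ θ0,
      (∀ θ, |θ - θ0| ≤ π / 2 → k θ0 s * Real.cos (θ - θ0) ≤ k θ s) →
      g s * k θ0 s ^ (p+1) ≤ c := by
  have hfl := h.fl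
  have hT := h.hT
  have hp1 : 1 ≤ p := hfl.hp
  have hpi := Real.pi_pos
  obtain ⟨E, E', hE⟩ := h.energy
  have hsub : Ico (T/2) T ⊆ Ioo 0 T := fun x hx => ⟨by linarith [hx.1], hx.2⟩
  have hsub' : Ioo (T/2) T ⊆ Ioo 0 T := fun x hx => ⟨by linarith [hx.1], hx.2⟩
  have scheme : ∀ g B B' : ℝ → ℝ, ∀ c : ℝ, 0 ≤ c → (∀ t ∈ Ioo 0 T, HasDerivAt g (-c * B t) t) →
      (∀ t ∈ Ioo 0 T, HasDerivAt B (B' t) t) → (∀ t ∈ Ioo 0 T, 0 ≤ B' t) →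
      ConcaveOn ℝ (Ico (T/2) T) g := by
    intro g B B' c hc hg hB hB'
    have hmono : MonotoneOn B (Ioo 0 T) := by
      refine monotoneOn_of_deriv_nonneg (convex_Ioo _ _)
        (fun x hx => (hB x hx).continuousAt.continuousWithinAt) ?_ ?_
      · rw [interior_Ioo]; exact fun x hx => (hB x hx).differentiableAt.differentiableWithinAt
      · rw [interior_Ioo]; intro x hx; rw [(hB x hx).deriv]; exact hB' x hx
    refine AntitoneOn.concaveOn_of_deriv (convex_Ico _ _)
      (fun x hx => (hg x (hsub hx)).continuousAt.continuousWithinAt) ?_ ?_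
    · rw [interior_Ico]
      exact fun x hx => (hg x (hsub' hx)).differentiableAt.differentiableWithinAt
    · rw [interior_Ico]
      intro x hx y hy hxy
      rw [(hg x (hsub' hx)).deriv, (hg y (hsub' hy)).deriv]
      have := hmono (hsub' hx) (hsub' hy) hxy
      nlinarith
  rcases hp1.eq_or_lt with hp | hp2
  ·
    subst hp
    simp only [Nat.cast_one, pow_one, div_one, Nat.sub_self, pow_zero,
      intervalIntegral.integral_const, smul_eq_mul, mul_one, sub_zero] at hE
    set Y : ℝ → ℝ := fun s => ∫ θ in (0:ℝ)..(2*π), Real.log (k θ s) with hY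
    have hYd : ∀ t ∈ Ioo 0 T, HasDerivAt Y (2 * E t) t := fun t ht => by
      have := hfl.hint_log ht
      rwa [(hE t ht).2.1] at this
    have hexp : ∀ t ∈ Ioo 0 T, HasDerivAt (fun t => rexp (-(Y t) / π))
        (rexp (-(Y t) / π) * (-(2 * E t) / π)) t := fun t ht =>
      (((hYd t ht).neg).div_const _).exp
    set L : ℝ := ∫ x in (-(π/2))..(3*π/2), Real.log (Real.cos x) with hL
    refine ⟨fun t => rexp (-(Y t) / π), rexp (-L/π), Real.exp_pos _, ?_,
      fun t _ => Real.exp_pos _, ?_⟩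
    · refine scheme _ (fun t => rexp (-(Y t) / π) * E t)
        (fun t => rexp (-(Y t) / π) * (E' t - 2 * E t ^ 2 / π)) (2 / π)
        (by positivity) ?_ ?_ ?_
      · intro t ht
        exact (hexp t ht).congr_deriv (by ring)
      · intro t ht
        exact ((hexp t ht).mul (hE t ht).1).congr_deriv (by ring)
      · intro t ht
        refine mul_nonneg (Real.exp_pos _).le ?_
        rw [sub_nonneg, div_le_iff₀ hpi]
        linarith [(hE t ht).2.2]
    · intro s hs θ0 hc
      have hsI := hsub hs
      obtain ⟨a1, a2⟩ := h.abscos hsI hc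
      set K := k θ0 s with hK
      have hK0 : 0 < K := hfl.pos θ0 s hsI
      have hpt : ∀ θ, ∀ e : ℝ, (e = 1 ∨ e = -1) → 0 < e * Real.cos (θ - θ0) →
          Real.log (Real.cos (θ - θ0)) + Real.log K + 1 - K * (e * Real.cos (θ - θ0) * (k θ s)⁻¹)
            ≤ Real.log (k θ s) := by
        intro θ e he hpos
        have hkp := hfl.pos θ s hsI
        have h1 := Real.log_le_sub_one_of_pos
          (show 0 < K * (e * Real.cos (θ - θ0) * (k θ s)⁻¹) by positivity)
        rw [Real.log_mul hK0.ne' (by positivity), Real.log_mul hpos.ne' (by positivity),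
          Real.log_inv] at h1
        have h2 : Real.log (e * Real.cos (θ - θ0)) = Real.log (Real.cos (θ - θ0)) := by
          rcases he with rfl | rfl
          · simp
          · rw [neg_one_mul, Real.log_neg_eq_log]
        linarith
      have hck := hfl.sm.cont hsI
      have hri := hfl.smInv.cont hsI
      have hlogc : Continuous fun θ => Real.log (k θ s) :=
        (hfl.sm.log fun θ t ht => (hfl.pos θ t ht).ne').cont hsI
      have hli : ∀ a b, IntervalIntegrable (fun θ => Real.log (Real.cos (θ - θ0))) volume a b := by
        intro a b
        have := (intervalIntegrable_log_cos (a := a - θ0) (b := b - θ0)).comp_sub_right θ0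
        simpa using this
      have hci : ∀ e a b : ℝ, IntervalIntegrable
          (fun θ => K * (e * Real.cos (θ - θ0) * (k θ s)⁻¹)) volume a b :=
        fun e a b => Continuous.intervalIntegrable (by fun_prop) _ _
      have hint : ∀ e a b : ℝ, (e = 1 ∨ e = -1) → a ≤ b →
          (∀ θ ∈ Ioo a b, 0 < e * Real.cos (θ - θ0)) →
          (∫ θ in a..b, Real.log (Real.cos (θ - θ0))) + (b - a) * (Real.log K + 1)
            - K * (∫ θ in a..b, e * Real.cos (θ - θ0) * (k θ s)⁻¹)
            ≤ ∫ θ in a..b, Real.log (k θ s) := by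
        intro e a b he hab hpos
        have := intervalIntegral.integral_mono_on_of_le_Ioo hab
          (((hli a b).add (intervalIntegrable_const (c := Real.log K + 1))).sub (hci e a b))
          (hlogc.intervalIntegrable a b)
          (fun θ hθ => by
            have := hpt θ e he (hpos θ hθ)
            linarith)
        refine le_trans (le_of_eq ?_) this
        rw [← intervalIntegral.integral_const_mul]
        have e1 := intervalIntegral.integral_sub
          ((hli a b).add (intervalIntegrable_const (c := Real.log K + 1))) (hci e a b)
        have e2 := intervalIntegral.integral_add (hli a b)
          (intervalIntegrable_const (μ := volume) (c := Real.log K + 1))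
        rw [intervalIntegral.integral_const, smul_eq_mul] at e2
        rw [← e2, ← e1]
      have b1 := hint 1 (θ0 - π/2) (θ0 + π/2) (Or.inl rfl) (by linarith)
        (fun θ hθ => by
          rw [one_mul]
          exact Real.cos_pos_of_mem_Ioo ⟨by linarith [hθ.1], by linarith [hθ.2]⟩)
      have b2 := hint (-1) (θ0 + π/2) (θ0 + 3*π/2) (Or.inr rfl) (by linarith)
        (fun θ hθ => by
          rw [neg_one_mul, neg_pos]
          exact Real.cos_neg_of_pi_div_two_lt_of_lt (by linarith [hθ.1]) (by linarith [hθ.2]))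
      simp only [one_mul, neg_one_mul] at b1 b2
      have hYs : (∫ θ in (θ0 - π/2)..(θ0 + π/2), Real.log (k θ s)) +
          (∫ θ in (θ0 + π/2)..(θ0 + 3*π/2), Real.log (k θ s)) = Y s := by
        rw [intervalIntegral.integral_add_adjacent_intervals (hlogc.intervalIntegrable _ _)
          (hlogc.intervalIntegrable _ _)]
        exact int_shift (f := fun θ => Real.log (k θ s))
          (fun θ => by simp only; rw [hfl.per θ s hsI]) _ _ (by ring)
      have hLs : (∫ θ in (θ0 - π/2)..(θ0 + π/2), Real.log (Real.cos (θ - θ0))) +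
          (∫ θ in (θ0 + π/2)..(θ0 + 3*π/2), Real.log (Real.cos (θ - θ0))) = L := by
        rw [intervalIntegral.integral_add_adjacent_intervals (hli _ _) (hli _ _),
          intervalIntegral.integral_comp_sub_right (fun x => Real.log (Real.cos x)) θ0, hL]
        congr 1 <;> ring
      have a1' : K * (∫ θ in (θ0 - π/2)..(θ0 + π/2), Real.cos (θ - θ0) * (k θ s)⁻¹)
          ≤ π := by
        rw [le_div_iff₀ hK0] at a1; linarith
      have a2' : K * (∫ θ in (θ0 + π/2)..(θ0 + 3*π/2),
          -Real.cos (θ - θ0) * (k θ s)⁻¹) ≤ π := by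
        rw [le_div_iff₀ hK0] at a2; linarith
      have hfin : L + 2 * π * Real.log K ≤ Y s := by
        rw [← hYs, ← hLs]; nlinarith
      have : rexp (-(Y s) / π) ≤ rexp (-L/π - 2 * Real.log K) := by
        apply Real.exp_le_exp.2
        rw [div_le_iff₀ hpi, sub_mul, div_mul_cancel₀ _ hpi.ne']
        linarith
      calc rexp (-(Y s) / π) * K ^ (1+1)
          ≤ rexp (-L/π - 2 * Real.log K) * K ^ (1+1) :=
            mul_le_mul_of_nonneg_right this (by positivity)
        _ = rexp (-L/π) := by
            rw [Real.exp_sub, show rexp (2 * Real.log K) = K ^ (1+1) by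
              rw [mul_comm, Real.exp_mul, Real.exp_log hK0]; norm_num]
            field_simp
  ·
    set Y : ℝ → ℝ := fun s => ∫ θ in (0:ℝ)..(2*π), k θ s ^ (p-1) with hY
    have hpr : (0:ℝ) < (p:ℝ) - 1 := by
      have : (2:ℝ) ≤ p := by exact_mod_cast hp2
      linarith
    have hp0 : (0:ℝ) < p := by linarith
    have hcast : ((p - 1 : ℕ) : ℝ) = (p:ℝ) - 1 := by push_cast [hp1]; ring
    have hYd : ∀ t ∈ Ioo 0 T, HasDerivAt Y (2 * (p-1) / p * E t) t := fun t ht => by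
      have := hfl.hint_pow (p-1) ht
      rw [Nat.sub_add_cancel hp1, (hE t ht).2.1, hcast] at this
      exact this.congr_deriv (by ring)
    have hYpos : ∀ t ∈ Ioo 0 T, 0 < Y t := fun t ht =>
      intervalIntegral.intervalIntegral_pos_of_pos
        (((hfl.sm.pow (p-1)).cont ht).intervalIntegrable _ _)
        (fun θ => pow_pos (hfl.pos θ t ht) _) two_pi_pos'
    have hrp : ∀ a : ℝ, ∀ t ∈ Ioo 0 T, HasDerivAt (fun t => Y t ^ a)
        (2 * (p-1) / p * E t * a * Y t ^ (a - 1)) t := fun a t ht =>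
      (hYd t ht).rpow_const (Or.inl (hYpos t ht).ne')
    set a : ℝ := -((p:ℝ)+1)/(p-1) with ha
    have ha0 : a ≤ 0 := by
      rw [ha]; apply div_nonpos_of_nonpos_of_nonneg <;> linarith
    have ha1 : a - 1 = -(2 * p) / (p - 1) := by rw [ha]; field_simp; ring
    set c1 : ℝ := 2 * π / 3 * (1/2)^(p-1) with hc1
    have hc1pos : 0 < c1 := by positivity
    refine ⟨fun t => Y t ^ a, c1 ^ a, Real.rpow_pos_of_pos hc1pos _, ?_,
      fun t ht => Real.rpow_pos_of_pos (hYpos t (hsub ht)) _, ?_⟩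
    · refine scheme _ (fun t => Y t ^ (a-1) * E t)
        (fun t => Y t ^ (a - 1 - 1) * (Y t * E' t - 4 * E t ^ 2)) (2 * (p+1) / p)
        (by positivity) ?_ ?_ ?_
      · intro t ht
        refine (hrp a t ht).congr_deriv ?_
        rw [ha]; field_simp
      · intro t ht
        refine ((hrp (a-1) t ht).mul (hE t ht).1).congr_deriv ?_
        have : Y t ^ (a - 1) = Y t ^ (a - 1 - 1) * Y t := by
          rw [← Real.rpow_add_one (hYpos t ht).ne']; ring_nf
        rw [this, ha1]; field_simp; ring
      · intro t ht
        exact mul_nonneg (Real.rpow_pos_of_pos (hYpos t ht) _).le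
          (sub_nonneg.2 (hE t ht).2.2)
    · intro s hs θ0 hc
      have hsI := hsub hs
      set K := k θ0 s with hK
      have hK0 : 0 < K := hfl.pos θ0 s hsI
      have hYge : c1 * K ^ (p-1) ≤ Y s := by
        have hcont := (hfl.sm.pow (p-1)).cont hsI
        have e1 : Y s = ∫ θ in (θ0 - π)..(θ0 + π), k θ s ^ (p-1) :=
          (int_shift (f := fun θ => k θ s ^ (p-1))
            (fun θ => by simp only; rw [hfl.per θ s hsI]) _ _ (by ring)).symm
        rw [e1]
        have e2 : ∫ θ in (θ0 - π/3)..(θ0 + π/3), (K/2) ^ (p-1)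
            ≤ ∫ θ in (θ0 - π/3)..(θ0 + π/3), k θ s ^ (p-1) := by
          refine intervalIntegral.integral_mono_on (by linarith) intervalIntegrable_const
            (hcont.intervalIntegrable _ _) fun θ hθ => ?_
          refine pow_le_pow_left₀ (by positivity) ?_ _
          have habs : |θ - θ0| ≤ π / 3 := abs_le.2 ⟨by linarith [hθ.1], by linarith [hθ.2]⟩
          have h1 := hc θ (habs.trans (by linarith))
          have h2 : 1/2 ≤ Real.cos (θ - θ0) := by
            rw [← Real.cos_abs, ← Real.cos_pi_div_three]
            exact Real.cos_le_cos_of_nonneg_of_le_pi (abs_nonneg _) (by linarith) habs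
          nlinarith
        have e3 := intervalIntegral.integral_mono_interval (μ := volume)
          (c := θ0 - π) (d := θ0 + π)
          (a := θ0 - π/3) (b := θ0 + π/3) (f := fun θ => k θ s ^ (p-1))
          (by linarith) (by linarith) (by linarith)
          (Filter.Eventually.of_forall fun θ => pow_nonneg (hfl.pos θ s hsI).le _)
          (hcont.intervalIntegrable _ _)
        refine le_trans (le_of_eq ?_) (e2.trans e3)
        rw [intervalIntegral.integral_const, smul_eq_mul, hc1, div_pow, div_pow, one_pow]; ring
      have h1 : Y s ^ a ≤ (c1 * K ^ (p-1)) ^ a :=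
        Real.rpow_le_rpow_of_nonpos (by positivity) hYge ha0
      have h2 : (c1 * K ^ (p-1)) ^ a * K ^ (p+1) = c1 ^ a := by
        rw [Real.mul_rpow hc1pos.le (by positivity), ← Real.rpow_natCast K (p-1),
          ← Real.rpow_mul hK0.le, ← Real.rpow_natCast K (p+1), mul_assoc,
          ← Real.rpow_add hK0, hcast, ha]
        have : ((p:ℝ) - 1) * (-((p:ℝ)+1)/(p-1)) + ((p+1 : ℕ):ℝ) = 0 := by
          push_cast; field_simp; ring
        rw [this, Real.rpow_zero, mul_one]
      calc Y s ^ a * K ^ (p+1) ≤ _ := mul_le_mul_of_nonneg_right h1 (by positivity)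
        _ = _ := h2
lemma typeI : ∃ C > 0, ∀ t ∈ Ico (T/2) T, ∀ θ, k θ t ^ (p+1) * (T - t) ≤ C := by
  obtain ⟨K0, hK0, hgood⟩ := h.good
  obtain ⟨g, c, hc, hconc, hpos, hg⟩ := h.typeI_aux
  have hT := h.hT
  have hg0 := hpos (T/2) ⟨le_rfl, by linarith⟩
  refine ⟨K0 ^ (p+1) * T + c * T / g (T/2), by positivity, fun t ht θ => ?_⟩
  obtain ⟨s, hs, θ0, hm, hbig⟩ := hgood t ht
  have htI : t ∈ Ioo 0 T := ⟨by linarith [ht.1], ht.2⟩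
  have hsI : s ∈ Ico (T/2) T := ⟨hs.1, hs.2.trans_lt ht.2⟩
  have hk0 := h.fl.pos θ t htI
  have hle := hm θ t ⟨ht.1, le_rfl⟩
  have hTt : 0 < T - t := sub_pos.2 ht.2
  rcases le_total K0 (k θ0 s) with hK | hK
  · have h1 := hg s hsI θ0 (hbig hK).2
    have h2 := concave_pos_lower hconc hpos hsI
    have hK1 : 0 < k θ0 s := hK0.trans_le hK
    have h3 : k θ0 s ^ (p+1) * (T - s) ≤ c * T / g (T/2) := by
      rw [le_div_iff₀ hg0]
      rw [div_le_iff₀ (by linarith)] at h2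
      have : g s * (T - T/2) ≤ g s * T := mul_le_mul_of_nonneg_left (by linarith) (hpos s hsI).le
      calc _ = (g (T/2) * (T - s)) * k θ0 s ^ (p+1) := by ring
        _ ≤ (g s * T) * k θ0 s ^ (p+1) :=
          mul_le_mul_of_nonneg_right (h2.trans this) (by positivity)
        _ = (g s * k θ0 s ^ (p+1)) * T := by ring
        _ ≤ _ := mul_le_mul_of_nonneg_right h1 hT.le
    calc k θ t ^ (p+1) * (T - t) ≤ k θ0 s ^ (p+1) * (T - s) := by
          apply mul_le_mul (pow_le_pow_left₀ hk0.le hle _) (by linarith [hs.2]) hTt.le (by positivity)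
      _ ≤ _ := h3
      _ ≤ _ := le_add_of_nonneg_left (by positivity)
  · calc k θ t ^ (p+1) * (T - t) ≤ K0 ^ (p+1) * T := by
          apply mul_le_mul (pow_le_pow_left₀ hk0.le (hle.trans hK) _) (by linarith [htI.1]) hTt.le
            (by positivity)
      _ ≤ _ := le_add_of_nonneg_right (by positivity)
end UF
end PC
namespace PC
open scoped ContDiff Topology
noncomputable def sg (p : ℕ) (T t : ℝ) : ℝ := (T - t) ^ ((1:ℝ) / ((p:ℝ) + 1))
lemma sg_pos {p : ℕ} {T t : ℝ} (h : t < T) : 0 < sg p T t := Real.rpow_pos_of_pos (sub_pos.2 h) _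
lemma sg_pow {p : ℕ} {T t : ℝ} (h : t < T) : sg p T t ^ (p+1) = T - t := by
  unfold sg
  rw [← Real.rpow_natCast, ← Real.rpow_mul (sub_pos.2 h).le]
  have : (1:ℝ) / ((p:ℝ) + 1) * ((p+1 : ℕ) : ℝ) = 1 := by push_cast; field_simp
  rw [this, Real.rpow_one]
lemma sg_anti {p : ℕ} {T t s : ℝ} (hs : s < T) (h : t ≤ s) : sg p T s ≤ sg p T t :=
  Real.rpow_le_rpow (sub_pos.2 hs).le (by linarith) (by positivity)
lemma sg_deriv {p : ℕ} {T t : ℝ} (h : t < T) :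
    HasDerivAt (sg p T) (-(1 / ((p:ℝ)+1)) * (1 / sg p T t ^ p)) t := by
  have h1 : HasDerivAt (fun t => T - t) (-1) t := by
    simpa using (hasDerivAt_id t).const_sub T
  have h2 := h1.rpow_const (p := (1:ℝ) / ((p:ℝ) + 1)) (Or.inl (sub_pos.2 h).ne')
  refine h2.congr_deriv ?_
  rw [Real.rpow_sub_one (sub_pos.2 h).ne']
  have h3 := sg_pow (p := p) h
  have h4 := sg_pos (p := p) h
  change -1 * (1 / ((p:ℝ)+1)) * (sg p T t / (T - t)) = _
  rw [← h3, pow_succ]; field_simp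
namespace UF
variable {p : ℕ} {T : ℝ} {k : ℝ → ℝ → ℝ} (h : UF p T k)
include h
lemma bounds : ∃ C ≥ 1, ∃ t1 ∈ Ioo 0 T, ∀ t ∈ Ioo t1 T, ∀ θ, k θ t * sg p T t ≤ C ∧
    |dx (V p k) θ t| * sg p T t ^ p ≤ C ^ p := by
  have hT := h.hT
  have hfl := h.fl
  obtain ⟨C, hC, hI⟩ := h.typeI
  obtain ⟨K0, hK0, hgood⟩ := h.good
  obtain ⟨t1, ht1, hbl⟩ := h.blow K0
  have hb : ∀ t ∈ Ico (T/2) T, ∀ θ, k θ t * sg p T t ≤ C + 1 := by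
    intro t ht θ
    have h1 := hI t ht θ
    have htI : t ∈ Ioo 0 T := ⟨by linarith [ht.1], ht.2⟩
    rw [← sg_pow ht.2, ← mul_pow] at h1
    by_contra! hlt
    have h2 : 1 ≤ k θ t * sg p T t := by linarith
    have := le_self_pow₀ h2 (show p + 1 ≠ 0 by omega)
    linarith
  refine ⟨C + 1, by linarith, max t1 (T/2), ⟨lt_max_of_lt_left ht1.1, max_lt ht1.2 (by linarith)⟩,
    fun t ht θ => ?_⟩
  have ht2 : t ∈ Ico (T/2) T := ⟨((le_max_right _ _).trans_lt ht.1).le, ht.2⟩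
  refine ⟨hb t ht2 θ, ?_⟩
  obtain ⟨s, hs, θ0, hm, hbig⟩ := hgood t ht2
  obtain ⟨y, hy⟩ := hbl t ⟨(le_max_left _ _).trans_lt ht.1, ht.2⟩
  have hK := hy.le.trans (hm y t ⟨ht2.1, le_rfl⟩)
  have h1 := (hbig hK).1 θ t ⟨ht2.1, le_rfl⟩
  have hK1 : 0 < k θ0 s := hK0.trans_le hK
  have h2 : |dx (V p k) θ t| ≤ k θ0 s ^ p := by
    apply abs_le_of_sq_le_sq _ (by positivity)
    nlinarith [sq_nonneg (V p k θ t)]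
  have hsg := sg_pos (p := p) ht.2
  have h3 : k θ0 s * sg p T t ≤ C + 1 := by
    have := hb s ⟨hs.1, hs.2.trans_lt ht.2⟩ θ0
    have h4 := sg_anti (p := p) ht.2 hs.2
    nlinarith
  calc _ ≤ k θ0 s ^ p * sg p T t ^ p := mul_le_mul_of_nonneg_right h2 (by positivity)
    _ = (k θ0 s * sg p T t) ^ p := by rw [mul_pow]
    _ ≤ _ := pow_le_pow_left₀ (by positivity) h3 p
lemma width_deriv (e : ℝ) {t : ℝ} (ht : t ∈ Ioo 0 T) :
    HasDerivAt (fun s => ∫ θ in (e - π/2)..(e + π/2), Real.cos (θ - e) * (k θ s)⁻¹)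
      (- ((1/(p:ℝ)) * (V p k (e + π/2) t + V p k (e - π/2) t))) t := by
  have hfl := h.fl
  refine (hfl.hint_inv (φ := fun θ => Real.cos (θ - e)) (by fun_prop) ht _ _).congr_deriv ?_
  congr 1
  have hd : ∀ θ, HasDerivAt (fun θ => (1/(p:ℝ)) * (Real.cos (θ - e) * dx (V p k) θ t
      + Real.sin (θ - e) * V p k θ t)) (Real.cos (θ - e) * F p k θ t) θ := by
    intro θ
    have h1 : HasDerivAt (fun θ => θ - e) 1 θ := (hasDerivAt_id θ).sub_const e
    refine ((((h1.cos).mul (hfl.smV1.hdx ht θ)).add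
      ((h1.sin).mul (hfl.smV.hdx ht θ))).const_mul (1/(p:ℝ))).congr_deriv ?_
    unfold F; ring
  rw [intervalIntegral.integral_eq_sub_of_hasDerivAt (fun θ _ => hd θ)
    (((by fun_prop : Continuous fun θ => Real.cos (θ - e)).mul
      (hfl.smH.cont ht)).intervalIntegrable _ _)]
  have e1 : e + π/2 - e = π/2 := by ring
  have e2 : e - π/2 - e = -(π/2) := by ring
  rw [e1, e2, Real.cos_neg, Real.sin_neg, Real.cos_pi_div_two, Real.sin_pi_div_two]
  ring
lemma small_width {ε t : ℝ} (hε : 0 < ε) (ht : t ∈ Ico (T/2) T) : ∃ x ∈ Ioo t T, ∃ e,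
    ∫ θ in (e - π/2)..(e + π/2), Real.cos (θ - e) * (k θ x)⁻¹ ≤ ε := by
  have hT := h.hT
  obtain ⟨K0, hK0, hgood⟩ := h.good
  obtain ⟨s0, hs0, a, hm0, -⟩ := hgood t ht
  obtain ⟨t1, ht1, hbl⟩ := h.blow (max (max K0 (π / ε)) (k a s0))
  obtain ⟨t', ht'⟩ : (Ioo (max t t1) T).Nonempty := nonempty_Ioo.2 (max_lt ht.2 ht1.2)
  have ht'2 : t' ∈ Ico (T/2) T := ⟨ht.1.trans ((le_max_left _ _).trans ht'.1.le), ht'.2⟩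
  obtain ⟨s, hs, θ0, hm, hbig⟩ := hgood t' ht'2
  obtain ⟨y, hy⟩ := hbl t' ⟨(le_max_right _ _).trans_lt ht'.1, ht'.2⟩
  have hK := hy.trans_le (hm y t' ⟨ht'2.1, le_rfl⟩)
  have k1 : K0 < k θ0 s := ((le_max_left _ _).trans (le_max_left _ _)).trans_lt hK
  have k2 : π / ε < k θ0 s := ((le_max_right _ _).trans (le_max_left _ _)).trans_lt hK
  have k3 : k a s0 < k θ0 s := (le_max_right _ _).trans_lt hK
  have hst : t < s := by
    by_contra! hle
    have := hm0 θ0 s ⟨hs.1, hle⟩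
    linarith
  have hsT := hs.2.trans_lt ht'.2
  refine ⟨s, ⟨hst, hsT⟩, θ0, ?_⟩
  refine (h.abscos ⟨by linarith [hs.1], hsT⟩ (hbig k1.le).2).1.trans ?_
  rw [div_lt_iff₀ hε] at k2
  rw [div_le_iff₀ (hK0.trans k1)]; linarith
set_option maxHeartbeats 1000000 in
lemma Lbound : ∃ C > 0, ∃ t1 ∈ Ioo 0 T, ∀ t ∈ Ioo t1 T,
    ∫ θ in (0:ℝ)..(2*π), (k θ t)⁻¹ ≤ C * sg p T t := by
  have hT := h.hT
  have hfl := h.fl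
  have hp1 : 1 ≤ p := hfl.hp
  have hp0 : (1:ℝ) ≤ p := by exact_mod_cast hp1
  have hpi := Real.pi_pos
  obtain ⟨C1, hC1, t1, ht1, hb⟩ := h.bounds
  have hC0 : 0 < C1 := by linarith
  set W : ℝ → ℝ → ℝ := fun e s =>
    ∫ θ in (e - π/2)..(e + π/2), Real.cos (θ - e) * (k θ s)⁻¹ with hW
  set C3 : ℝ := (p+1) * (2 / p * C1 ^ p) with hC3
  have hC3p : 0 < C3 := by positivity
  set t2 := max t1 (T/2) with ht2
  have ht2T : t2 < T := max_lt ht1.2 (by linarith)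
  have ht20 : 0 < t2 := lt_max_of_lt_left ht1.1
  have hin : ∀ t ∈ Ioo t2 T, t ∈ Ioo 0 T ∧ t ∈ Ioo t1 T ∧ t ∈ Ico (T/2) T := fun t ht =>
    ⟨⟨ht20.trans ht.1, ht.2⟩, ⟨(le_max_left _ _).trans_lt ht.1, ht.2⟩,
      ⟨((le_max_right _ _).trans_lt ht.1).le, ht.2⟩⟩
  have hVb : ∀ t ∈ Ioo t2 T, ∀ θ, V p k θ t ≤ C1 ^ p * (1 / sg p T t ^ p) := by
    intro t ht θ
    have h1 := (hb t (hin t ht).2.1 θ).1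
    have hs := sg_pos (p := p) ht.2
    have h2 := pow_le_pow_left₀ (mul_pos (hfl.pos θ t (hin t ht).1) hs).le h1 p
    rw [mul_pow] at h2
    rw [mul_one_div, le_div_iff₀ (by positivity)]
    exact h2
  have hmono : ∀ e, MonotoneOn (fun s => W e s - C3 * sg p T s) (Ioo t2 T) := by
    intro e
    have hd : ∀ s ∈ Ioo t2 T, HasDerivAt (fun s => W e s - C3 * sg p T s)
        (- ((1/(p:ℝ)) * (V p k (e + π/2) s + V p k (e - π/2) s))
          - C3 * (-(1 / ((p:ℝ)+1)) * (1 / sg p T s ^ p))) s := fun s hs =>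
      (h.width_deriv e (hin s hs).1).sub ((sg_deriv hs.2).const_mul C3)
    refine monotoneOn_of_deriv_nonneg (convex_Ioo _ _)
      (fun x hx => (hd x hx).continuousAt.continuousWithinAt) ?_ ?_
    · rw [interior_Ioo]; exact fun x hx => (hd x hx).differentiableAt.differentiableWithinAt
    · rw [interior_Ioo]; intro x hx; rw [(hd x hx).deriv]
      have v1 := hVb x hx (e + π/2)
      have v2 := hVb x hx (e - π/2)
      have e1 : C3 * (-(1 / ((p:ℝ)+1)) * (1 / sg p T x ^ p))
          = - ((1/(p:ℝ)) * (C1 ^ p * (1 / sg p T x ^ p) + C1 ^ p * (1 / sg p T x ^ p))) := by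
        rw [hC3]; field_simp; ring
      rw [e1]
      have : (1/(p:ℝ)) * (V p k (e + π/2) x + V p k (e - π/2) x)
          ≤ (1/(p:ℝ)) * (C1 ^ p * (1 / sg p T x ^ p) + C1 ^ p * (1 / sg p T x ^ p)) :=
        mul_le_mul_of_nonneg_left (add_le_add v1 v2) (by positivity)
      linarith
  set b : ℝ := 1 / (C1 * (1 + C3) + 1) with hbdef
  have hbp : 0 < b := by positivity
  have hb1' : b < 1 := by
    rw [hbdef, div_lt_one (by positivity)]
    have : 0 < C1 * (1 + C3) := by positivity
    linarith
  have hb1 : b ≤ 1 := hb1'.le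
  have hbC : (1 + C3) * b ≤ 1 / C1 := by
    rw [hbdef, mul_one_div, div_le_div_iff₀ (by positivity) hC0]; linarith
  set η : ℝ := min (π/3) ((1/(4*C1)) / (C1/b)^p) with hη
  have hη0 : 0 < η := by rw [hη]; positivity
  have hη1 : η ≤ π/3 := min_le_left _ _
  have hη2 : (C1/b)^p * η ≤ 1/(4*C1) := by
    have := min_le_right (π/3) ((1/(4*C1)) / (C1/b)^p)
    rw [le_div_iff₀ (by positivity)] at this
    rw [mul_comm]; exact this
  have hsη : 0 < Real.sin η := Real.sin_pos_of_pos_of_lt_pi hη0 (by linarith)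
  set A : ℝ := 3 / Real.sin η with hA
  have hA0 : 0 < A := by positivity
  set C9 : ℝ := A * (2 * (1 + C3)) + 2 * π * (12 * C1) with hC9
  have main : ∀ t ∈ Ioo t2 T, ∀ s, s = T - b^(p+1) * (T - t) →
      ∫ θ in (0:ℝ)..(2*π), (k θ s)⁻¹ ≤ C9 * sg p T t := by
    intro t ht s hs
    have hTt : 0 < T - t := sub_pos.2 ht.2
    have hbp1 : b^(p+1) < 1 := pow_lt_one₀ hbp.le hb1' (by omega)
    have hbp0 : 0 < b^(p+1) := by positivity
    have hbT := mul_pos hbp0 hTt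
    have hbT' := mul_lt_mul_of_pos_right hbp1 hTt
    have hsT : s < T := by rw [hs]; linarith
    have hts : t < s := by rw [hs]; linarith
    have hsI : s ∈ Ioo t2 T := ⟨ht.1.trans hts, hsT⟩
    have hst := sg_pos (p := p) ht.2
    have hss := sg_pos (p := p) hsT
    have hsgs : sg p T s = b * sg p T t := by
      have e1 : (sg p T s)^(p+1) = (b * sg p T t)^(p+1) := by
        rw [mul_pow, sg_pow hsT, sg_pow ht.2, hs]; ring
      exact (pow_left_inj₀ hss.le (by positivity) (by omega)).1 e1
    obtain ⟨x0, hx0, e, hWe⟩ := h.small_width hss (hin s hsI).2.2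
    have hx0I : x0 ∈ Ioo t2 T := ⟨hsI.1.trans hx0.1, hx0.2⟩
    have hWup : ∀ y ∈ Icc t s, W e y ≤ (1 + C3) * sg p T y := by
      intro y hy
      have hyI : y ∈ Ioo t2 T := ⟨ht.1.trans_le hy.1, hy.2.trans_lt hsT⟩
      have h1 := hmono e hyI hx0I (hy.2.trans hx0.1.le)
      simp only at h1
      have h2 := sg_anti (p := p) hsT hy.2
      have h3 := sg_pos (p := p) hx0.2
      have : W e x0 ≤ sg p T s := hWe
      have h4 := mul_pos hC3p h3
      linarith
    have hWlow : 2 * (sg p T t / C1) ≤ W e t := by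
      have e1 : ∫ θ in (e - π/2)..(e + π/2), Real.cos (θ - e) * (sg p T t / C1)
          = 2 * (sg p T t / C1) := by
        rw [intervalIntegral.integral_mul_const,
          intervalIntegral.integral_comp_sub_right (fun x => Real.cos x), integral_cos]
        have e1 : e + π/2 - e = π/2 := by ring
        have e2 : e - π/2 - e = -(π/2) := by ring
        rw [e1, e2, Real.sin_neg, Real.sin_pi_div_two]; ring
      rw [← e1]
      have hcont := hfl.smInv.cont (hin t ht).1
      refine intervalIntegral.integral_mono_on (by linarith)
        (Continuous.intervalIntegrable (by fun_prop) _ _)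
        (Continuous.intervalIntegrable (by fun_prop) _ _) fun θ hθ => ?_
      refine mul_le_mul_of_nonneg_left ?_ (Real.cos_nonneg_of_neg_pi_div_two_le_of_le
        (by linarith [hθ.1]) (by linarith [hθ.2]))
      have hkp := hfl.pos θ t (hin t ht).1
      have := (hb t (hin t ht).2.1 θ).1
      rw [div_le_iff₀ hC0, inv_mul_eq_div, le_div_iff₀ hkp]; linarith
    have hdrop : sg p T t / C1 ≤ W e t - W e s := by
      have h1 := hWup s ⟨hts.le, le_rfl⟩
      rw [hsgs, ← mul_assoc] at h1
      have h2 : (1 + C3) * b * sg p T t ≤ 1 / C1 * sg p T t :=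
        mul_le_mul_of_nonneg_right hbC hst.le
      have e1 : 1 / C1 * sg p T t = sg p T t / C1 := by ring
      linarith
    obtain ⟨x, hx, hxd⟩ := exists_hasDerivAt_eq_slope (W e)
      (fun s => - ((1/(p:ℝ)) * (V p k (e + π/2) s + V p k (e - π/2) s))) hts
      (fun y hy => (h.width_deriv e
        (hin y ⟨ht.1.trans_le hy.1, hy.2.trans_lt hsT⟩).1).continuousAt.continuousWithinAt)
      (fun y hy => h.width_deriv e (hin y ⟨ht.1.trans hy.1, hy.2.trans hsT⟩).1)
    have hxI : x ∈ Ioo t2 T := ⟨ht.1.trans hx.1, hx.2.trans hsT⟩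
    have hx00 := (hin x hxI).1
    have hsum : 1 / (C1 * sg p T t ^ p)
        ≤ V p k (e + π/2) x + V p k (e - π/2) x := by
      have hVp1 := pow_pos (hfl.pos (e + π/2) x hx00) p
      have hVp2 := pow_pos (hfl.pos (e - π/2) x hx00) p
      have hVp : 0 < V p k (e + π/2) x + V p k (e - π/2) x := add_pos hVp1 hVp2
      rw [eq_div_iff (by linarith)] at hxd
      set Z := V p k (e + π/2) x + V p k (e - π/2) x
      have h1 : sg p T t / C1 ≤ Z * (T - t) := by
        have h2 : (1/(p:ℝ)) * Z * (s - t) ≤ Z * (T - t) := by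
          have h3 : (1/(p:ℝ)) ≤ 1 := by rw [div_le_one (by linarith)]; exact hp0
          calc (1/(p:ℝ)) * Z * (s - t) ≤ 1 * Z * (s-t) := by
                apply mul_le_mul_of_nonneg_right _ (by linarith)
                exact mul_le_mul_of_nonneg_right h3 hVp.le
            _ ≤ _ := by rw [one_mul]; exact mul_le_mul_of_nonneg_left (by linarith) hVp.le
        linarith
      rw [← sg_pow (p := p) ht.2, pow_succ] at h1
      rw [div_le_iff₀ hC0] at h1
      rw [div_le_iff₀ (by positivity)]
      have : sg p T t * 1 ≤ sg p T t * (Z * (C1 * sg p T t ^ p)) := by linarith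
      exact le_of_mul_le_mul_left this hst
    obtain ⟨m, hm, hVm⟩ : ∃ m, (m = e + π/2 ∨ m = e - π/2) ∧
        1 / (2 * C1) * (1 / sg p T t ^ p) ≤ V p k m x := by
      have e1 : 1 / (2 * C1) * (1 / sg p T t ^ p) = (1 / (C1 * sg p T t ^ p)) / 2 := by
        field_simp
      rw [e1]
      by_contra! hcon
      have c1 := hcon (e + π/2) (Or.inl rfl)
      have c2 := hcon (e - π/2) (Or.inr rfl)
      linarith
    have hsgx : b * sg p T t ≤ sg p T x := by rw [← hsgs]; exact sg_anti hsT hx.2.le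
    have hsgx' : sg p T x ≤ sg p T t := sg_anti hxI.2 hx.1.le
    have hgrad : ∀ θ, |dx (V p k) θ x| ≤ (C1/b)^p * (1 / sg p T t ^ p) := by
      intro θ
      have h1 := (hb x (hin x hxI).2.1 θ).2
      have h2 : |dx (V p k) θ x| * (b * sg p T t)^p ≤ C1 ^ p :=
        (mul_le_mul_of_nonneg_left (pow_le_pow_left₀ (by positivity) hsgx p)
          (abs_nonneg _)).trans h1
      rw [div_pow, mul_one_div, div_div, ← mul_pow, le_div_iff₀ (by positivity)]; exact h2
    have hrgood : ∀ θ, |θ - m| ≤ η → (k θ x)⁻¹ ≤ 4 * C1 * sg p T t := by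
      intro θ hθ
      have h1 := Convex.norm_image_sub_le_of_norm_hasDerivWithin_le
        (f := fun y => V p k y x) (s := Set.univ)
        (fun y _ => (hfl.smV.hdx hx00 y).hasDerivWithinAt) (fun y _ => hgrad y) convex_univ
        (Set.mem_univ m) (Set.mem_univ θ)
      simp only [Real.norm_eq_abs] at h1
      have h2 : (C1/b)^p * (1 / sg p T t ^ p) * |θ - m| ≤ 1/(4*C1) * (1 / sg p T t ^ p) := by
        calc _ ≤ (C1/b)^p * (1 / sg p T t ^ p) * η := mul_le_mul_of_nonneg_left hθ (by positivity)
          _ = ((C1/b)^p * η) * (1 / sg p T t ^ p) := by ring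
          _ ≤ _ := mul_le_mul_of_nonneg_right hη2 (by positivity)
      have h3 : 1/(4*C1) * (1 / sg p T t ^ p) ≤ V p k θ x := by
        have := (abs_le.1 (h1.trans h2)).1
        have e1 : 1 / (2 * C1) * (1 / sg p T t ^ p) = 2 * (1/(4*C1) * (1 / sg p T t ^ p)) := by
          field_simp; norm_num
        linarith
      have h4 : (1/(4*C1 * sg p T t)) ^ p ≤ k θ x ^ p := by
        refine le_trans ?_ h3
        rw [← one_div_mul_one_div, mul_pow, one_div_pow (sg p T t)]
        refine mul_le_mul_of_nonneg_right (pow_le_of_le_one (by positivity) ?_ (by omega))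
          (by positivity)
        rw [div_le_one (by positivity)]; linarith
      have h5 := le_of_pow_le_pow_left₀ (by omega) (hfl.pos θ x hx00).le h4
      rw [inv_eq_one_div, div_le_iff₀ (hfl.pos θ x hx00)]
      rw [div_le_iff₀ (by positivity)] at h5; linarith
    have hcont := hfl.smInv.cont hx00
    have hpt : ∀ θ ∈ Icc (m - π) (m + π), (k θ x)⁻¹
        ≤ A * (|Real.cos (θ - e)| * (k θ x)⁻¹) + (-2) * (Real.cos (θ - m) * (k θ x)⁻¹)
          + 12 * C1 * sg p T t := by
      intro θ hθ
      have hr : 0 < (k θ x)⁻¹ := inv_pos.2 (hfl.pos θ x hx00)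
      have hce : |Real.cos (θ - e)| = |Real.sin (θ - m)| := by
        rcases hm with hm | hm
        · rw [show θ - e = (θ - m) + π/2 by rw [hm]; ring, Real.cos_add_pi_div_two, abs_neg]
        · rw [show θ - e = (θ - m) - π/2 by rw [hm]; ring, Real.cos_sub_pi_div_two]
      rw [hce]
      have hAn : 0 ≤ A * (|Real.sin (θ - m)| * (k θ x)⁻¹) := by positivity
      have hcos := Real.cos_le_one (θ - m)
      rcases le_or_gt |θ - m| η with hc | hc
      · have := hrgood θ hc
        have h6 := mul_le_mul_of_nonneg_right hcos hr.le
        linarith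
      · rcases le_or_gt (Real.cos (θ - m)) (-1/2) with hc2 | hc2
        · have : 0 ≤ 12 * C1 * sg p T t := by positivity
          have h6 := mul_le_mul_of_nonneg_right hc2 hr.le
          linarith
        · have hlt : |θ - m| < 2 * π/3 := by
            by_contra! hge
            have h1 : Real.cos |θ - m| ≤ Real.cos (2 * π / 3) :=
              Real.cos_le_cos_of_nonneg_of_le_pi (by linarith)
                (abs_le.2 ⟨by linarith [hθ.1], by linarith [hθ.2]⟩) hge
            rw [Real.cos_abs, show 2 * π / 3 = π - π/3 by ring,
              Real.cos_pi_sub, Real.cos_pi_div_three] at h1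
            linarith
          have hsin : Real.sin η ≤ |Real.sin (θ - m)| := by
            have e1 : |Real.sin (θ - m)| = Real.sin |θ - m| := by
              rcases le_total 0 (θ - m) with h0 | h0
              · rw [abs_of_nonneg h0, abs_of_nonneg]
                rw [abs_of_nonneg h0] at hlt
                exact Real.sin_nonneg_of_nonneg_of_le_pi h0 (by linarith)
              · rw [abs_of_nonpos h0, Real.sin_neg, abs_of_nonpos]
                rw [abs_of_nonpos h0] at hlt
                exact Real.sin_nonpos_of_nonpos_of_neg_pi_le h0 (by linarith)
            rw [e1]
            rcases le_total |θ - m| (π/2) with h2 | h2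
            · exact Real.sin_le_sin_of_le_of_le_pi_div_two (by linarith) h2 hc.le
            · rw [← Real.sin_pi_sub |θ - m|]
              exact Real.sin_le_sin_of_le_of_le_pi_div_two (by linarith) (by linarith)
                (by linarith)
          have h3 : 3 * (k θ x)⁻¹ ≤ A * (|Real.sin (θ - m)| * (k θ x)⁻¹) := by
            rw [← mul_assoc]
            refine mul_le_mul_of_nonneg_right ?_ hr.le
            rw [hA, div_mul_eq_mul_div, le_div_iff₀ hsη]; linarith
          have h5 : 0 ≤ 12 * C1 * sg p T t := by positivity
          have h6 := mul_le_mul_of_nonneg_right hcos hr.le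
          linarith
    have hper := h.rper hx00
    have hLx : ∫ θ in (0:ℝ)..(2*π), (k θ x)⁻¹ ≤ C9 * sg p T t := by
      rw [← int_shift hper (m - π) (m + π) (by ring)]
      have i1 : Continuous fun θ => A * (|Real.cos (θ - e)| * (k θ x)⁻¹) := by fun_prop
      have i2 : Continuous fun θ => (-2) * (Real.cos (θ - m) * (k θ x)⁻¹) := by fun_prop
      have i12 : Continuous fun θ => A * (|Real.cos (θ - e)| * (k θ x)⁻¹)
          + (-2) * (Real.cos (θ - m) * (k θ x)⁻¹) := by fun_prop
      have i3 : Continuous fun θ => A * (|Real.cos (θ - e)| * (k θ x)⁻¹)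
          + (-2) * (Real.cos (θ - m) * (k θ x)⁻¹) + 12 * C1 * sg p T t := by fun_prop
      have h1 := intervalIntegral.integral_mono_on (by linarith) (hcont.intervalIntegrable (μ := volume) _ _)
        (i3.intervalIntegrable _ _) hpt
      refine h1.trans ?_
      rw [intervalIntegral.integral_add (i12.intervalIntegrable _ _)
        intervalIntegrable_const, intervalIntegral.integral_add (i1.intervalIntegrable _ _)
        (i2.intervalIntegrable _ _), intervalIntegral.integral_const_mul,
        intervalIntegral.integral_const_mul, intervalIntegral.integral_const]
      have hcl := closing_shift hcont (h.ccos x hx00) (h.csin x hx00)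
      have hcp : ∀ a, Function.Periodic (fun θ => Real.cos (θ - a) * (k θ x)⁻¹) (2*π) := by
        intro a θ
        simp only
        rw [show θ + 2 * π - a = (θ - a) + 2 * π by ring, Real.cos_add_two_pi,
          h.fl.per θ x hx00]
      have z1 : ∫ θ in (m - π)..(m + π), Real.cos (θ - m) * (k θ x)⁻¹ = 0 := by
        rw [int_shift (hcp m) _ _ (by ring)]; exact hcl m
      have hap : Function.Periodic (fun θ => |Real.cos (θ - e)| * (k θ x)⁻¹) (2*π) := by
        intro θ
        simp only
        rw [show θ + 2 * π - e = (θ - e) + 2 * π by ring, Real.cos_add_two_pi,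
          h.fl.per θ x hx00]
      have ia : Continuous fun θ => |Real.cos (θ - e)| * (k θ x)⁻¹ := by fun_prop
      have ic : Continuous fun θ => Real.cos (θ - e) * (k θ x)⁻¹ := by fun_prop
      have z2 : ∫ θ in (m - π)..(m + π), |Real.cos (θ - e)| * (k θ x)⁻¹
          = 2 * W e x := by
        rw [int_shift hap _ _ (by ring), ← int_shift hap (e - π/2) (e + 3*π/2) (by ring),
          ← intervalIntegral.integral_add_adjacent_intervals
            (ia.intervalIntegrable _ (e + π/2)) (ia.intervalIntegrable _ _)]
        have y1 : ∫ θ in (e - π/2)..(e + π/2), |Real.cos (θ - e)| * (k θ x)⁻¹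
            = W e x := by
          apply intervalIntegral.integral_congr
          intro θ hθ
          rw [uIcc_of_le (by linarith)] at hθ
          simp only
          rw [abs_of_nonneg (Real.cos_nonneg_of_neg_pi_div_two_le_of_le
            (by linarith [hθ.1]) (by linarith [hθ.2]))]
        have y2 : ∫ θ in (e + π/2)..(e + 3*π/2), |Real.cos (θ - e)| * (k θ x)⁻¹
            = - ∫ θ in (e + π/2)..(e + 3*π/2), Real.cos (θ - e) * (k θ x)⁻¹ := by
          rw [← intervalIntegral.integral_neg]
          apply intervalIntegral.integral_congr
          intro θ hθ
          rw [uIcc_of_le (by linarith)] at hθ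
          simp only
          rw [abs_of_nonpos (Real.cos_nonpos_of_pi_div_two_le_of_le
            (by linarith [hθ.1]) (by linarith [hθ.2]))]
          ring
        have y3 := int_shift (hcp e) (e - π/2) (e + 3*π/2) (by ring)
        rw [hcl e, ← intervalIntegral.integral_add_adjacent_intervals
            (ic.intervalIntegrable _ (e + π/2)) (ic.intervalIntegrable _ _)] at y3
        have y4 : W e x + ∫ θ in (e + π/2)..(e + 3*π/2),
          Real.cos (θ - e) * (k θ x)⁻¹ = 0 := y3
        rw [y1, y2]; linarith
      rw [z1, z2, smul_eq_mul]
      have h2 := hWup x ⟨hx.1.le, hx.2.le⟩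
      have h3 : W e x ≤ (1 + C3) * sg p T t :=
        h2.trans (mul_le_mul_of_nonneg_left hsgx' (by linarith))
      have h4 : A * (2 * W e x) ≤ A * (2 * ((1 + C3) * sg p T t)) :=
        mul_le_mul_of_nonneg_left (by linarith) hA0.le
      rw [hC9]; linarith
    have hL : AntitoneOn (fun s => ∫ θ in (0:ℝ)..(2*π), (k θ s)⁻¹) (Ioo 0 T) := by
      have hd : ∀ y ∈ Ioo 0 T, HasDerivAt (fun s => ∫ θ in (0:ℝ)..(2*π), (k θ s)⁻¹)
          (-((1/(p:ℝ)) * ∫ θ in (0:ℝ)..(2*π), V p k θ y)) y := by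
        intro y hy
        have := hfl.hint_inv (φ := fun _ => 1) continuous_const hy 0 (2*π)
        simp only [one_mul] at this
        refine this.congr_deriv ?_
        congr 1
        unfold F
        rw [intervalIntegral.integral_const_mul, intervalIntegral.integral_add
          ((hfl.smV.cont hy).intervalIntegrable _ _) ((hfl.smV2.cont hy).intervalIntegrable _ _),
          intervalIntegral.integral_eq_sub_of_hasDerivAt (fun θ _ => hfl.smV1.hdx hy θ)
            ((hfl.smV2.cont hy).intervalIntegrable _ _), hfl.perV.dx.apply0 hy]
        ring
      refine antitoneOn_of_deriv_nonpos (convex_Ioo _ _)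
        (fun x hx => (hd x hx).continuousAt.continuousWithinAt) ?_ ?_
      · rw [interior_Ioo]; exact fun x hx => (hd x hx).differentiableAt.differentiableWithinAt
      · rw [interior_Ioo]; intro x hx; rw [(hd x hx).deriv]
        have : 0 ≤ ∫ θ in (0:ℝ)..(2*π), V p k θ x :=
          intervalIntegral.integral_nonneg two_pi_pos'.le
            fun θ _ => (pow_pos (hfl.pos θ x hx) p).le
        have : 0 ≤ (1/(p:ℝ)) * ∫ θ in (0:ℝ)..(2*π), V p k θ x := by positivity
        linarith
    exact (hL hx00 (hin s hsI).1 hx.2.le).trans hLx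
  have hC9p : 0 < C9 := by positivity
  refine ⟨C9 / b, by positivity, T - b^(p+1) * (T - t2), ?_, ?_⟩
  · have hbp1 : b^(p+1) ≤ 1 := pow_le_one₀ hbp.le hb1
    have hbp0 : 0 < b^(p+1) := by positivity
    constructor <;> nlinarith
  · intro s hs
    have hbp0 : 0 < b^(p+1) := by positivity
    have hTs : 0 < T - s := sub_pos.2 hs.2
    have ht : T - (T - s) / b^(p+1) ∈ Ioo t2 T := by
      constructor
      · have : (T - s) / b^(p+1) < T - t2 := by
          rw [div_lt_iff₀ hbp0]; linarith [hs.1]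
        linarith
      · have : 0 < (T - s) / b^(p+1) := by positivity
        linarith
    have h1 := main _ ht s (by field_simp; ring)
    have h2 : sg p T s = b * sg p T (T - (T - s) / b^(p+1)) := by
      have e1 : (sg p T s)^(p+1) = (b * sg p T (T - (T - s) / b^(p+1)))^(p+1) := by
        rw [mul_pow, sg_pow hs.2, sg_pow ht.2]; field_simp; ring
      have := sg_pos (p := p) ht.2
      exact (pow_left_inj₀ (sg_pos hs.2).le (by positivity) (by omega)).1 e1
    rw [h2]
    refine h1.trans_eq ?_
    field_simp
end UF
end PC
namespace PC
open scoped ContDiff Topology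
lemma uf_of {p : ℕ} (hp : 1 ≤ p) {T : ℝ} (hT : 0 < T) {k : ℝ → ℝ → ℝ} {ψ : ℝ → ℝ}
    (hk : IsPCSF p T k ψ) : UF p T k := by
  obtain ⟨hsm, hper, hpos, heq, -, -, -, -, hblow, hcl⟩ := hk
  have hsub : Ioo 0 T ⊆ Ico 0 T := Ioo_subset_Ico_self
  have sm : SM (Ioo 0 T) k := SM.mono (I := Ico 0 T) hsm hsub
  have per : Per (Ioo 0 T) k := fun θ t _ => hper θ t
  have smV : SM (Ioo 0 T) (V p k) := sm.pow p
  have smV1 := smV.dx isOpen_Ioo.uniqueDiffOn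
  have smV2 := smV1.dx isOpen_Ioo.uniqueDiffOn
  have perV : Per (Ioo 0 T) (V p k) := per.pow p
  have hp0 : (p:ℝ) ≠ 0 := by positivity
  have hV2 : ∀ θ, ∀ t ∈ Ioo 0 T, dx (dx (V p k)) θ t
      = p * (k θ t ^ (p-1) * dx (dx k) θ t + ((p:ℝ)-1) * k θ t ^ (p-2) * dx k θ t ^ 2) := by
    intro θ t ht
    have h1 : ∀ x, dx (V p k) x t = p * (k x t ^ (p-1) * dx k x t) := fun x =>
      ((sm.hdx ht x).pow p).deriv.trans (by simp [mul_assoc])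
    have h2 : dx (dx (V p k)) θ t = deriv (fun x => p * (k x t ^ (p-1) * dx k x t)) θ := by
      unfold dx at h1 ⊢
      congr 1; funext x; exact h1 x
    rw [h2]
    have h3 := (((sm.hdx ht θ).pow (p-1)).mul ((sm.dx isOpen_Ioo.uniqueDiffOn).hdx ht θ)).const_mul (p:ℝ)
    refine h3.deriv.trans ?_
    rw [Nat.cast_sub hp, show p - 1 - 1 = p - 2 by omega]
    simp only [Pi.pow_apply]
    push_cast; ring
  have hre : ∀ t ∈ Ioo 0 T, ∀ z : ℂ → ℝ, (z = Complex.re ∨ z = Complex.im) →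
      ∫ θ in (0:ℝ)..(2*π), z (Complex.exp (Complex.I * θ)) * (k θ t)⁻¹ = 0 := by
    intro t ht z hz
    have hc : Continuous fun θ : ℝ => Complex.exp (Complex.I * θ) / (k θ t : ℂ) := by
      have := sm.cont ht
      refine Continuous.div (by fun_prop) (by fun_prop) fun θ => ?_
      exact_mod_cast (hpos θ t (hsub ht)).ne'
    have e := hcl t (hsub ht)
    rcases hz with rfl | rfl
    · have := Complex.reCLM.intervalIntegral_comp_comm (hc.intervalIntegrable (μ := volume) 0 (2*π))
      rw [e] at this
      simp only [Complex.reCLM_apply, Complex.zero_re] at this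
      rw [← this]; congr 1; funext θ
      rw [div_eq_mul_inv, ← Complex.ofReal_inv, Complex.re_mul_ofReal]
    · have := Complex.imCLM.intervalIntegral_comp_comm (hc.intervalIntegrable (μ := volume) 0 (2*π))
      rw [e] at this
      simp only [Complex.imCLM_apply, Complex.zero_im] at this
      rw [← this]; congr 1; funext θ
      rw [div_eq_mul_inv, ← Complex.ofReal_inv, Complex.im_mul_ofReal]
  refine ⟨hT, ⟨isOpen_Ioo, hp, sm, per, fun θ t ht => hpos θ t (hsub ht), ?_, ?_, ?_⟩, ?_, ?_, ?_⟩
  · exact (smV.add smV2).cmul _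
  · intro θ t ht
    unfold F
    rw [perV θ t ht, perV.dx.dx θ t ht]
  · intro θ t ht
    refine (heq θ t (hsub ht)).deriv.trans ?_
    unfold F
    rw [hV2 θ t ht]
    unfold V dx
    field_simp; ring
  · intro t ht
    have := hre t ht Complex.re (Or.inl rfl)
    simpa [Complex.exp_re, Complex.exp_im] using this
  · intro t ht
    have := hre t ht Complex.im (Or.inr rfl)
    simpa [Complex.exp_re, Complex.exp_im] using this
  · intro M
    have h1 := (tendsto_atTop.1 hblow (max M 0 + 1))
    have h2 := (mem_nhdsLT_iff_exists_Ioo_subset' (show (0:ℝ) < T from hT)).1 h1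
    obtain ⟨l, hl, hsubl⟩ := h2
    obtain ⟨t1, ht1⟩ : (Ioo (max l 0) T).Nonempty := nonempty_Ioo.2 (max_lt hl hT)
    have := max_lt_iff.1 ht1.1
    refine ⟨t1, ⟨this.2, ht1.2⟩, fun t ht => ?_⟩
    have h3 : max M 0 + 1 ≤ ⨆ θ : Set.Icc (0:ℝ) (2 * π), k (θ : ℝ) t :=
      hsubl ⟨by linarith [ht.1], ht.2⟩
    have : Nonempty (Set.Icc (0:ℝ) (2 * π)) := ⟨⟨0, le_rfl, two_pi_pos'.le⟩⟩
    obtain ⟨θ, hθ⟩ := exists_lt_of_lt_ciSup (lt_of_lt_of_le (by linarith [le_max_left M 0] :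
      M < max M 0 + 1) h3)
    exact ⟨θ, hθ⟩
noncomputable def G (p : ℕ) (k : ℝ → ℝ → ℝ) : ℝ → ℝ → ℝ :=
  fun θ t => dx (dx (V p k)) θ t + V p k θ t - (k θ t)⁻¹
structure NF (p : ℕ) (C τ1 : ℝ) (κ : ℝ → ℝ → ℝ) : Prop where
  fl : Flow p (Ioi τ1) κ (G p κ)
  ccos : ∀ t ∈ Ioi τ1, ∫ θ in (0:ℝ)..(2*π), Real.cos θ * (κ θ t)⁻¹ = 0
  csin : ∀ t ∈ Ioi τ1, ∫ θ in (0:ℝ)..(2*π), Real.sin θ * (κ θ t)⁻¹ = 0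
  C1 : 1 ≤ C
  hκ : ∀ t ∈ Ioi τ1, ∀ θ, κ θ t ≤ C
  hv1 : ∀ t ∈ Ioi τ1, ∀ θ, |dx (V p κ) θ t| ≤ C
  hr : ∀ t ∈ Ioi τ1, ∫ θ in (0:ℝ)..(2*π), (κ θ t)⁻¹ ≤ C
lemma dx_cmul (g : ℝ → ℝ → ℝ) (s : ℝ → ℝ) (a : ℝ → ℝ) :
    dx (fun θ t => a t * g θ (s t)) = fun θ t => a t * dx g θ (s t) := by
  funext θ t
  unfold dx
  rw [deriv_const_mul_field]
lemma nf_of {p : ℕ} {T : ℝ} {k : ℝ → ℝ → ℝ} (h : UF p T k) :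
    ∃ C, ∃ τ1 > 0, NF p C τ1 (ktilde p T k) := by
  have hT := h.hT
  have hp1 := h.fl.hp
  have hp0 : (0:ℝ) < p := by positivity
  obtain ⟨C1, hC1, t1, ht1, hb⟩ := h.bounds
  obtain ⟨C2, hC2, t2, ht2, hL⟩ := h.Lbound
  set c1 : ℝ := (((p : ℝ) + 1) / (p : ℝ)) ^ ((1 : ℝ) / ((p : ℝ) + 1)) with hc1
  have hc1p : 0 < c1 := by positivity
  have hc1pow : c1 ^ (p+1) = ((p:ℝ)+1)/p := by
    rw [hc1, ← Real.rpow_natCast, ← Real.rpow_mul (by positivity)]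
    have : (1:ℝ) / ((p:ℝ) + 1) * ((p+1 : ℕ) : ℝ) = 1 := by push_cast; field_simp
    rw [this, Real.rpow_one]
  set a : ℝ → ℝ := fun τ => c1 * sg p T (tOf p T τ) with ha
  have hTt : ∀ τ, T - tOf p T τ = T * rexp (-((p : ℝ) + 1) * τ) := by
    intro τ; unfold tOf; ring
  have htlt : ∀ τ, tOf p T τ < T := by
    intro τ; have := hTt τ; have : 0 < T * rexp (-((p : ℝ) + 1) * τ) := by positivity
    linarith
  have hap : ∀ τ, 0 < a τ := fun τ => mul_pos hc1p (sg_pos (htlt τ))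
  have hapow : ∀ τ, a τ ^ (p+1) = ((p:ℝ)+1)/p * (T * rexp (-((p : ℝ) + 1) * τ)) := by
    intro τ; rw [ha]; simp only
    rw [mul_pow, hc1pow, sg_pow (htlt τ), hTt]
  have hk : ktilde p T k = fun θ τ => a τ * k θ (tOf p T τ) := by
    funext θ τ; unfold ktilde; rfl
  have htd : ∀ τ, HasDerivAt (tOf p T) (T * ((p:ℝ)+1) * rexp (-((p : ℝ) + 1) * τ)) τ := by
    intro τ
    have h1 : HasDerivAt (fun τ : ℝ => -((p : ℝ) + 1) * τ) (-((p : ℝ) + 1)) τ := by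
      simpa using (hasDerivAt_id τ).const_mul (-((p : ℝ) + 1))
    refine ((h1.exp.const_sub 1).const_mul T).congr_deriv ?_
    ring
  have had : ∀ τ, HasDerivAt a (- a τ) τ := by
    intro τ
    refine (((sg_deriv (p := p) (htlt τ)).comp τ (htd τ)).const_mul c1).congr_deriv ?_
    have h1 := sg_pow (p := p) (htlt τ)
    rw [hTt] at h1
    have h2 := (sg_pos (p := p) (htlt τ)).ne'
    rw [show T * ((p:ℝ)+1) * rexp (-((p : ℝ) + 1) * τ)
      = ((p:ℝ)+1) * (T * rexp (-((p : ℝ) + 1) * τ)) by ring, ← h1]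
    simp only [ha]
    field_simp
    ring
  have haS : ContDiff ℝ (⊤ : ℕ∞) a := by
    have : a = fun τ => c1 * (T ^ ((1:ℝ) / ((p:ℝ) + 1)) * rexp (-τ)) := by
      funext τ; simp only [ha]; unfold sg
      rw [hTt, Real.mul_rpow hT.le (Real.exp_pos _).le, ← Real.exp_mul]
      congr 4; field_simp
    rw [this]; fun_prop
  have htS : ContDiff ℝ (⊤ : ℕ∞) (tOf p T) := by unfold tOf; fun_prop
  set δ : ℝ := 1 - max t1 t2 / T with hδ
  have hδ0 : 0 < δ := by
    rw [hδ, sub_pos, div_lt_one hT]; exact max_lt ht1.2 ht2.2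
  set τ1 : ℝ := max 1 (-Real.log δ) with hτ1
  have hmem : ∀ τ ∈ Ioi τ1, tOf p T τ ∈ Ioo (max t1 t2) T := by
    intro τ hτ
    refine ⟨?_, htlt τ⟩
    have h1 := max_lt_iff.1 (show max 1 (-Real.log δ) < τ from hτ)
    have h2 : rexp (-((p : ℝ) + 1) * τ) < δ := by
      rw [← Real.exp_log hδ0, Real.exp_lt_exp]
      have : 0 < (p:ℝ) * τ := mul_pos hp0 (by linarith)
      linarith
    have h3 := mul_lt_mul_of_pos_left h2 hT
    have h4 : T * δ = T - max t1 t2 := by rw [hδ]; field_simp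
    linarith [hTt τ]
  have hm0 : ∀ τ ∈ Ioi τ1, tOf p T τ ∈ Ioo 0 T := fun τ hτ =>
    ⟨by have := (hmem τ hτ).1; linarith [le_max_left t1 t2, ht1.1], htlt τ⟩
  have hm1 : ∀ τ ∈ Ioi τ1, tOf p T τ ∈ Ioo t1 T := fun τ hτ =>
    ⟨by have := (hmem τ hτ).1; linarith [le_max_left t1 t2], htlt τ⟩
  have hm2 : ∀ τ ∈ Ioi τ1, tOf p T τ ∈ Ioo t2 T := fun τ hτ =>
    ⟨by have := (hmem τ hτ).1; linarith [le_max_right t1 t2], htlt τ⟩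
  have hV : V p (ktilde p T k) = fun θ τ => a τ ^ p * V p k θ (tOf p T τ) := by
    funext θ τ; unfold V; rw [hk, mul_pow]
  have hV1 : dx (V p (ktilde p T k)) = fun θ τ => a τ ^ p * dx (V p k) θ (tOf p T τ) := by
    rw [hV]; exact dx_cmul (V p k) (tOf p T) (fun τ => a τ ^ p)
  have hV2 : dx (dx (V p (ktilde p T k))) = fun θ τ => a τ ^ p * dx (dx (V p k)) θ (tOf p T τ) := by
    rw [hV1]; exact dx_cmul (dx (V p k)) (tOf p T) (fun τ => a τ ^ p)
  have sm : SM (Ioi τ1) (ktilde p T k) := by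
    rw [hk]
    unfold SM
    refine ContDiffOn.mul ?_ ?_
    · exact (haS.comp contDiff_snd).contDiffOn
    · have h1 : ContDiffOn ℝ (⊤ : ℕ∞) (fun q : ℝ × ℝ => (q.1, tOf p T q.2)) (Set.univ ×ˢ Ioi τ1) :=
        (contDiff_fst.prodMk (htS.comp contDiff_snd)).contDiffOn
      exact ContDiffOn.comp h.fl.sm h1 fun q hq => ⟨trivial, hm0 q.2 hq.2⟩
  have per : Per (Ioi τ1) (ktilde p T k) := by
    intro θ τ hτ
    rw [hk]; simp only; rw [h.fl.per θ _ (hm0 τ hτ)]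
  have pos : ∀ θ, ∀ τ ∈ Ioi τ1, 0 < ktilde p T k θ τ := by
    intro θ τ hτ
    rw [hk]; exact mul_pos (hap τ) (h.fl.pos θ _ (hm0 τ hτ))
  have smV := sm.pow p
  have smV1 := smV.dx isOpen_Ioi.uniqueDiffOn
  have smV2 := smV1.dx isOpen_Ioi.uniqueDiffOn
  have perV : Per (Ioi τ1) (V p (ktilde p T k)) := per.pow p
  refine ⟨max (c1 * C1) (max ((c1*C1)^p) (max (c1⁻¹ * C2) 1)), τ1, by positivity,
    ⟨isOpen_Ioi, hp1, sm, per, pos, ?_, ?_, ?_⟩, ?_, ?_, ?_, ?_, ?_, ?_⟩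
  · exact (smV2.add smV).sub (sm.inv fun θ t ht => (pos θ t ht).ne')
  · intro θ τ hτ
    unfold G
    rw [per θ τ hτ, perV θ τ hτ, perV.dx.dx θ τ hτ]
  · intro θ τ hτ
    have h1 : HasDerivAt (fun s => k θ (tOf p T s)) _ τ := (h.fl.hk (hm0 τ hτ) θ).comp τ (htd τ)
    have h2 := ((had τ).mul h1).deriv
    have h2' : dt (ktilde p T k) θ τ = deriv (a * fun s => k θ (tOf p T s)) τ := by rw [hk]; rfl
    rw [h2', h2]
    unfold G
    rw [hV2, hV, hk]
    simp only
    have e1 := hapow τ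
    have e2 := h.pH θ (tOf p T τ)
    have e3 : a τ ^ p * dx (dx (V p k)) θ (tOf p T τ) + a τ ^ p * V p k θ (tOf p T τ)
      = a τ ^ p * (p * F p k θ (tOf p T τ)) := by rw [e2]; ring
    rw [e3, mul_sub]
    have e4 : (a τ * k θ (tOf p T τ)) ^ 2 * (a τ * k θ (tOf p T τ))⁻¹ = a τ * k θ (tOf p T τ) := by
      have := (pos θ τ hτ).ne'
      rw [hk] at this
      simp only at this
      field_simp
    rw [e4]
    have e5 : (a τ * k θ (tOf p T τ)) ^ 2 * (a τ ^ p * (p * F p k θ (tOf p T τ)))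
      = a τ * (p * a τ ^ (p+1)) * k θ (tOf p T τ) ^ 2 * F p k θ (tOf p T τ) := by ring
    rw [e5, e1]
    field_simp
    ring
  · intro τ hτ
    rw [hk]; simp only [mul_inv]
    have := h.ccos _ (hm0 τ hτ)
    simp_rw [mul_left_comm _ (a τ)⁻¹]
    rw [intervalIntegral.integral_const_mul, this, mul_zero]
  · intro τ hτ
    rw [hk]; simp only [mul_inv]
    have := h.csin _ (hm0 τ hτ)
    simp_rw [mul_left_comm _ (a τ)⁻¹]
    rw [intervalIntegral.integral_const_mul, this, mul_zero]
  · simp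
  · intro τ hτ θ
    refine le_trans ?_ (le_max_left _ _)
    have := mul_le_mul_of_nonneg_left (hb _ (hm1 τ hτ) θ).1 hc1p.le
    rw [hk]; simp only [ha]; linarith
  · intro τ hτ θ
    refine le_trans ?_ ((le_max_left _ _).trans (le_max_right _ _))
    have := mul_le_mul_of_nonneg_left (hb _ (hm1 τ hτ) θ).2 (pow_pos hc1p p).le
    rw [hV1]; simp only
    rw [abs_mul, abs_of_pos (pow_pos (hap τ) p)]; simp only [ha]
    rw [mul_pow, mul_pow]; linarith
  · intro τ hτ
    refine le_trans ?_ ((le_max_left _ _).trans ((le_max_right _ _).trans (le_max_right _ _)))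
    rw [hk]; simp only [mul_inv]
    rw [intervalIntegral.integral_const_mul]
    have hs := sg_pos (p := p) (htlt τ)
    have := mul_le_mul_of_nonneg_left (hL _ (hm2 τ hτ)) (inv_pos.2 (hap τ)).le
    refine this.trans (le_of_eq ?_)
    simp only [ha]; field_simp
end PC
namespace PC
open scoped ContDiff Topology
noncomputable def Phi (p : ℕ) (κ : ℝ → ℝ → ℝ) (t : ℝ) : ℝ :=
  if p = 1 then ∫ θ in (0:ℝ)..(2*π), Real.log (κ θ t)
  else (p/((p:ℝ)-1)) * ∫ θ in (0:ℝ)..(2*π), κ θ t ^ (p-1)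
noncomputable def J (p : ℕ) (κ : ℝ → ℝ → ℝ) (t : ℝ) : ℝ :=
  (∫ θ in (0:ℝ)..(2*π), ((V p κ θ t)^2 - (dx (V p κ) θ t)^2) / 2) - Phi p κ t
noncomputable def Ds (p : ℕ) (κ : ℝ → ℝ → ℝ) (t : ℝ) : ℝ :=
  ∫ θ in (0:ℝ)..(2*π), κ θ t ^ (p+1) * G p κ θ t ^ 2
namespace NF
variable {p : ℕ} {C τ1 : ℝ} {κ : ℝ → ℝ → ℝ} (h : NF p C τ1 κ)
include h
lemma Ds_nonneg {t : ℝ} (ht : t ∈ Ioi τ1) : 0 ≤ Ds p κ t :=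
  intervalIntegral.integral_nonneg two_pi_pos'.le fun θ _ =>
    mul_nonneg (pow_pos (h.fl.pos θ t ht) _).le (sq_nonneg _)
lemma hPhi {t : ℝ} (ht : t ∈ Ioi τ1) : HasDerivAt (Phi p κ)
    (p * ∫ θ in (0:ℝ)..(2*π), κ θ t ^ p * G p κ θ t) t := by
  have hp := h.fl.hp
  unfold Phi
  by_cases h1 : p = 1
  · subst h1
    simpa using h.fl.hint_log ht
  · simp only [h1, if_false]
    refine ((h.fl.hint_pow (p-1) ht).const_mul _).congr_deriv ?_
    rw [Nat.sub_add_cancel hp, Nat.cast_sub hp]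
    have : (p:ℝ) - 1 ≠ 0 := by
      rw [sub_ne_zero]; exact_mod_cast h1
    push_cast
    field_simp
lemma hJ {t : ℝ} (ht : t ∈ Ioi τ1) : HasDerivAt (J p κ) (p * Ds p κ t) t := by
  unfold J
  refine ((h.fl.hint_E ht).sub (h.hPhi ht)).congr_deriv ?_
  rw [← mul_sub, ← intervalIntegral.integral_sub]
  · unfold Ds; congr 1; apply intervalIntegral.integral_congr
    intro θ _
    simp only
    have e : V p κ θ t + dx (dx (V p κ)) θ t = G p κ θ t + (κ θ t)⁻¹ := by unfold G; ring
    have := (h.fl.pos θ t ht).ne'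
    rw [e]; field_simp; ring
  · exact (((h.fl.smV.add h.fl.smV2).mul ((h.fl.sm.pow (p+1)).mul h.fl.smH)).cont
      ht).intervalIntegrable _ _
  · exact (((h.fl.sm.pow p).mul h.fl.smH).cont ht).intervalIntegrable _ _
lemma Jbdd : ∃ M, ∀ t ∈ Ioi τ1, J p κ t ≤ M := by
  refine ⟨(2*π) * ((C^p)^2/2) + C, fun t ht => ?_⟩
  have hC := h.C1
  have h1 : (∫ θ in (0:ℝ)..(2*π), ((V p κ θ t)^2 - (dx (V p κ) θ t)^2) / 2)
      ≤ (2*π) * ((C^p)^2/2) := by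
    have : (∫ θ in (0:ℝ)..(2*π), ((V p κ θ t)^2 - (dx (V p κ) θ t)^2) / 2)
      ≤ ∫ θ in (0:ℝ)..(2*π), ((C^p)^2/2) := by
      refine intervalIntegral.integral_mono_on two_pi_pos'.le ?_ intervalIntegrable_const ?_
      · exact ((((h.fl.smV.cont ht).pow 2).sub ((h.fl.smV1.cont ht).pow 2)).div_const
          2).intervalIntegrable _ _
      · intro θ _
        have h2 : V p κ θ t ≤ C^p := pow_le_pow_left₀ (h.fl.pos θ t ht).le (h.hκ t ht θ) p
        have h3 : V p κ θ t ^2 ≤ (C^p)^2 := pow_le_pow_left₀ (pow_pos (h.fl.pos θ t ht) p).le h2 2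
        have := sq_nonneg (dx (V p κ) θ t)
        linarith
    rwa [intervalIntegral.integral_const, smul_eq_mul, sub_zero] at this
  have h2 : -C ≤ Phi p κ t := by
    unfold Phi
    split_ifs with h1
    · have h5 : ∫ θ in (0:ℝ)..(2*π), -(κ θ t)⁻¹
          ≤ ∫ θ in (0:ℝ)..(2*π), Real.log (κ θ t) := by
        refine intervalIntegral.integral_mono_on two_pi_pos'.le
          ((h.fl.smInv.cont ht).neg.intervalIntegrable _ _)
          (((h.fl.sm.log fun θ t ht => (h.fl.pos θ t ht).ne').cont ht).intervalIntegrable _ _) ?_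
        intro θ _
        have h4 := Real.log_le_sub_one_of_pos (inv_pos.2 (h.fl.pos θ t ht))
        rw [Real.log_inv] at h4
        linarith
      rw [intervalIntegral.integral_neg] at h5
      linarith [h.hr t ht]
    · have hp := h.fl.hp
      have : (1:ℝ) ≤ p := by exact_mod_cast hp
      have h4 : 0 ≤ ∫ θ in (0:ℝ)..(2*π), κ θ t ^ (p-1) :=
        intervalIntegral.integral_nonneg two_pi_pos'.le fun θ _ =>
          (pow_pos (h.fl.pos θ t ht) _).le
      have : 0 ≤ (p/((p:ℝ)-1)) := div_nonneg (by linarith) (by linarith)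
      have := mul_nonneg this h4
      linarith
  unfold J; linarith
lemma Jmono : MonotoneOn (J p κ) (Ioi τ1) := by
  refine monotoneOn_of_deriv_nonneg (convex_Ioi _)
    (fun x hx => (h.hJ hx).continuousAt.continuousWithinAt) ?_ ?_
  · rw [interior_Ioi]; exact fun x hx => (h.hJ hx).differentiableAt.differentiableWithinAt
  · rw [interior_Ioi]; intro x hx; rw [(h.hJ hx).deriv]
    exact mul_nonneg (by positivity) (h.Ds_nonneg hx)
lemma Jlim : ∃ L, Tendsto (J p κ) atTop (𝓝 L) := by
  obtain ⟨M, hM⟩ := h.Jbdd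
  have hm : ∀ t, max t (τ1+1) ∈ Ioi τ1 := fun t => by
    have := le_max_right t (τ1+1)
    exact lt_of_lt_of_le (by linarith) this
  have hmono : Monotone fun t => J p κ (max t (τ1+1)) := fun a b hab =>
    h.Jmono (hm a) (hm b) (max_le_max_right _ hab)
  refine ⟨_, (tendsto_atTop_ciSup hmono ⟨M, ?_⟩).congr' ?_⟩
  · rintro _ ⟨t, rfl⟩; exact hM _ (hm t)
  · filter_upwards [eventually_ge_atTop (τ1+1)] with t ht
    rw [max_eq_left ht]
lemma Jsmall {ε : ℝ} (hε : 0 < ε) : ∃ τ2 > τ1, ∀ t ≥ τ2, ∀ s ≥ t, J p κ s - J p κ t ≤ ε := by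
  obtain ⟨L, hL⟩ := h.Jlim
  obtain ⟨N, hN⟩ := Metric.tendsto_atTop.1 hL (ε/2) (by linarith)
  refine ⟨max N (τ1+1), lt_of_lt_of_le (by linarith) (le_max_right _ _), fun t ht s hs => ?_⟩
  have h1 := hN t (le_of_max_le_left ht)
  have h2 := hN s ((le_of_max_le_left ht).trans hs)
  rw [Real.dist_eq] at h1 h2
  have := abs_lt.1 h1
  have := abs_lt.1 h2
  linarith
end NF
end PC
namespace PC
open scoped ContDiff Topology
def Stu (B : ℝ) (g g1 Q : ℝ → ℝ) : Prop :=
  Continuous g ∧ ∀ x, g x ≠ 0 → HasDerivAt g (g1 x) x ∧ HasDerivAt g1 ((Q x - 4) * g x) x ∧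
    0 < Q x ∧ |g1 x| ≤ B
lemma Stu.neg {B : ℝ} {g g1 Q : ℝ → ℝ} (h : Stu B g g1 Q) :
    Stu B (fun x => - g x) (fun x => - g1 x) Q := by
  refine ⟨h.1.neg, fun x hx => ?_⟩
  obtain ⟨h1, h2, h3, h4⟩ := h.2 x (by simpa using hx)
  exact ⟨h1.neg, h2.neg.congr_deriv (by ring), h3, by rwa [abs_neg]⟩
lemma Stu.len {B : ℝ} {g g1 Q : ℝ → ℝ} (h : Stu B g g1 Q) {α β : ℝ} (hab : α < β)
    (hα : g α = 0) (hβ : g β = 0) (hpos : ∀ x ∈ Ioo α β, 0 < g x) : π / 2 < β - α := by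
  by_contra! hle
  have hd : 0 < β - α := sub_pos.2 hab
  set w := π / (β - α) with hw
  have hw0 : 0 < w := div_pos Real.pi_pos hd
  have hw2 : 2 ≤ w := by rw [hw, le_div_iff₀ hd]; linarith
  have hwd : w * (β - α) = π := by rw [hw]; field_simp
  set φ : ℝ → ℝ := fun x => Real.sin (w * (x - α)) with hφ
  set ψ : ℝ → ℝ := fun x => w * Real.cos (w * (x - α)) with hψ
  have hl : ∀ x, HasDerivAt (fun x => w * (x - α)) w x := fun x => by
    simpa using ((hasDerivAt_id x).sub_const α).const_mul w
  have dφ : ∀ x, HasDerivAt φ (ψ x) x := fun x => (hl x).sin.congr_deriv (by simp only [hψ]; ring)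
  have dψ : ∀ x, HasDerivAt ψ (-(w^2 * φ x)) x := fun x =>
    ((hl x).cos.const_mul w).congr_deriv (by simp only [hφ]; ring)
  have cφ : Continuous φ := by fun_prop
  have φpos : ∀ x ∈ Ioo α β, 0 < φ x := by
    intro x hx
    refine Real.sin_pos_of_pos_of_lt_pi (mul_pos hw0 (by linarith [hx.1])) ?_
    rw [← hwd]; exact mul_lt_mul_of_pos_left (by linarith [hx.2]) hw0
  set W : ℝ → ℝ := fun x => g1 x * φ x - g x * ψ x with hW
  have dW : ∀ x ∈ Ioo α β, HasDerivAt W ((Q x + (w^2 - 4)) * (g x * φ x)) x := by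
    intro x hx
    obtain ⟨h1, h2, h3, h4⟩ := h.2 x (hpos x hx).ne'
    exact ((h2.mul (dφ x)).sub (h1.mul (dψ x))).congr_deriv (by ring)
  have hmono : StrictMonoOn W (Ioo α β) := by
    refine strictMonoOn_of_deriv_pos (convex_Ioo _ _)
      (fun x hx => (dW x hx).continuousAt.continuousWithinAt) ?_
    rw [interior_Ioo]
    intro x hx
    rw [(dW x hx).deriv]
    refine mul_pos ?_ (mul_pos (hpos x hx) (φpos x hx))
    have := (h.2 x (hpos x hx).ne').2.2.1
    have : 4 ≤ w^2 := by nlinarith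
    linarith
  have hbd : ∀ x ∈ Ioo α β, ‖W x‖ ≤ B * |φ x| + |g x| * w := by
    intro x hx
    have h4 := (h.2 x (hpos x hx).ne').2.2.2
    refine (norm_sub_le _ _).trans (add_le_add ?_ ?_)
    · rw [Real.norm_eq_abs, abs_mul]; exact mul_le_mul_of_nonneg_right h4 (abs_nonneg _)
    · rw [Real.norm_eq_abs, abs_mul]
      refine mul_le_mul_of_nonneg_left ?_ (abs_nonneg _)
      simp only [hψ]
      rw [abs_mul, abs_of_pos hw0]
      exact mul_le_of_le_one_right hw0.le (Real.abs_cos_le_one _)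
  have hc : Continuous fun x => B * |φ x| + |g x| * w := by
    have := h.1
    fun_prop
  have eα : B * |φ α| + |g α| * w = 0 := by rw [hα]; simp [hφ]
  have eβ : B * |φ β| + |g β| * w = 0 := by rw [hβ]; simp [hφ, hwd]
  have tα : Tendsto W (𝓝[>] α) (𝓝 0) := by
    refine squeeze_zero_norm' (f := W) (a := fun x => B * |φ x| + |g x| * w) ?_ ?_
    · filter_upwards [Ioo_mem_nhdsGT hab] with x hx using hbd x hx
    · have := hc.tendsto α; rw [eα] at this; exact this.mono_left nhdsWithin_le_nhds
  have tβ : Tendsto W (𝓝[<] β) (𝓝 0) := by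
    refine squeeze_zero_norm' (f := W) (a := fun x => B * |φ x| + |g x| * w) ?_ ?_
    · filter_upwards [Ioo_mem_nhdsLT hab] with x hx using hbd x hx
    · have := hc.tendsto β; rw [eβ] at this; exact this.mono_left nhdsWithin_le_nhds
  obtain ⟨x, hx⟩ := exists_between hab
  obtain ⟨y, hy⟩ := exists_between hx.2
  have hxm : x ∈ Ioo α β := hx
  have hym : y ∈ Ioo α β := ⟨hx.1.trans hy.1, hy.2⟩
  have h1 : 0 ≤ W x := by
    refine le_of_tendsto tα ?_
    filter_upwards [Ioo_mem_nhdsGT hx.1] with u hu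
    exact (hmono ⟨hu.1, hu.2.trans hx.2⟩ hxm hu.2).le
  have h2 : W y ≤ 0 := by
    refine ge_of_tendsto tβ ?_
    filter_upwards [Ioo_mem_nhdsLT hy.2] with u hu
    exact (hmono hym ⟨hym.1.trans hu.1, hu.2⟩ hu.1).le
  have := hmono hxm hym hy.1
  linarith
lemma sep {g : ℝ → ℝ} (hg : Continuous g) {x y : ℝ} (hxy : x < y) (hx : 0 < g x) (hy : g y < 0) :
    ∃ β α, x < β ∧ β ≤ α ∧ α < y ∧ g β = 0 ∧ g α = 0 ∧ (∀ z ∈ Ico x β, 0 < g z) ∧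
      ∀ z ∈ Ioc α y, g z < 0 := by
  have c1 : IsCompact (Icc x y ∩ {z | g z ≤ 0}) :=
    isCompact_Icc.inter_right (isClosed_le hg continuous_const)
  have c2 : IsCompact (Icc x y ∩ {z | 0 ≤ g z}) :=
    isCompact_Icc.inter_right (isClosed_le continuous_const hg)
  obtain ⟨β, ⟨hβm, hβ0⟩, hβ⟩ := c1.exists_isLeast ⟨y, ⟨hxy.le, le_rfl⟩, hy.le⟩
  obtain ⟨α, ⟨hαm, hα0⟩, hα⟩ := c2.exists_isGreatest ⟨x, ⟨le_rfl, hxy.le⟩, hx.le⟩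
  simp only [mem_ofPred_eq] at hβ0 hα0
  have p1 : ∀ z ∈ Ico x β, 0 < g z := fun z hz => by
    by_contra! hc
    have := hβ (⟨⟨hz.1, hz.2.le.trans hβm.2⟩, hc⟩ : z ∈ Icc x y ∩ {z | g z ≤ 0})
    linarith [hz.2]
  have p2 : ∀ z ∈ Ioc α y, g z < 0 := fun z hz => by
    by_contra! hc
    have := hα (⟨⟨hαm.1.trans hz.1.le, hz.2⟩, hc⟩ : z ∈ Icc x y ∩ {z | 0 ≤ g z})
    linarith [hz.1]
  have hxβ : x < β := lt_of_le_of_ne hβm.1 fun e => by rw [← e] at hβ0; linarith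
  have hαy : α < y := lt_of_le_of_ne hαm.2 fun e => by rw [e] at hα0; linarith
  have e1 : g β = 0 := by
    refine le_antisymm hβ0 (ge_of_tendsto ((hg.tendsto β).mono_left nhdsWithin_le_nhds :
      Tendsto g (𝓝[<] β) _) ?_)
    filter_upwards [Ioo_mem_nhdsLT hxβ] with z hz using (p1 z ⟨hz.1.le, hz.2⟩).le
  have e2 : g α = 0 := by
    refine le_antisymm (le_of_tendsto ((hg.tendsto α).mono_left nhdsWithin_le_nhds :
      Tendsto g (𝓝[>] α) _) ?_) hα0
    filter_upwards [Ioo_mem_nhdsGT hαy] with z hz using (p2 z ⟨hz.1, hz.2.le⟩).le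
  exact ⟨β, α, hxβ, hα ⟨hβm, e1.ge⟩, hαy, e1, e2, p1, p2⟩
lemma Stu.no4 {B : ℝ} {g g1 Q : ℝ → ℝ} (h : Stu B g g1 Q) (hper : ∀ x, g (x + 2*π) = g x)
    {x1 x2 x3 x4 : ℝ} (h12 : x1 < x2) (h23 : x2 < x3) (h34 : x3 < x4) (h41 : x4 < x1 + 2*π)
    (h1 : 0 < g x1) (h2 : g x2 < 0) (h3 : 0 < g x3) (h4 : g x4 < 0) : False := by
  have hn := h.neg
  obtain ⟨b1, a2, h1b, hba1, ha2, eb1, ea2, p1, n2⟩ := sep h.1 h12 h1 h2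
  obtain ⟨b2, a3, h2b, hba2, ha3, eb2, ea3, n2', p3⟩ := sep hn.1 h23 (neg_pos.2 h2) (by linarith)
  obtain ⟨b3, a4, h3b, hba3, ha4, eb3, ea4, p3', n4⟩ := sep h.1 h34 h3 h4
  obtain ⟨b4, a5, h4b, hba4, ha5, eb4, ea5, n4', p1'⟩ := sep hn.1 h41 (neg_pos.2 h4)
    (by rw [hper]; linarith)
  have l1 := h.len (α := a5 - 2*π) (β := b1) (by linarith)
    (by rw [← hper, sub_add_cancel]; simpa using ea5) eb1 (fun z hz => by
      rcases le_or_gt x1 z with hz1 | hz1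
      · exact p1 z ⟨hz1, hz.2⟩
      · have := p1' (z + 2*π) ⟨by linarith [hz.1], by linarith⟩
        rw [hper] at this; linarith)
  have l2 := hn.len (α := a2) (β := b2) (by linarith) (by rw [ea2, neg_zero]) eb2 (fun z hz => by
      rcases le_or_gt x2 z with hz1 | hz1
      · exact n2' z ⟨hz1, hz.2⟩
      · have := n2 z ⟨hz.1, hz1.le⟩
        linarith)
  have l3 := h.len (α := a3) (β := b3) (by linarith) (by simpa using ea3) eb3 (fun z hz => by
      rcases le_or_gt x3 z with hz1 | hz1
      · exact p3' z ⟨hz1, hz.2⟩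
      · have := p3 z ⟨hz.1, hz1.le⟩
        linarith)
  have l4 := hn.len (α := a4) (β := b4) (by linarith) (by rw [ea4, neg_zero]) eb4 (fun z hz => by
      rcases le_or_gt x4 z with hz1 | hz1
      · exact n4' z ⟨hz1, hz.2⟩
      · have := n4 z ⟨hz.1, hz1.le⟩
        linarith)
  linarith
lemma unimodal {W g : ℝ → ℝ} (hW : ∀ x, HasDerivAt W (g x) x)
    (hper : ∀ x, W (x + 2*π) = W x)
    (no4 : ∀ x1 x2 x3 x4, x1 < x2 → x2 < x3 → x3 < x4 → x4 < x1 + 2*π →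
      0 < g x1 → g x2 < 0 → 0 < g x3 → g x4 < 0 → False)
    {a b : ℝ} (ha : ∀ x, W a ≤ W x) (hb : ∀ x, W x ≤ W b) (hab : W a < W b)
    (h1 : a < b) (h2 : b < a + 2*π) :
    MonotoneOn W (Icc a b) ∧ AntitoneOn W (Icc b (a + 2*π)) := by
  have up : ∀ x y, x < y → W x < W y → ∃ z ∈ Ioo x y, 0 < g z := by
    intro x y hxy hlt
    obtain ⟨z, hz, e⟩ := exists_hasDerivAt_eq_slope W g hxy
      (fun z _ => (hW z).continuousAt.continuousWithinAt) (fun z _ => hW z)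
    exact ⟨z, hz, by rw [e]; exact div_pos (by linarith) (by linarith)⟩
  have dn : ∀ x y, x < y → W y < W x → ∃ z ∈ Ioo x y, g z < 0 := by
    intro x y hxy hlt
    obtain ⟨z, hz, e⟩ := exists_hasDerivAt_eq_slope W g hxy
      (fun z _ => (hW z).continuousAt.continuousWithinAt) (fun z _ => hW z)
    exact ⟨z, hz, by rw [e]; exact div_neg_of_neg_of_pos (by linarith) (by linarith)⟩
  have hpa := hper a
  refine ⟨fun x hx y hy hxy => ?_, fun x hx y hy hxy => ?_⟩
  · by_contra! hlt
    have hxy' : x < y := lt_of_le_of_ne hxy fun e => by rw [e] at hlt; linarith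
    have hax : a < x := lt_of_le_of_ne hx.1 fun e => by have := ha y; rw [e] at this; linarith
    have hyb : y < b := lt_of_le_of_ne hy.2 fun e => by have := hb x; rw [← e] at this; linarith
    obtain ⟨x1, hx1, g1⟩ := up a x hax (by linarith [ha y])
    obtain ⟨x2, hx2, g2⟩ := dn x y hxy' hlt
    obtain ⟨x3, hx3, g3⟩ := up y b hyb (by linarith [hb x])
    obtain ⟨x4, hx4, g4⟩ := dn b (a + 2*π) h2 (by rw [hpa]; exact hab)
    exact no4 x1 x2 x3 x4 (hx1.2.trans hx2.1) (hx2.2.trans hx3.1) (hx3.2.trans hx4.1)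
      (by linarith [hx4.2, hx1.1]) g1 g2 g3 g4
  · by_contra! hlt
    have hxy' : x < y := lt_of_le_of_ne hxy fun e => by rw [e] at hlt; linarith
    have hbx : b < x := lt_of_le_of_ne hx.1 fun e => by have := hb y; rw [e] at this; linarith
    have hya : y < a + 2*π := lt_of_le_of_ne hy.2 fun e => by
      have := ha x; rw [← hpa, ← e] at this; linarith
    obtain ⟨x1, hx1, g1⟩ := up a b h1 hab
    obtain ⟨x2, hx2, g2⟩ := dn b x hbx (by linarith [hb y])
    obtain ⟨x3, hx3, g3⟩ := up x y hxy' hlt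
    obtain ⟨x4, hx4, g4⟩ := dn y (a + 2*π) hya (by rw [hpa]; linarith [ha x])
    exact no4 x1 x2 x3 x4 (hx1.2.trans hx2.1) (hx2.2.trans hx3.1) (hx3.2.trans hx4.1)
      (by linarith [hx4.2, hx1.1]) g1 g2 g3 g4
end PC
namespace PC
open scoped ContDiff Topology
lemma cheb {R : ℝ → ℝ} (hR : Continuous R) {a b c : ℝ} (h1 : a < b) (h2 : b < a + 2*π)
    (hc : c = (a+b)/2) (ha : AntitoneOn R (Icc a b)) (hm : MonotoneOn R (Icc b (a+2*π)))
    (hI : 0 ≤ ∫ θ in a..(a+2*π), R θ * Real.sin (θ - c)) : R a = R b := by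
  have hpi := Real.pi_pos
  have i1 : ∫ θ in a..b, Real.sin (θ - c) = 0 := by
    rw [intervalIntegral.integral_comp_sub_right (fun x => Real.sin x), integral_sin,
      show a - c = -(b - c) by rw [hc]; ring, Real.cos_neg, sub_self]
  have i2 : ∫ θ in b..(a+2*π), Real.sin (θ - c) = 0 := by
    rw [intervalIntegral.integral_comp_sub_right (fun x => Real.sin x), integral_sin,
      show a + 2*π - c = -(b - c) + 2*π by rw [hc]; ring, Real.cos_add_two_pi,
      Real.cos_neg, sub_self]
  have f1 : ∀ θ ∈ Icc a b, 0 ≤ (R c - R θ) * Real.sin (θ - c) := by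
    intro θ hθ
    have hcm : c ∈ Icc a b := ⟨by linarith, by linarith⟩
    rcases le_total θ c with h | h
    · exact mul_nonneg_of_nonpos_of_nonpos (by linarith [ha hθ hcm h])
        (Real.sin_nonpos_of_nonpos_of_neg_pi_le (by linarith) (by linarith [hθ.1]))
    · exact mul_nonneg (by linarith [ha hcm hθ h])
        (Real.sin_nonneg_of_nonneg_of_le_pi (by linarith) (by linarith [hθ.2]))
  have f2 : ∀ θ ∈ Icc b (a+2*π), 0 ≤ (R (c+π) - R θ) * Real.sin (θ - c) := by
    intro θ hθ
    have hcm : c + π ∈ Icc b (a+2*π) := ⟨by linarith, by linarith⟩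
    rcases le_total θ (c+π) with h | h
    · exact mul_nonneg (by linarith [hm hθ hcm h])
        (Real.sin_nonneg_of_nonneg_of_le_pi (by linarith [hθ.1]) (by linarith))
    · have : Real.sin (θ - c) ≤ 0 := by
        rw [← Real.sin_sub_two_pi]
        exact Real.sin_nonpos_of_nonpos_of_neg_pi_le (by linarith [hθ.2]) (by linarith)
      exact mul_nonneg_of_nonpos_of_nonpos (by linarith [hm hcm hθ h]) this
  have c1 : ∀ d, Continuous fun θ => (d - R θ) * Real.sin (θ - c) := fun d => by fun_prop
  have c2 : Continuous fun θ => R θ * Real.sin (θ - c) := by fun_prop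
  have e : ∀ d x y, ∫ θ in x..y, (d - R θ) * Real.sin (θ - c)
      = d * (∫ θ in x..y, Real.sin (θ - c)) - ∫ θ in x..y, R θ * Real.sin (θ - c) := by
    intro d x y
    rw [← intervalIntegral.integral_const_mul, ← intervalIntegral.integral_sub]
    · congr 1; funext θ; ring
    · exact Continuous.intervalIntegrable (by fun_prop) _ _
    · exact c2.intervalIntegrable _ _
  have hs := intervalIntegral.integral_add_adjacent_intervals
    (c2.intervalIntegrable (μ := volume) a b) (c2.intervalIntegrable b (a+2*π))
  have n2 : 0 ≤ ∫ θ in b..(a+2*π), (R (c+π) - R θ) * Real.sin (θ - c) :=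
    intervalIntegral.integral_nonneg h2.le f2
  rw [e, i2] at n2
  by_contra hne
  have n1 : 0 < ∫ θ in a..b, (R c - R θ) * Real.sin (θ - c) := by
    refine intervalIntegral.integral_pos h1 (c1 _).continuousOn
      (fun θ hθ => f1 θ ⟨hθ.1.le, hθ.2⟩) ?_
    by_cases hac : R a = R c
    · refine ⟨b, ⟨h1.le, le_rfl⟩, mul_pos ?_ (Real.sin_pos_of_pos_of_lt_pi (by linarith)
        (by linarith))⟩
      have := ha (⟨by linarith, by linarith⟩ : c ∈ Icc a b) ⟨h1.le, le_rfl⟩ (by linarith)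
      exact sub_pos.2 (lt_of_le_of_ne this fun e => hne (by rw [hac, e]))
    · refine ⟨a, ⟨le_rfl, h1.le⟩, mul_pos_of_neg_of_neg ?_
        (Real.sin_neg_of_neg_of_neg_pi_lt (by linarith) (by linarith))⟩
      have := ha (⟨le_rfl, h1.le⟩ : a ∈ Icc a b) (⟨by linarith, by linarith⟩ : c ∈ Icc a b)
        (by linarith)
      exact sub_neg.2 (lt_of_le_of_ne this fun e => hac e.symm)
  rw [e, i1] at n1
  linarith
lemma classify {p : ℕ} (hp : 1 ≤ p) {C q : ℝ} (hC : 1 ≤ C) (hq : q = 1/(p:ℝ)) {V V1 : ℝ → ℝ}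
    (hper : ∀ x, V (x + 2*π) = V x) (h0 : ∀ x, 0 ≤ V x)
    (hVC : ∀ x, V x ≤ C) (hL : ∀ x y, |V x - V y| ≤ C * |x - y|)
    (hd : ∀ x, 0 < V x → HasDerivAt V (V1 x) x ∧ HasDerivAt V1 (V x ^ (-q) - V x) x ∧ |V1 x| ≤ C)
    (hZ : ∀ a b, a < b → ∃ x ∈ Ioo a b, 0 < V x)
    (hcl : ∀ m > 0, ∀ c, (∀ θ, 0 ≤ Real.sin (θ - c) → 2 * m ≤ V θ) →
      0 ≤ ∫ θ in (0:ℝ)..(2*π), (max (V θ) m) ^ (-q) * Real.sin (θ - c)) :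
    ∀ x, V x = 1 := by
  have hpi := Real.pi_pos
  have hp0 : (1:ℝ) ≤ p := by exact_mod_cast hp
  have hq0 : 0 < q := by rw [hq]; positivity
  have hq1 : q ≤ 1 := by rw [hq, div_le_one (by linarith)]; exact hp0
  have hC0 : 0 < C := by linarith
  have Vc : Continuous V := by
    refine (LipschitzWith.of_dist_le_mul (K := ⟨C, hC0.le⟩) fun x y => ?_).continuous
    rw [Real.dist_eq, Real.dist_eq]; exact hL x y
  set g : ℝ → ℝ := fun x => 2 * V x * V1 x with hg
  set g1 : ℝ → ℝ := fun x => 2 * V1 x ^ 2 + 2 * V x ^ (1 - q) - 2 * V x ^ 2 with hg1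
  have hW : ∀ x, HasDerivAt (fun x => V x ^ 2) (g x) x := by
    intro x
    rcases (h0 x).eq_or_lt with hx | hx
    · have e : g x = 0 := by simp only [hg]; rw [← hx]; ring
      rw [e, hasDerivAt_iff_isLittleO]
      simp only [← hx, smul_zero, sub_zero]
      have h1 : (fun y => V y ^ 2 - 0 ^ 2) =O[𝓝 x] fun y => (y - x) ^ 2 := by
        refine Asymptotics.IsBigO.of_bound (C^2) (Eventually.of_forall fun y => ?_)
        have := hL y x
        rw [← hx, sub_zero] at this
        simp only [norm_pow, Real.norm_eq_abs, ne_eq, OfNat.ofNat_ne_zero, not_false_eq_true,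
          zero_pow, sub_zero]
        rw [← mul_pow]
        exact pow_le_pow_left₀ (abs_nonneg _) this 2
      refine h1.trans_isLittleO ?_
      have h2 : (fun y : ℝ => y - x) =o[𝓝 x] fun _ => (1:ℝ) := by
        rw [Asymptotics.isLittleO_one_iff]
        have : Tendsto (fun y : ℝ => y - x) (𝓝 x) (𝓝 (x - x)) :=
          (continuous_id.sub continuous_const).tendsto x
        rwa [sub_self] at this
      have h3 := h2.mul_isBigO (Asymptotics.isBigO_refl (fun y : ℝ => y - x) (𝓝 x))
      simpa [sq] using h3
    · refine ((hd x hx).1.pow 2).congr_deriv ?_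
      simp only [hg]; norm_num
  have gV : ∀ x, g x ≠ 0 → 0 < V x := fun x hx => (h0 x).lt_of_ne fun e => hx (by
    simp only [hg]; rw [← e]; ring)
  have dg : ∀ x, 0 < V x → HasDerivAt g (g1 x) x := by
    intro x hx
    obtain ⟨d1, d2, -⟩ := hd x hx
    refine ((d1.const_mul 2).mul d2).congr_deriv ?_
    simp only [hg1]
    rw [show 1 - q = -q + 1 by ring, Real.rpow_add hx, Real.rpow_one]; ring
  have gc : Continuous g := by
    rw [continuous_iff_continuousAt]
    intro x
    rcases (h0 x).eq_or_lt with hx | hx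
    · have e : g x = 0 := by simp only [hg]; rw [← hx]; ring
      unfold ContinuousAt
      rw [e]
      refine squeeze_zero_norm (a := fun y => 2 * C * V y) (fun y => ?_) ?_
      · rcases (h0 y).eq_or_lt with hy | hy
        · simp [hg, ← hy]
        · simp only [hg, Real.norm_eq_abs, abs_mul, abs_two, abs_of_pos hy]
          have := mul_le_mul_of_nonneg_left (hd y hy).2.2 (show 0 ≤ 2 * V y by linarith)
          linarith
      · have : Continuous fun y => 2 * C * V y := by fun_prop
        have := this.tendsto x
        rwa [← hx, mul_zero] at this
    · exact (dg x hx).continuousAt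
  have hS : Stu (2*C^2+2*C+2*C^2) g g1 (fun x => (3 - q) * V x ^ (-q-1)) := by
    refine ⟨gc, fun x hx => ?_⟩
    have hV := gV x hx
    obtain ⟨d1, d2, d3⟩ := hd x hV
    refine ⟨dg x hV, ?_, mul_pos (by linarith) (Real.rpow_pos_of_pos hV _), ?_⟩
    · refine (((d2.pow 2).const_mul 2).add ((d1.rpow_const (p := 1-q) (Or.inl hV.ne')).const_mul 2)
        |>.sub ((d1.pow 2).const_mul 2)).congr_deriv ?_
      simp only [hg]
      rw [show 1 - q - 1 = -q by ring, show V x ^ (-q) = V x * V x ^ (-q-1) by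
        rw [Real.rpow_sub_one hV.ne']; field_simp]
      norm_num
      ring
    · simp only [hg1]
      have a1 : V x ^ (1-q) ≤ C := by
        calc V x ^ (1-q) ≤ C ^ (1-q) := Real.rpow_le_rpow hV.le (hVC x) (by linarith)
          _ ≤ C ^ (1:ℝ) := Real.rpow_le_rpow_of_exponent_le hC (by linarith)
          _ = C := Real.rpow_one C
      have a2 : V x ^ 2 ≤ C ^ 2 := pow_le_pow_left₀ hV.le (hVC x) 2
      have a3 : V1 x ^ 2 ≤ C ^ 2 := sq_le_sq' (abs_le.1 d3).1 (abs_le.1 d3).2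
      have a4 : 0 ≤ V x ^ (1-q) := (Real.rpow_pos_of_pos hV _).le
      have := sq_nonneg (V x)
      have := sq_nonneg (V1 x)
      have := sq_nonneg C
      rw [abs_le]; constructor <;> linarith
  have hVp : ∀ x, V (x + 2*π) = V x := hper
  have gper : ∀ x, g (x + 2*π) = g x := by
    intro x
    rw [← (hW x).deriv, ← (hW (x + 2*π)).deriv,
      ← deriv_comp_add_const (fun x => V x ^ 2) (2*π) x]
    congr 1; funext y; simp only [hper]
  have hP : Function.Periodic V (2*π) := hper
  obtain ⟨a, -, ha⟩ := isCompact_Icc.exists_isMinOn (nonempty_Icc.2 two_pi_pos'.le) Vc.continuousOn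
  have ha' : ∀ x, V a ≤ V x := fun x => by
    obtain ⟨y, hy, e⟩ := hP.exists_mem_Ico₀ two_pi_pos' x
    rw [e]; exact ha ⟨hy.1, hy.2.le⟩
  obtain ⟨b, hbm, hb⟩ := isCompact_Icc.exists_isMaxOn (s := Icc a (a + 2*π))
    (nonempty_Icc.2 (by linarith)) Vc.continuousOn
  have hb' : ∀ x, V x ≤ V b := fun x => by
    obtain ⟨y, hy, e⟩ := hP.exists_mem_Ico two_pi_pos' x a
    rw [e]; exact hb ⟨hy.1, hy.2.le⟩
  have hconst : V a = V b := by
    by_contra hne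
    have hlt : V a < V b := lt_of_le_of_ne (ha' b) hne
    have hab : a < b := lt_of_le_of_ne hbm.1 fun e => hne (by rw [← e])
    have hb2 : b < a + 2*π := lt_of_le_of_ne hbm.2 fun e => hne (by rw [e, hper])
    obtain ⟨m1, m2⟩ := unimodal hW (fun x => by rw [hper])
      (fun x1 x2 x3 x4 => hS.no4 gper)
      (a := a) (b := b) (fun x => pow_le_pow_left₀ (h0 a) (ha' x) 2)
      (fun x => pow_le_pow_left₀ (h0 x) (hb' x) 2)
      (pow_lt_pow_left₀ hlt (h0 a) two_ne_zero) hab hb2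
    have m1' : MonotoneOn V (Icc a b) := fun x hx y hy hxy =>
      le_of_pow_le_pow_left₀ two_ne_zero (h0 y) (m1 hx hy hxy)
    have m2' : AntitoneOn V (Icc b (a+2*π)) := fun x hx y hy hxy =>
      le_of_pow_le_pow_left₀ two_ne_zero (h0 x) (m2 hx hy hxy)
    set c := (a+b)/2 with hc
    obtain ⟨y, hy, hy0⟩ := hZ a c (by linarith)
    obtain ⟨z, hz, hz0⟩ := hZ (c+π) (a+2*π) (by linarith)
    set m := min (V y) (V z) / 2 with hm
    have hm0 : 0 < m := by rw [hm]; positivity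
    have hmy : 2 * m ≤ V y := by rw [hm]; linarith [min_le_left (V y) (V z)]
    have hmz : 2 * m ≤ V z := by rw [hm]; linarith [min_le_right (V y) (V z)]
    have hcond : ∀ θ, 0 ≤ Real.sin (θ - c) → 2 * m ≤ V θ := by
      intro θ hθ
      have hsP : Function.Periodic (fun x => (V x, Real.sin (x - c))) (2*π) := fun x => by
        simp only; rw [hper, show x + 2*π - c = x - c + 2*π by ring,
          Real.sin_add_two_pi]
      obtain ⟨u, hu, e⟩ := hsP.exists_mem_Ico two_pi_pos' θ y
      simp only [Prod.mk.injEq] at e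
      rw [e.1]; rw [e.2] at hθ
      have hu2 : u ≤ z := by
        by_contra! hzu
        by_cases hq : u ≤ a + 2*π
        all_goals
          have : Real.sin (u - c) < 0 := by
            rw [← Real.sin_sub_two_pi]
            exact Real.sin_neg_of_neg_of_neg_pi_lt (by linarith [hu.2, hy.2, hy.1])
              (by linarith [hz.1, hu.1])
          linarith
      rcases le_total u b with h | h
      · exact hmy.trans (m1' ⟨hy.1.le, by linarith [hy.2]⟩ ⟨by linarith [hy.1, hu.1], h⟩ hu.1)
      · exact hmz.trans (m2' ⟨h, by linarith [hz.2]⟩ ⟨by linarith [hz.1], by linarith [hz.2]⟩ hu2)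
    have hI := hcl m hm0 c hcond
    have mpos : ∀ θ, 0 < max (V θ) m := fun θ => lt_max_of_lt_right hm0
    have Rc : Continuous fun θ => (max (V θ) m) ^ (-q) :=
      (Vc.max continuous_const).rpow_const fun θ => Or.inl (mpos θ).ne'
    have hfp : Function.Periodic (fun θ => (max (V θ) m) ^ (-q) * Real.sin (θ - c)) (2*π) :=
      fun x => by
        simp only; rw [hper, show x + 2*π - c = x - c + 2*π by ring,
          Real.sin_add_two_pi]
    rw [← int_shift hfp a (a+2*π) rfl] at hI
    have anti : ∀ x y, V x ≤ V y → (max (V y) m) ^ (-q) ≤ (max (V x) m) ^ (-q) := fun x y hxy =>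
      Real.rpow_le_rpow_of_nonpos (mpos x) (max_le_max_right _ hxy) (by linarith)
    have := cheb Rc hab hb2 hc (fun x hx y hy hxy => anti x y (m1' hx hy hxy))
      (fun x hx y hy hxy => anti y x (m2' hx hy hxy)) hI
    have e1 := (Real.rpow_left_inj (mpos a).le (mpos b).le (by linarith : -q ≠ 0)).1 this
    have hbm : m < V b := by linarith [hb' y]
    rw [max_eq_left hbm.le] at e1
    rcases max_choice (V a) m with h | h <;> rw [h] at e1 <;> linarith
  have hall : ∀ x, V x = V a := fun x => le_antisymm (hconst ▸ hb' x) (ha' x)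
  obtain ⟨x0, -, hx0⟩ := hZ 0 1 one_pos
  have hVa : 0 < V a := hall x0 ▸ hx0
  have hVe : V = fun _ => V a := funext hall
  have z1 : ∀ x, V1 x = 0 := fun x => by
    have h1 := (hd x (by rw [hall x]; exact hVa)).1
    rw [hVe] at h1
    exact h1.unique (hasDerivAt_const x _)
  have z2 : V a ^ (-q) - V a = 0 := by
    have h1 := (hd a hVa).2.1
    rw [show V1 = fun _ => 0 from funext z1] at h1
    exact h1.unique (hasDerivAt_const a _)
  have z3 : V a ^ (1 + q) = 1 := by
    rw [Real.rpow_add hVa, Real.rpow_one]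
    nth_rewrite 1 [← sub_eq_zero.1 z2]
    rw [← Real.rpow_add hVa]; simp
  intro x
  rw [hall x]
  have z4 := (Real.rpow_left_inj hVa.le one_pos.le (by linarith : 1 + q ≠ 0)).1
    (z3.trans (Real.one_rpow _).symm)
  exact z4
end PC
namespace PC
open scoped ContDiff Topology
lemma aa {v : ℕ → ℝ → ℝ} {C : ℝ} (hC : 0 < C) (h0 : ∀ n x, v n x ∈ Icc 0 C)
    (hL : ∀ n x y, |v n x - v n y| ≤ C * |x - y|)
    (hper : ∀ n x, v n (x + 2*π) = v n x) :
    ∃ W : ℝ → ℝ, ∀ ε > 0, ∀ N : ℕ, ∃ n ≥ N, ∀ x, |v n x - W x| ≤ ε := by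
  have hpi := Real.pi_pos
  have key : ∀ x, ∃ w ∈ Icc 0 C, Tendsto (fun n => v n x) (hyperfilter ℕ : Filter ℕ) (𝓝 w) := by
    intro x
    have hmem : ((hyperfilter ℕ).map (fun n => v n x) : Filter ℝ) ≤ 𝓟 (Icc 0 C) := by
      rw [le_principal_iff]
      exact Filter.mem_map.2 (Filter.univ_mem' (fun n => h0 n x))
    obtain ⟨w, hw, hl⟩ := isCompact_Icc.ultrafilter_le_nhds ((hyperfilter ℕ).map (fun n => v n x)) hmem
    exact ⟨w, hw, hl⟩
  choose W hW hlim using key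
  have WL : ∀ x y, |W x - W y| ≤ C * |x - y| := fun x y =>
    le_of_tendsto ((hlim x).sub (hlim y)).abs (Eventually.of_forall fun n => hL n x y)
  have Wp : ∀ x, W (x + 2*π) = W x := fun x =>
    tendsto_nhds_unique (hlim (x + 2*π)) (by simpa only [hper] using hlim x)
  refine ⟨W, fun ε hε N => ?_⟩
  obtain ⟨M, hM⟩ := exists_nat_gt (2*π*(3*C)/ε)
  have hM0 : (0:ℝ) < M := lt_of_le_of_lt (by positivity) hM
  set d := 2*π/M with hd
  have hd0 : 0 < d := by positivity
  have hdC : C * d ≤ ε/3 := by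
    rw [hd, div_lt_iff₀ hε] at *
    rw [← mul_div_assoc, div_le_iff₀ hM0]; linarith
  have hev : ∀ᶠ n in (hyperfilter ℕ : Filter ℕ), N ≤ n ∧ ∀ i ∈ Finset.range (M+1), |v n (i*d) - W (i*d)| < ε/3 := by
    refine ((eventually_ge_atTop N).filter_mono Nat.hyperfilter_le_atTop).and ?_
    rw [Filter.eventually_all_finset]
    intro i _
    have := Metric.tendsto_nhds.1 (hlim (i*d)) (ε/3) (by linarith)
    simpa only [Real.dist_eq] using this
  obtain ⟨n, hn, hi⟩ := hev.exists
  refine ⟨n, hn, fun x => ?_⟩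
  have hfp : Function.Periodic (fun x => v n x - W x) (2*π) := fun x => by
    simp only [hper, Wp]
  obtain ⟨y, hy, he⟩ := hfp.exists_mem_Ico₀ two_pi_pos' x
  have he' : v n x - W x = v n y - W y := he
  rw [he']
  set i := ⌊y/d⌋₊ with hidef
  have h1 : i*d ≤ y := by
    have := Nat.floor_le (div_nonneg hy.1 hd0.le)
    rwa [le_div_iff₀ hd0] at this
  have h2 : y < (i+1)*d := by
    have := Nat.lt_floor_add_one (y/d)
    rwa [div_lt_iff₀ hd0] at this
  have h3 : i ∈ Finset.range (M+1) := by
    rw [Finset.mem_range]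
    have : y/d ≤ M := by
      rw [div_le_iff₀ hd0, hd, mul_div_cancel₀ _ hM0.ne']; exact hy.2.le
    have := Nat.floor_le_of_le this
    omega
  have h4 := hi i h3
  have h5 : |y - i*d| ≤ d := by rw [abs_of_nonneg (by linarith)]; linarith
  have h6 := (hL n y (i*d)).trans (mul_le_mul_of_nonneg_left h5 hC.le)
  have h7 := (WL y (i*d)).trans (mul_le_mul_of_nonneg_left h5 hC.le)
  rw [abs_le] at h6 h7 ⊢
  rw [abs_lt] at h4
  constructor <;> linarith [h6.1, h6.2, h7.1, h7.2, h4.1, h4.2]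
structure Snap (p : ℕ) (C : ℝ) (κ v1 g : ℝ → ℝ) : Prop where
  kc : Continuous κ
  gc : Continuous g
  pos : ∀ x, 0 < κ x
  le : ∀ x, κ x ≤ C
  per : ∀ x, κ (x + 2*π) = κ x
  gper : ∀ x, g (x + 2*π) = g x
  h1 : ∀ x, HasDerivAt (fun x => κ x ^ p) (v1 x) x
  h2 : ∀ x, HasDerivAt v1 (g x + (κ x)⁻¹ - κ x ^ p) x
  hv1 : ∀ x, |v1 x| ≤ C
  hr : ∫ θ in (0:ℝ)..(2*π), (κ θ)⁻¹ ≤ C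
  cl : ∀ c, ∫ θ in (0:ℝ)..(2*π), Real.sin (θ - c) * (κ θ)⁻¹ = 0
lemma NF.snap {p : ℕ} {C τ1 : ℝ} {κ : ℝ → ℝ → ℝ} (h : NF p C τ1 κ) {t : ℝ} (ht : t ∈ Ioi τ1) :
    Snap p C (fun x => κ x t) (fun x => dx (V p κ) x t) (fun x => G p κ x t) where
  kc := h.fl.sm.cont ht
  gc := h.fl.smH.cont ht
  pos x := h.fl.pos x t ht
  le x := h.hκ t ht x
  per x := h.fl.per x t ht
  gper x := h.fl.perH x t ht
  h1 x := h.fl.smV.hdx ht x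
  h2 x := (h.fl.smV1.hdx ht x).congr_deriv (by unfold G V; ring)
  hv1 x := h.hv1 t ht x
  hr := h.hr t ht
  cl c := by
    have := closing_shift (h.fl.smInv.cont ht) (h.ccos t ht) (h.csin t ht) (c + π/2)
    rw [← this]; congr 1; funext θ
    rw [show θ - (c + π/2) = θ - c - π/2 by ring, Real.cos_sub_pi_div_two]
lemma Snap.gint {p : ℕ} {C : ℝ} {κ v1 g : ℝ → ℝ} (h : Snap p C κ v1 g) {a b : ℝ} (hab : a ≤ b)
    (hb : b ≤ a + 2*π) {η M D : ℝ} (hη : 0 < η) (hM : 0 < M)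
    (hD : ∫ θ in (0:ℝ)..(2*π), κ θ ^ (p+1) * g θ ^ 2 ≤ D)
    (hk : ∀ x ∈ Icc a b, M ≤ κ x ^ (p+1)) :
    |∫ θ in a..b, g θ| ≤ η * (b - a) + D/(η*M) := by
  have hc : Continuous fun θ => κ θ ^ (p+1) * g θ ^ 2 := (h.kc.pow _).mul (h.gc.pow 2)
  have e1 : |∫ θ in a..b, g θ| ≤ ∫ θ in a..b, (η + (κ θ ^ (p+1) * g θ ^ 2)/(η*M)) := by
    refine (intervalIntegral.abs_integral_le_integral_abs hab).trans ?_
    refine intervalIntegral.integral_mono_on hab (h.gc.abs.intervalIntegrable _ _)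
      ((continuous_const.add (hc.div_const _)).intervalIntegrable _ _) fun x hx => ?_
    have h1 := hk x hx
    have h2 : |g x| ≤ η + g x^2/η := by
      have : 0 ≤ (|g x| - η)^2 := sq_nonneg _
      rw [← sq_abs, ← sub_nonneg]
      have e : η + |g x|^2/η - |g x| = ((|g x| - η)^2 + η * |g x|)/η := by field_simp; ring
      rw [e]; positivity
    have h3 : g x^2/η ≤ (κ x ^ (p+1) * g x ^ 2)/(η*M) := by
      rw [div_le_div_iff₀ hη (by positivity)]
      nlinarith [mul_le_mul_of_nonneg_right h1 (by positivity : 0 ≤ g x^2*η)]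
    linarith
  have e2 : ∫ θ in a..b, (η + (κ θ ^ (p+1) * g θ ^ 2)/(η*M))
      = η*(b-a) + (∫ θ in a..b, κ θ ^ (p+1) * g θ ^ 2)/(η*M) := by
    rw [intervalIntegral.integral_add (continuous_const.intervalIntegrable _ _)
      ((hc.div_const _).intervalIntegrable _ _), intervalIntegral.integral_const,
      intervalIntegral.integral_div, smul_eq_mul, mul_comm]
  have e3 : ∫ θ in a..b, κ θ ^ (p+1) * g θ ^ 2 ≤ D := by
    refine le_trans ?_ hD
    rw [← int_shift (f := fun θ => κ θ ^ (p+1) * g θ ^ 2) (fun x => by simp only [h.per, h.gper]) a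
      (a + 2*π) rfl]
    refine intervalIntegral.integral_mono_interval le_rfl hab hb ?_ (hc.intervalIntegrable _ _)
    exact Eventually.of_forall fun x => mul_nonneg (pow_pos (h.pos x) _).le (sq_nonneg _)
  rw [e2] at e1
  have : (∫ θ in a..b, κ θ ^ (p+1) * g θ ^ 2)/(η*M) ≤ D/(η*M) := by gcongr
  linarith
end PC
namespace PC
open scoped ContDiff Topology
lemma lim_ode {p : ℕ} (hp : 1 ≤ p) {C q : ℝ} (hq : q = 1/(p:ℝ)) {κ v1 g : ℕ → ℝ → ℝ} {W : ℝ → ℝ}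
    (hs : ∀ n, Snap p C (κ n) (v1 n) (g n))
    (hD : Tendsto (fun n => ∫ θ in (0:ℝ)..(2*π), κ n θ ^ (p+1) * g n θ ^ 2) atTop (𝓝 0))
    (hl : ∀ x, Tendsto (fun n => κ n x ^ p) atTop (𝓝 (W x)))
    (Wc : Continuous W) {x0 δ m : ℝ} (hδ : 0 < δ) (hδp : δ ≤ π) (hm : 0 < m)
    (hN : ∀ᶠ n in atTop, ∀ x ∈ Icc (x0-δ) (x0+δ), m ≤ κ n x)
    (hC : ∀ n x, κ n x ^ p ≤ C) (W0 : ∀ x ∈ Icc (x0-δ) (x0+δ), 0 < W x) :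
    ∃ P : ℝ → ℝ, (∀ x ∈ Ioo (x0-δ) (x0+δ), HasDerivAt W (P x) x) ∧
      HasDerivAt P (W x0 ^ (-q) - W x0) x0 := by
  have hpi := Real.pi_pos
  have hp0 : (p:ℝ) ≠ 0 := by positivity
  obtain ⟨a, ha, φ, hφ, hlim⟩ := (isCompact_Icc (a := -C) (b := C)).tendsto_subseq
    (x := fun n => v1 n x0) (fun n => abs_le.1 ((hs n).hv1 x0))
  have hφt := hφ.tendsto_atTop
  set R : ℝ → ℝ := fun x => W x ^ (-q) - W x with hR
  have Rc : ContinuousOn R (Icc (x0-δ) (x0+δ)) := fun x hx =>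
    ((Real.continuousAt_rpow_const _ _ (Or.inl (W0 x hx).ne')).comp
      Wc.continuousAt |>.sub Wc.continuousAt).continuousWithinAt
  have hx0 : x0 ∈ Icc (x0-δ) (x0+δ) := ⟨by linarith, by linarith⟩
  have hsub : ∀ y ∈ Icc (x0-δ) (x0+δ), uIcc x0 y ⊆ Icc (x0-δ) (x0+δ) := fun y hy =>
    Set.uIcc_subset_Icc hx0 hy
  have hrl : ∀ x ∈ Icc (x0-δ) (x0+δ), Tendsto (fun n => (κ n x)⁻¹) atTop (𝓝 (W x ^ (-q))) := by
    intro x hx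
    have := (Real.continuousAt_rpow_const (W x) (-q) (Or.inl (W0 x hx).ne')).tendsto.comp (hl x)
    refine this.congr fun n => ?_
    simp only [Function.comp]
    rw [← Real.rpow_natCast, ← Real.rpow_mul ((hs n).pos x).le, hq]
    rw [show (p:ℝ) * -(1/(p:ℝ)) = -1 by field_simp, Real.rpow_neg_one]
  have hg0 : ∀ y ∈ Icc (x0-δ) (x0+δ), Tendsto (fun n => ∫ θ in x0..y, g n θ) atTop (𝓝 0) := by
    intro y hy
    have key : ∀ c d, c ≤ d → Icc c d ⊆ Icc (x0-δ) (x0+δ) → d ≤ c + 2*π →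
        Tendsto (fun n => ∫ θ in c..d, g n θ) atTop (𝓝 0) := by
      intro c d hcd hsb hd
      rw [Metric.tendsto_atTop']
      intro ε hε
      set η := ε/(2*(d-c+1)) with hη
      have hη0 : 0 < η := by have : 0 < d - c + 1 := by linarith
                             positivity
      have hM : 0 < m^(p+1) := by positivity
      have hev : ∀ᶠ n in atTop, |∫ θ in c..d, g n θ| < ε := by
        have hsm : ∀ᶠ n in atTop, ∫ θ in (0:ℝ)..(2*π), κ n θ ^ (p+1) * g n θ ^ 2
            < ε/2 * (η * m^(p+1)) := hD.eventually (gt_mem_nhds (by positivity))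
        filter_upwards [hsm, hN] with n h1 h2
        have := (hs n).gint hcd hd hη0 hM h1.le
          (fun x hx => pow_le_pow_left₀ hm.le (h2 x (hsb hx)) _)
        rw [mul_div_assoc, div_self (by positivity)] at this
        have e : η * (d - c) < ε/2 := by
          rw [hη, div_mul_eq_mul_div, div_lt_iff₀ (by linarith)]; nlinarith
        linarith
      obtain ⟨N, hN⟩ := eventually_atTop.1 hev
      refine ⟨N, fun n hn => ?_⟩
      rw [Real.dist_eq, sub_zero]; exact hN n hn.le
    rcases le_total x0 y with h | h
    · exact key x0 y h (by rw [← uIcc_of_le h]; exact hsub y hy) (by linarith [hy.2])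
    · have := (key y x0 h (by rw [← uIcc_of_ge h]; exact hsub y hy) (by linarith [hy.1])).neg
      rw [neg_zero] at this
      refine this.congr fun n => ?_
      rw [intervalIntegral.integral_symm, neg_neg]
  have hrc : ∀ n, Continuous fun x => (κ n x)⁻¹ - κ n x ^ p := fun n =>
    ((hs n).kc.inv₀ fun x => ((hs n).pos x).ne').sub ((hs n).kc.pow p)
  have hrv : ∀ y ∈ Icc (x0-δ) (x0+δ), Tendsto (fun n => ∫ θ in x0..y, ((κ n θ)⁻¹ - κ n θ ^ p)) atTop
      (𝓝 (∫ θ in x0..y, R θ)) := by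
    intro y hy
    refine intervalIntegral.tendsto_integral_filter_of_dominated_convergence (fun _ => m⁻¹ + C)
      (Eventually.of_forall fun n => (hrc n).aestronglyMeasurable) ?_
      intervalIntegrable_const ?_
    · filter_upwards [hN] with n hn
      refine Eventually.of_forall fun x hx => ?_
      have hx' := hsub y hy (uIoc_subset_uIcc hx)
      have h1 := inv_anti₀ hm (hn x hx')
      have h2 := inv_pos.2 ((hs n).pos x)
      have h3 := pow_pos ((hs n).pos x) p
      have h4 := hC n x
      rw [Real.norm_eq_abs, abs_le]; constructor <;> linarith
    · refine Eventually.of_forall fun x hx => ?_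
      have hx' := hsub y hy (uIoc_subset_uIcc hx)
      exact (hrl x hx').sub (hl x)
  set P : ℝ → ℝ := fun y => a + ∫ θ in x0..y, R θ with hP
  have v1c : ∀ n, Continuous (v1 n) := fun n =>
    continuous_iff_continuousAt.2 fun x => ((hs n).h2 x).continuousAt
  have hv1 : ∀ y ∈ Icc (x0-δ) (x0+δ), Tendsto (fun n => v1 (φ n) y) atTop (𝓝 (P y)) := by
    intro y hy
    have := (hlim.add ((hrv y hy).comp hφt)).add ((hg0 y hy).comp hφt)
    rw [add_zero] at this
    refine this.congr fun n => ?_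
    simp only [Function.comp]
    have e := intervalIntegral.integral_eq_sub_of_hasDerivAt (a := x0) (b := y) (fun x _ => (hs (φ n)).h2 x)
      ((((hs (φ n)).gc.add (hrc (φ n))).congr fun x => by simp only [Pi.add_apply]; ring).intervalIntegrable _ _)
    have e2 : ∫ x in x0..y, (g (φ n) x + (κ (φ n) x)⁻¹ - κ (φ n) x ^ p)
      = (∫ x in x0..y, ((κ (φ n) x)⁻¹ - κ (φ n) x ^ p)) + ∫ x in x0..y, g (φ n) x := by
      rw [← intervalIntegral.integral_add ((hrc _).intervalIntegrable _ _)
        ((hs _).gc.intervalIntegrable _ _)]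
      congr 1; funext x; ring
    linarith
  have hI : ∀ y ∈ Icc (x0-δ) (x0+δ), W y = W x0 + ∫ θ in x0..y, P θ := by
    intro y hy
    have h1 : Tendsto (fun n => ∫ θ in x0..y, v1 (φ n) θ) atTop (𝓝 (∫ θ in x0..y, P θ)) := by
      refine intervalIntegral.tendsto_integral_filter_of_dominated_convergence (fun _ => C)
        (Eventually.of_forall fun n => (v1c _).aestronglyMeasurable) ?_
        intervalIntegrable_const ?_
      · exact Eventually.of_forall fun n => Eventually.of_forall fun x _ => (hs _).hv1 x
      · exact Eventually.of_forall fun x hx => hv1 x (hsub y hy (uIoc_subset_uIcc hx))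
    have h2 : Tendsto (fun n => ∫ θ in x0..y, v1 (φ n) θ) atTop (𝓝 (W y - W x0)) := by
      refine (((hl y).sub (hl x0)).comp hφt).congr fun n => ?_
      exact (intervalIntegral.integral_eq_sub_of_hasDerivAt (fun x _ => (hs (φ n)).h1 x)
        ((v1c _).intervalIntegrable _ _)).symm
    linarith [tendsto_nhds_unique h1 h2]
  have hop : Ioo (x0-δ) (x0+δ) ⊆ Icc (x0-δ) (x0+δ) := Ioo_subset_Icc_self
  have hx0' : x0 ∈ Ioo (x0-δ) (x0+δ) := ⟨by linarith, by linarith⟩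
  have Pd : ∀ x ∈ Ioo (x0-δ) (x0+δ), HasDerivAt P (R x) x := by
    intro x hx
    refine (intervalIntegral.integral_hasDerivAt_right
      ((Rc.mono (hsub x (hop hx))).intervalIntegrable) ?_ ?_).const_add a
    · exact (Rc.mono hop).stronglyMeasurableAtFilter isOpen_Ioo x hx
    · exact Rc.continuousAt (Icc_mem_nhds hx.1 hx.2)
  have Pc : ContinuousOn P (Ioo (x0-δ) (x0+δ)) := fun x hx => (Pd x hx).continuousAt.continuousWithinAt
  refine ⟨P, fun x hx => ?_, Pd x0 hx0'⟩
  have hsx : uIcc x0 x ⊆ Ioo (x0-δ) (x0+δ) := fun z hz => by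
    have h1 := hz.1
    have h2 := hz.2
    exact ⟨lt_of_lt_of_le (lt_min hx0'.1 hx.1) h1, lt_of_le_of_lt h2 (max_lt hx0'.2 hx.2)⟩
  have h1 : HasDerivAt (fun y => W x0 + ∫ θ in x0..y, P θ) (P x) x := by
    refine (intervalIntegral.integral_hasDerivAt_right
      ((Pc.mono hsx).intervalIntegrable) ?_ ?_).const_add _
    · exact Pc.stronglyMeasurableAtFilter isOpen_Ioo x hx
    · exact (Pd x hx).continuousAt
  refine h1.congr_of_eventuallyEq ?_
  filter_upwards [Ioo_mem_nhds hx.1 hx.2] with y hy using hI y (hop hy)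
lemma limit_one {p : ℕ} (hp : 1 ≤ p) {C : ℝ} (hC : 1 ≤ C) {κ v1 g : ℕ → ℝ → ℝ} {W : ℝ → ℝ}
    (hs : ∀ n, Snap p C (κ n) (v1 n) (g n))
    (hD : Tendsto (fun n => ∫ θ in (0:ℝ)..(2*π), κ n θ ^ (p+1) * g n θ ^ 2) atTop (𝓝 0))
    (hu : ∀ ε > 0, ∀ᶠ n in atTop, ∀ x, |κ n x ^ p - W x| ≤ ε) : ∀ x, W x = 1 := by
  have hpi := Real.pi_pos
  have hp0 : (p:ℝ) ≠ 0 := by positivity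
  have hl : ∀ x, Tendsto (fun n => κ n x ^ p) atTop (𝓝 (W x)) := by
    intro x
    rw [Metric.tendsto_nhds]
    intro ε hε
    filter_upwards [hu (ε/2) (by linarith)] with n hn
    rw [Real.dist_eq]; linarith [hn x]
  have hCp : C ≤ C^p := by
    calc C = C^1 := (pow_one C).symm
      _ ≤ C^p := pow_le_pow_right₀ hC hp
  have hkC : ∀ n x, κ n x ^ p ≤ C^p := fun n x => pow_le_pow_left₀ ((hs n).pos x).le ((hs n).le x) p
  have hL : ∀ x y, |W x - W y| ≤ C^p * |x - y| := by
    intro x y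
    refine le_of_tendsto ((hl x).sub (hl y)).abs (Eventually.of_forall fun n => ?_)
    have := Convex.norm_image_sub_le_of_norm_hasDerivWithin_le (s := univ) (f := fun x => κ n x ^ p)
      (f' := v1 n) (C := C) (fun x _ => ((hs n).h1 x).hasDerivWithinAt) (fun x _ => (hs n).hv1 x)
      convex_univ (mem_univ y) (mem_univ x)
    simp only [Real.norm_eq_abs] at this
    exact this.trans (mul_le_mul_of_nonneg_right hCp (abs_nonneg _))
  have hC0 : 0 < C^p := by positivity
  have Wc : Continuous W := by
    refine (LipschitzWith.of_dist_le_mul (K := ⟨C^p, hC0.le⟩) fun x y => ?_).continuous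
    rw [Real.dist_eq, Real.dist_eq]; exact hL x y
  set q : ℝ := 1/(p:ℝ) with hq
  have hloc : ∀ x0, 0 < W x0 → ∃ δ > 0, ∃ P : ℝ → ℝ, (∀ x ∈ Ioo (x0-δ) (x0+δ), HasDerivAt W (P x) x) ∧
      HasDerivAt P (W x0 ^ (-q) - W x0) x0 := by
    intro x0 hx0
    set δ := min π (W x0 / (2 * C^p)) with hδ
    have hδ0 : 0 < δ := lt_min hpi (by positivity)
    have hW2 : ∀ x ∈ Icc (x0-δ) (x0+δ), W x0/2 ≤ W x := by
      intro x hx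
      have h1 : |x0 - x| ≤ δ := by rw [abs_le]; constructor <;> linarith [hx.1, hx.2]
      have h2 := (hL x0 x).trans (mul_le_mul_of_nonneg_left (h1.trans (min_le_right _ _)) hC0.le)
      have h3 : C^p * (W x0 / (2 * C^p)) = W x0/2 := by field_simp
      rw [h3] at h2
      linarith [(abs_le.1 h2).2]
    have hm : 0 < min 1 (W x0/4) := lt_min one_pos (by linarith)
    refine ⟨δ, hδ0, lim_ode (v1 := v1) (m := min 1 (W x0/4)) hp hq (fun n => ?_) hD hl Wc hδ0 (min_le_left _ _) hm ?_ hkC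
      (fun x hx => by linarith [hW2 x hx])⟩
    · exact { hs n with le := fun x => ((hs n).le x).trans hCp, hv1 := fun x => ((hs n).hv1 x).trans hCp, hr := ((hs n).hr).trans hCp }
    · filter_upwards [hu (W x0/4) (by linarith)] with n hn x hx
      by_contra hlt
      push Not at hlt
      have h1 := (abs_le.1 (hn x)).1
      have h2 := hW2 x hx
      have h3 : κ n x ≤ 1 := (hlt.trans_le (min_le_left _ _)).le
      have h4 : κ n x ^ p ≤ κ n x := pow_le_of_le_one ((hs n).pos x).le h3 (by omega)
      linarith [min_le_right 1 (W x0/4)]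
  have hrpow : ∀ n x, (κ n x ^ p) ^ (-q) = (κ n x)⁻¹ := by
    intro n x
    rw [← Real.rpow_natCast, ← Real.rpow_mul ((hs n).pos x).le, hq]
    rw [show (p:ℝ) * -(1/(p:ℝ)) = -1 by field_simp, Real.rpow_neg_one]
  have hq0 : 0 < q := by rw [hq]; positivity
  refine classify (V := W) (V1 := deriv W) (C := C^p) hp (one_le_pow₀ hC) hq ?_ ?_ ?_ hL ?_ ?_ ?_
  · exact fun x => tendsto_nhds_unique (hl _) (by simpa only [(hs _).per] using hl x)
  · exact fun x => ge_of_tendsto (hl x) (Eventually.of_forall fun n => (pow_pos ((hs n).pos x) p).le)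
  · exact fun x => le_of_tendsto (hl x) (Eventually.of_forall fun n => hkC n x)
  · intro x hx
    obtain ⟨δ, hδ, P, h1, h2⟩ := hloc x hx
    have hx' : x ∈ Ioo (x-δ) (x+δ) := ⟨by linarith, by linarith⟩
    have h3 := h1 x hx'
    refine ⟨h3.differentiableAt.hasDerivAt, h2.congr_of_eventuallyEq ?_, ?_⟩
    · filter_upwards [Ioo_mem_nhds hx'.1 hx'.2] with y hy using (h1 y hy).deriv
    · have := norm_deriv_le_of_lipschitz (𝕜 := ℝ) (f := W) (x₀ := x) (C := ⟨C^p, hC0.le⟩)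
        (LipschitzWith.of_dist_le_mul fun x y => by rw [Real.dist_eq, Real.dist_eq]; exact hL x y)
      exact this
  · intro a b hab
    by_contra hne
    push Not at hne
    set b' := min b (a + 2*π) with hb'
    have hab' : a < b' := lt_min hab (by linarith)
    set ε := (b'-a)/(C+1) with hε
    have hε0 : 0 < ε := div_pos (by linarith) (by linarith)
    obtain ⟨n, hn⟩ := (hu (ε^p) (by positivity)).exists
    have rc : Continuous fun x => (κ n x)⁻¹ := (hs n).kc.inv₀ fun x => ((hs n).pos x).ne'
    have h1 : ∫ x in a..b', ε⁻¹ ≤ ∫ x in a..b', (κ n x)⁻¹ := by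
      refine intervalIntegral.integral_mono_on_of_le_Ioo hab'.le intervalIntegrable_const
        (rc.intervalIntegrable _ _) fun x hx => ?_
      have h2 := hne x ⟨hx.1, hx.2.trans_le (min_le_left _ _)⟩
      have h3 := (abs_le.1 (hn x)).2
      have h4 : κ n x ^ p ≤ ε^p := by linarith
      exact inv_anti₀ ((hs n).pos x) (le_of_pow_le_pow_left₀ (by omega) hε0.le h4)
    have h2 : ∫ x in a..b', (κ n x)⁻¹ ≤ C := by
      refine le_trans ?_ (hs n).hr
      rw [← int_shift (f := fun θ => (κ n θ)⁻¹) (fun x => by simp only [(hs n).per]) a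
        (a + 2*π) rfl]
      refine intervalIntegral.integral_mono_interval le_rfl hab'.le (min_le_right _ _) ?_
        (rc.intervalIntegrable _ _)
      exact Eventually.of_forall fun x => (inv_pos.2 ((hs n).pos x)).le
    rw [intervalIntegral.integral_const, smul_eq_mul, hε, inv_div, mul_div_cancel₀ _ (by linarith)] at h1
    linarith
  · intro m hm c hV
    have hlim : Tendsto (fun n => ∫ θ in (0:ℝ)..(2*π), (max (κ n θ ^ p) m) ^ (-q) * Real.sin (θ - c))
        atTop (𝓝 (∫ θ in (0:ℝ)..(2*π), (max (W θ) m) ^ (-q) * Real.sin (θ - c))) := by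
      refine intervalIntegral.tendsto_integral_filter_of_dominated_convergence (fun _ => m^(-q))
        (Eventually.of_forall fun n => Continuous.aestronglyMeasurable ?_) ?_
        intervalIntegrable_const ?_
      · refine Continuous.mul (Continuous.rpow_const (((hs n).kc.pow p).max continuous_const) fun x => ?_)
          (by fun_prop)
        exact Or.inl (lt_of_lt_of_le hm (le_max_right _ _)).ne'
      · refine Eventually.of_forall fun n => Eventually.of_forall fun x _ => ?_
        have h0 : 0 < max (κ n x ^ p) m := lt_of_lt_of_le hm (le_max_right _ _)
        rw [Real.norm_eq_abs, abs_mul, abs_of_pos (Real.rpow_pos_of_pos h0 _)]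
        have h1 : (max (κ n x ^ p) m)^(-q) ≤ m^(-q) :=
          Real.rpow_le_rpow_of_nonpos hm (le_max_right _ _) (by linarith)
        have h2 := Real.abs_sin_le_one (x - c)
        have h3 := (Real.rpow_pos_of_pos h0 (-q)).le
        calc _ ≤ (max (κ n x ^ p) m)^(-q) * 1 := mul_le_mul_of_nonneg_left h2 h3
          _ ≤ _ := by rw [mul_one]; exact h1
      · refine Eventually.of_forall fun x _ => ?_
        have h0 : 0 < max (W x) m := lt_of_lt_of_le hm (le_max_right _ _)
        exact ((Real.continuousAt_rpow_const _ (-q) (Or.inl h0.ne')).tendsto.comp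
          ((hl x).max tendsto_const_nhds)).mul_const _
    refine ge_of_tendsto hlim ?_
    filter_upwards [hu m hm] with n hn
    refine le_of_eq_of_le ((hs n).cl c).symm ?_
    have rc : Continuous fun x => (κ n x)⁻¹ := (hs n).kc.inv₀ fun x => ((hs n).pos x).ne'
    refine intervalIntegral.integral_mono_on two_pi_pos'.le
      ((Continuous.mul (Real.continuous_sin.comp (continuous_sub_right c)) rc).intervalIntegrable _ _) (Continuous.intervalIntegrable ?_ _ _) fun x _ => ?_
    · refine Continuous.mul (Continuous.rpow_const (((hs n).kc.pow p).max continuous_const) fun x => ?_)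
          (by fun_prop)
      exact Or.inl (lt_of_lt_of_le hm (le_max_right _ _)).ne'
    · rw [← hrpow, mul_comm]
      rcases le_total 0 (Real.sin (x-c)) with h | h
      · have h1 := hV x h
        have h2 := (abs_le.1 (hn x)).1
        rw [max_eq_left (by linarith)]
      · refine mul_le_mul_of_nonpos_right ?_ h
        exact Real.rpow_le_rpow_of_nonpos (pow_pos ((hs n).pos x) p) (le_max_left _ _) (by linarith)
end PC
namespace PC
open scoped ContDiff Topology
namespace NF
variable {p : ℕ} {C τ1 : ℝ} {κ : ℝ → ℝ → ℝ} (h : NF p C τ1 κ)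
include h
lemma lipV {t : ℝ} (ht : t ∈ Ioi τ1) (x y : ℝ) : |V p κ x t - V p κ y t| ≤ C * |x - y| := by
  have := Convex.norm_image_sub_le_of_norm_hasDerivWithin_le (s := univ) (f := fun x => V p κ x t)
      (f' := fun x => dx (V p κ) x t) (C := C) (fun x _ => (h.fl.smV.hdx ht x).hasDerivWithinAt)
      (fun x _ => h.hv1 t ht x) convex_univ (mem_univ y) (mem_univ x)
  simpa only [Real.norm_eq_abs] using this
lemma VC {t : ℝ} (ht : t ∈ Ioi τ1) (x : ℝ) : V p κ x t ≤ C^p :=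
  pow_le_pow_left₀ (h.fl.pos x t ht).le (h.hκ t ht x) p
lemma leCp : C ≤ C^p := by
  calc C = C^1 := (pow_one C).symm
    _ ≤ C^p := pow_le_pow_right₀ h.C1 h.fl.hp
lemma stat {ε : ℝ} (hε : 0 < ε) :
    ∃ δ > 0, ∀ t ∈ Ioi τ1, Ds p κ t ≤ δ → ∀ θ, |V p κ θ t - 1| ≤ ε := by
  by_contra hcon
  push Not at hcon
  have hC0 : 0 < C^p := lt_of_lt_of_le (by linarith [h.C1]) h.leCp
  choose t ht hD θ hθ using fun n : ℕ => hcon (1/((n:ℝ)+1)) (by positivity)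
  obtain ⟨W, hW⟩ := aa (v := fun n x => V p κ x (t n)) hC0
    (fun n x => ⟨(pow_pos (h.fl.pos x _ (ht n)) p).le, h.VC (ht n) x⟩)
    (fun n x y => (h.lipV (ht n) x y).trans (mul_le_mul_of_nonneg_right h.leCp (abs_nonneg _)))
    (fun n x => h.fl.perV x _ (ht n))
  choose j hj hjW using fun n : ℕ => hW (1/((n:ℝ)+1)) (by positivity) n
  have lim0 : Tendsto (fun n : ℕ => 1/((n:ℝ)+1)) atTop (𝓝 0) := tendsto_one_div_add_atTop_nhds_zero_nat
  have hu : ∀ ε > 0, ∀ᶠ n in atTop, ∀ x, |κ x (t (j n)) ^ p - W x| ≤ ε := by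
    intro ε hε
    filter_upwards [lim0.eventually (gt_mem_nhds hε)] with n hn x
    exact (hjW n x).trans hn.le
  have h1 := limit_one (W := W) (κ := fun n x => κ x (t (j n))) h.fl.hp h.C1 (fun n => h.snap (ht (j n))) ?_ hu
  · obtain ⟨n, hn⟩ := (hu ε hε).exists
    have h2 := hn (θ (j n))
    rw [h1] at h2
    exact absurd h2 (not_le.2 (hθ (j n)))
  · refine squeeze_zero (fun n => h.Ds_nonneg (ht (j n))) (fun n => ?_) lim0
    refine (hD (j n)).trans ?_
    have : (n:ℝ) ≤ j n := by exact_mod_cast hj n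
    exact one_div_le_one_div_of_le (by positivity) (by linarith)
lemma hintV {t : ℝ} (ht : t ∈ Ioi τ1) (a b : ℝ) :
    HasDerivAt (fun s => ∫ θ in a..b, V p κ θ s)
      (∫ θ in a..b, p * (κ θ t ^ (p+1) * G p κ θ t)) t := by
  have := h.fl.smV.hasDerivAt_integral h.fl.io ht a b
  refine this.congr_deriv ?_
  congr 1; funext θ; exact h.fl.dtV ht θ
lemma avg {a b : ℝ} (hab : a ≤ b) (hb : b ≤ a + 2*π) {η : ℝ} (hη : 0 < η) {s t : ℝ}
    (ht : t ∈ Ioi τ1) (hts : t ≤ s) (hs : s ≤ t + 1) :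
    |(∫ θ in a..b, V p κ θ s) - ∫ θ in a..b, V p κ θ t|
      ≤ p * (C^(p+1) * (2*π) * η) + (J p κ s - J p κ t)/η := by
  have hp := h.fl.hp
  have hpi := Real.pi_pos
  have hC0 : 0 < C := by linarith [h.C1]
  set K : ℝ := p * (C^(p+1) * (2*π) * η) with hK
  have hd : ∀ x ∈ Ioi τ1, |∫ θ in a..b, p * (κ θ x ^ (p+1) * G p κ θ x)| ≤ K + p * Ds p κ x/η := by
    intro x hx
    rw [intervalIntegral.integral_const_mul, abs_mul, Nat.abs_cast]
    have hc : Continuous fun θ => κ θ x ^ (p+1) := (h.fl.sm.pow (p+1)).cont hx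
    have gc : Continuous fun θ => G p κ θ x := h.fl.smH.cont hx
    have hcg : Continuous fun θ => κ θ x ^ (p+1) * G p κ θ x ^ 2 := hc.mul (gc.pow 2)
    have e1 : |∫ θ in a..b, κ θ x ^ (p+1) * G p κ θ x|
        ≤ ∫ θ in a..b, (C^(p+1) * η + (κ θ x ^ (p+1) * G p κ θ x ^ 2)/η) := by
      refine (intervalIntegral.abs_integral_le_integral_abs hab).trans ?_
      refine intervalIntegral.integral_mono_on hab ((hc.mul gc).abs.intervalIntegrable _ _)
        ((continuous_const.add ((hc.mul (gc.pow 2)).div_const _)).intervalIntegrable _ _) fun z _ => ?_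
      have k0 := h.fl.pos z x hx
      have hk : κ z x ^ (p+1) ≤ C^(p+1) := pow_le_pow_left₀ k0.le (h.hκ x hx z) _
      have h0 : 0 < κ z x ^ (p+1) := pow_pos k0 _
      have h2 : |G p κ z x| ≤ η + G p κ z x^2/η := by
        have : 0 ≤ (|G p κ z x| - η)^2 := sq_nonneg _
        rw [← sq_abs, ← sub_nonneg]
        have e : η + |G p κ z x|^2/η - |G p κ z x| = ((|G p κ z x| - η)^2 + η * |G p κ z x|)/η := by
          field_simp; ring
        rw [e]; positivity
      rw [abs_mul, abs_of_pos h0]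
      calc _ ≤ κ z x ^ (p+1) * (η + G p κ z x^2/η) := mul_le_mul_of_nonneg_left h2 h0.le
        _ = κ z x ^ (p+1) * η + (κ z x ^ (p+1) * G p κ z x ^ 2)/η := by ring
        _ ≤ _ := by gcongr
    rw [intervalIntegral.integral_add (continuous_const.intervalIntegrable _ _)
      ((hcg.div_const _).intervalIntegrable _ _), intervalIntegral.integral_const,
      intervalIntegral.integral_div, smul_eq_mul] at e1
    have e3 : ∫ θ in a..b, κ θ x ^ (p+1) * G p κ θ x ^ 2 ≤ Ds p κ x := by
      unfold Ds
      rw [← int_shift (f := fun θ => κ θ x ^ (p+1) * G p κ θ x ^ 2)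
        (fun z => by simp only [h.fl.per z x hx, h.fl.perH z x hx]) a (a + 2*π) rfl]
      refine intervalIntegral.integral_mono_interval le_rfl hab hb ?_ ((hc.mul (gc.pow 2)).intervalIntegrable _ _)
      exact Eventually.of_forall fun z => mul_nonneg (pow_pos (h.fl.pos z x hx) _).le (sq_nonneg _)
    have e4 : (b - a) * (C^(p+1)*η) ≤ (2*π) * (C^(p+1)*η) :=
      mul_le_mul_of_nonneg_right (by linarith) (by positivity)
    have e5 : (∫ θ in a..b, κ θ x ^ (p+1) * G p κ θ x ^ 2)/η ≤ Ds p κ x/η := by gcongr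
    have e6 : |∫ θ in a..b, κ θ x ^ (p+1) * G p κ θ x| ≤ C^(p+1) * (2*π) * η + Ds p κ x/η := by
      linarith
    have := mul_le_mul_of_nonneg_left e6 (Nat.cast_nonneg (α := ℝ) p)
    rw [hK, mul_div_assoc]; linarith
  have hmem : ∀ x ∈ Icc t s, x ∈ Ioi τ1 := fun x hx => lt_of_lt_of_le ht hx.1
  have mono : ∀ σ : ℝ, |σ| = 1 →
      σ * ((∫ θ in a..b, V p κ θ s) - ∫ θ in a..b, V p κ θ t) ≤ K + (J p κ s - J p κ t)/η := by
    intro σ hσ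
    have hder : ∀ x ∈ Icc t s, HasDerivAt (fun x => K * x + J p κ x/η - σ * ∫ θ in a..b, V p κ θ x)
        (K * 1 + p * Ds p κ x/η - σ * ∫ θ in a..b, p * (κ θ x ^ (p+1) * G p κ θ x)) x := fun x hx =>
      (((hasDerivAt_id x).const_mul K).add ((h.hJ (hmem x hx)).div_const η)).sub
        ((h.hintV (hmem x hx) a b).const_mul σ)
    have hm := monotoneOn_of_deriv_nonneg (convex_Icc t s)
      (fun x hx => (hder x hx).continuousAt.continuousWithinAt)
      (fun x hx => (hder x (interior_subset hx)).differentiableAt.differentiableWithinAt)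
      (fun x hx => by
        rw [(hder x (interior_subset hx)).deriv]
        have h1 := hd x (hmem x (interior_subset hx))
        have h2 := le_abs_self (σ * ∫ θ in a..b, p * (κ θ x ^ (p+1) * G p κ θ x))
        rw [abs_mul, hσ, one_mul] at h2
        linarith)
    have h3 := hm (left_mem_Icc.2 hts) (right_mem_Icc.2 hts) hts
    simp only at h3
    have hK0 : 0 ≤ K := by positivity
    have h4 : K * s - K * t ≤ K := by nlinarith
    rw [sub_div, mul_sub]; linarith
  rw [abs_le]
  have h1 := mono 1 (by simp)
  have h2 := mono (-1) (by simp)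
  constructor <;> linarith
lemma dyn {ε : ℝ} (hε : 0 < ε) : ∃ τ2 > τ1, ∀ t ≥ τ2, ∃ s ∈ Ioo t (t+1),
    Ds p κ s ≤ ε ∧ ∀ θ, |V p κ θ s - V p κ θ t| ≤ ε := by
  have hp : (1:ℝ) ≤ p := by exact_mod_cast h.fl.hp
  have hpi := Real.pi_pos
  have hC0 : 0 < C := by linarith [h.C1]
  set d := min (ε/(4*C)) (2*π) with hd
  have hd0 : 0 < d := lt_min (by positivity) (by positivity)
  set η := ε*d/(4*(p*(C^(p+1) * (2*π)))) with hη
  have hη0 : 0 < η := by positivity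
  set e := min ε (ε*d*η/4) with he
  have he0 : 0 < e := lt_min hε (by positivity)
  obtain ⟨τ2, hτ2, hJs⟩ := h.Jsmall he0
  refine ⟨τ2, hτ2, fun t ht => ?_⟩
  have htm : t ∈ Ioi τ1 := lt_of_lt_of_le hτ2 ht
  have hmem : ∀ x ≥ t, x ∈ Ioi τ1 := fun x hx => lt_of_lt_of_le htm hx
  obtain ⟨s, hs, hsl⟩ := exists_hasDerivAt_eq_slope (J p κ) (fun x => p * Ds p κ x) (lt_add_one t)
    (fun x hx => (h.hJ (hmem x hx.1)).continuousAt.continuousWithinAt)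
    (fun x hx => h.hJ (hmem x hx.1.le))
  refine ⟨s, hs, ?_, fun θ => ?_⟩
  · have h1 := hJs t ht (t+1) (by linarith)
    have h2 := h.Ds_nonneg (hmem s hs.1.le)
    simp only [add_sub_cancel_left, div_one] at hsl
    have : Ds p κ s ≤ p * Ds p κ s := le_mul_of_one_le_left h2 hp
    linarith [min_le_left ε (ε*d*η/4)]
  · have hsm := hmem s hs.1.le
    have h1 := h.avg (a := θ) (b := θ + d) (by linarith) (by linarith [min_le_right (ε/(4*C)) (2*π)]) hη0
      htm hs.1.le hs.2.le
    have h2 : p * (C^(p+1) * (2*π) * η) = ε*d/4 := by rw [hη]; field_simp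
    have h3 : (J p κ s - J p κ t)/η ≤ ε*d/4 := by
      rw [div_le_iff₀ hη0]
      have := hJs t ht s hs.1.le
      linarith [min_le_right ε (ε*d*η/4)]
    have h4 : ∀ x ∈ Ioi τ1, |(∫ z in θ..(θ+d), V p κ z x) - d * V p κ θ x| ≤ C * d * d := by
      intro x hx
      have e1 : (∫ z in θ..(θ+d), V p κ z x) - d * V p κ θ x = ∫ z in θ..(θ+d), (V p κ z x - V p κ θ x) := by
        rw [intervalIntegral.integral_sub ((h.fl.smV.cont hx).intervalIntegrable _ _)
          (continuous_const.intervalIntegrable _ _), intervalIntegral.integral_const, smul_eq_mul,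
          add_sub_cancel_left]
      rw [e1]
      have := intervalIntegral.norm_integral_le_of_norm_le_const (a := θ) (b := θ+d) (C := C*d)
        (f := fun z => V p κ z x - V p κ θ x) (fun z hz => by
          rw [uIoc_of_le (by linarith)] at hz
          refine (h.lipV hx z θ).trans (mul_le_mul_of_nonneg_left ?_ hC0.le)
          rw [abs_of_nonneg (by linarith [hz.1])]; linarith [hz.2])
      rwa [add_sub_cancel_left, abs_of_pos hd0, Real.norm_eq_abs] at this
    have h5 := h4 s hsm
    have h6 := h4 t htm
    have h7 : C * d ≤ ε/4 := by
      have := mul_le_mul_of_nonneg_left (min_le_left (ε/(4*C)) (2*π)) hC0.le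
      calc C*d ≤ C*(ε/(4*C)) := this
        _ = ε/4 := by field_simp
    have h8 : C*d*d ≤ ε/4*d := mul_le_mul_of_nonneg_right h7 hd0.le
    rw [abs_le] at h1 h5 h6
    have h9 : |d * (V p κ θ s - V p κ θ t)| ≤ d * ε := by
      rw [abs_le]; constructor <;> linarith [h1.1, h1.2, h5.1, h5.2, h6.1, h6.2]
    rw [abs_mul, abs_of_pos hd0] at h9
    exact le_of_mul_le_mul_left h9 hd0
lemma conv {ε : ℝ} (hε : 0 < ε) : ∃ τ2 > τ1, ∀ t ≥ τ2, ∀ θ, |V p κ θ t - 1| ≤ ε := by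
  obtain ⟨δ, hδ, hst⟩ := h.stat (half_pos hε)
  obtain ⟨τ2, h2, hd⟩ := h.dyn (lt_min hδ (half_pos hε))
  refine ⟨τ2, h2, fun t ht θ => ?_⟩
  obtain ⟨s, hs, hD, hv⟩ := hd t ht
  have h1 := hst s (lt_trans (lt_of_lt_of_le h2 ht) hs.1) (hD.trans (min_le_left _ _)) θ
  have h3 := (hv θ).trans (min_le_right _ _)
  rw [abs_le] at h1 h3 ⊢
  constructor <;> linarith [h1.1, h1.2, h3.1, h3.2]
end NF
end PC
namespace PC
open scoped ContDiff Topology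
def SP (f : ℝ → ℝ) : Prop := ContDiff ℝ (⊤ : ℕ∞) f ∧ ∀ θ, f (θ + 2 * π) = f θ
namespace SP
variable {f g : ℝ → ℝ}
lemma der (hf : SP f) : SP (deriv f) := by
  refine ⟨?_, fun θ => ?_⟩
  · have h : ContDiff ℝ ((⊤ : ℕ∞) + 1) f := by simpa using hf.1
    exact (contDiff_succ_iff_deriv.1 h).2.2
  · have : (fun x => f (x + 2 * π)) = f := funext hf.2
    rw [← deriv_comp_add_const, this]
lemma iter (hf : SP f) (m : ℕ) : SP (deriv^[m] f) := by
  induction m generalizing f with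
  | zero => exact hf
  | succ m ih => exact ih hf.der
lemma cont (hf : SP f) : Continuous f := hf.1.continuous
lemma hd (hf : SP f) (θ : ℝ) : HasDerivAt f (deriv f θ) θ :=
  ((hf.1.differentiable (by simp)) θ).hasDerivAt
lemma add (hf : SP f) (hg : SP g) : SP (fun θ => f θ + g θ) :=
  ⟨hf.1.add hg.1, fun θ => by simp only [hf.2, hg.2]⟩
lemma sub (hf : SP f) (hg : SP g) : SP (fun θ => f θ - g θ) :=
  ⟨hf.1.sub hg.1, fun θ => by simp only [hf.2, hg.2]⟩
lemma mul (hf : SP f) (hg : SP g) : SP (fun θ => f θ * g θ) :=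
  ⟨hf.1.mul hg.1, fun θ => by simp only [hf.2, hg.2]⟩
lemma cst (c : ℝ) : SP (fun _ => c) := ⟨contDiff_const, fun _ => rfl⟩
lemma bdd (hf : SP f) : ∃ B, ∀ θ, |f θ| ≤ B := by
  obtain ⟨B, hB⟩ := (isCompact_Icc (a := (0:ℝ)) (b := 2 * π)).exists_bound_of_continuousOn
    hf.cont.continuousOn
  refine ⟨B, fun θ => ?_⟩
  obtain ⟨y, hy, e⟩ := Function.Periodic.exists_mem_Ico₀ (f := f) hf.2 Real.two_pi_pos θ
  rw [e]; exact hB y ⟨hy.1, hy.2.le⟩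
end SP
lemma int_cont {f : ℝ → ℝ} (hf : Continuous f) (n : ℤ) :
    Continuous (fun θ : ℝ => (f θ : ℂ) * Complex.exp (-(Complex.I * n * θ))) := by fun_prop
lemma norm_e (n : ℤ) (θ : ℝ) : ‖Complex.exp (-(Complex.I * n * θ))‖ = 1 := by
  rw [Complex.norm_exp]; simp
lemma fc_bd {f : ℝ → ℝ} {B : ℝ} (h : ∀ θ, |f θ| ≤ B) (n : ℤ) : ‖fCoeff f n‖ ≤ B := by
  have h1 := intervalIntegral.norm_integral_le_of_norm_le_const (a := 0) (b := 2 * π) (C := B)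
    (f := fun θ : ℝ => (f θ : ℂ) * Complex.exp (-(Complex.I * n * θ))) (fun θ _ => by
      rw [norm_mul, norm_e, mul_one, Complex.norm_real]; exact h θ)
  unfold fCoeff
  rw [norm_mul]
  have hpi := Real.two_pi_pos
  have : ‖(1 / (2 * (π:ℂ)))‖ = (2 * π)⁻¹ := by
    simp [abs_of_pos Real.pi_pos]
  rw [this]
  rw [sub_zero, abs_of_pos hpi] at h1
  calc _ ≤ (2 * π)⁻¹ * (B * (2 * π)) := by gcongr
    _ = B := by field_simp
lemma fc_lin {f g : ℝ → ℝ} (hf : Continuous f) (hg : Continuous g) (a b : ℝ) (n : ℤ) :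
    fCoeff (fun θ => a * f θ + b * g θ) n = a * fCoeff f n + b * fCoeff g n := by
  unfold fCoeff
  have e : (fun θ : ℝ => ((a * f θ + b * g θ : ℝ) : ℂ) * Complex.exp (-(Complex.I * n * θ)))
    = fun θ => a * ((f θ : ℂ) * Complex.exp (-(Complex.I * n * θ))) +
      b * ((g θ : ℂ) * Complex.exp (-(Complex.I * n * θ))) := by
    funext θ; push_cast; ring
  rw [e, intervalIntegral.integral_add, intervalIntegral.integral_const_mul,
    intervalIntegral.integral_const_mul]
  · ring
  · exact (continuous_const.mul (int_cont hf n)).intervalIntegrable _ _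
  · exact (continuous_const.mul (int_cont hg n)).intervalIntegrable _ _
lemma fc_der {f : ℝ → ℝ} (hf : SP f) (n : ℤ) :
    fCoeff (deriv f) n = Complex.I * n * fCoeff f n := by
  unfold fCoeff
  have h1 : ∀ x : ℝ, HasDerivAt (fun θ : ℝ => (f θ : ℂ)) ((deriv f x : ℝ) : ℂ) x := fun x =>
    (hf.hd x).ofReal_comp
  have h2 : ∀ x : ℝ, HasDerivAt (fun θ : ℝ => Complex.exp (-(Complex.I * n * θ)))
      (Complex.exp (-(Complex.I * n * x)) * -(Complex.I * n)) x := fun x => by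
    have : HasDerivAt (fun θ : ℝ => -(Complex.I * n * (θ:ℂ))) (-(Complex.I * n)) x := by
      have := ((Complex.ofRealCLM.hasDerivAt (x := x)).const_mul (Complex.I * n)).neg
      simp only [Complex.ofRealCLM_apply, Complex.ofReal_one, mul_one] at this
      exact this
    exact this.cexp
  have h3 := intervalIntegral.integral_mul_deriv_eq_deriv_mul (a := 0) (b := 2 * π)
    (fun x _ => h1 x) (fun x _ => h2 x)
    ((Complex.continuous_ofReal.comp hf.der.cont).intervalIntegrable _ _)
    (by apply Continuous.intervalIntegrable; fun_prop)
  have e0 : f (2 * π) = f 0 := by simpa using hf.2 0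
  have e1 : Complex.exp (-(Complex.I * n * ((2 * π : ℝ) : ℂ))) = 1 := by
    rw [Complex.exp_eq_one_iff]; exact ⟨-n, by push_cast; ring⟩
  rw [e0, e1] at h3
  simp only [Complex.ofReal_zero, mul_zero, neg_zero, Complex.exp_zero, sub_self, zero_sub] at h3
  have e2 : ∀ θ : ℝ, (f θ : ℂ) * (Complex.exp (-(Complex.I * n * θ)) * -(Complex.I * n)) =
    -(Complex.I * n) * ((f θ : ℂ) * Complex.exp (-(Complex.I * n * θ))) := fun θ => by ring
  simp only [e2] at h3
  rw [intervalIntegral.integral_const_mul] at h3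
  rw [← neg_eq_iff_eq_neg.2 h3]; ring
noncomputable def wt (n : ℤ) : ℝ := 1 + |(n:ℝ)|
lemma wt1 (n : ℤ) : 1 ≤ wt n := by unfold wt; linarith [abs_nonneg (n:ℝ)]
lemma wt0 (n : ℤ) : 0 < wt n := by linarith [wt1 n]
lemma fc_iter {f : ℝ → ℝ} (hf : SP f) (m : ℕ) (n : ℤ) :
    ‖fCoeff (deriv^[m] f) n‖ = |(n:ℝ)| ^ m * ‖fCoeff f n‖ := by
  induction m generalizing f with
  | zero => simp
  | succ m ih =>
    rw [Function.iterate_succ_apply, ih hf.der, fc_der hf, norm_mul, norm_mul]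
    simp only [Complex.norm_I, Complex.norm_intCast, one_mul]
    ring
lemma wt_pow (n : ℤ) (m : ℕ) : wt n ^ m ≤ 2 ^ m * (1 + |(n:ℝ)| ^ m) := by
  have h0 := abs_nonneg (n:ℝ)
  have h1 : wt n ≤ 2 * max 1 |(n:ℝ)| := by
    unfold wt; linarith [le_max_left 1 |(n:ℝ)|, le_max_right 1 |(n:ℝ)|]
  calc wt n ^ m ≤ (2 * max 1 |(n:ℝ)|) ^ m := pow_le_pow_left₀ (wt0 n).le h1 m
    _ = 2 ^ m * (max 1 |(n:ℝ)|) ^ m := mul_pow ..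
    _ ≤ _ := by
      gcongr
      rcases max_choice 1 |(n:ℝ)| with h | h <;> rw [h]
      · simp [h0, pow_nonneg]
      · linarith
noncomputable def Xn (m : ℕ) (f : ℝ → ℝ) : ℝ := ⨆ n : ℤ, wt n ^ m * ‖fCoeff f n‖
noncomputable def An (f : ℝ → ℝ) : ℝ := ∑' n : ℤ, ‖fCoeff f n‖
noncomputable def Kc : ℝ := ∑' n : ℤ, (wt n ^ 2)⁻¹
lemma wt_bd {f : ℝ → ℝ} (hf : SP f) {m : ℕ} {B0 B1 : ℝ} (h0 : ∀ θ, |f θ| ≤ B0)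
    (h1 : ∀ θ, |deriv^[m] f θ| ≤ B1) (n : ℤ) : wt n ^ m * ‖fCoeff f n‖ ≤ 2 ^ m * (B0 + B1) := by
  have a1 := fc_bd h0 n
  have a2 := fc_bd h1 n
  rw [fc_iter hf] at a2
  calc wt n ^ m * ‖fCoeff f n‖ ≤ 2 ^ m * (1 + |(n:ℝ)| ^ m) * ‖fCoeff f n‖ :=
      mul_le_mul_of_nonneg_right (wt_pow n m) (norm_nonneg _)
    _ = 2 ^ m * (‖fCoeff f n‖ + |(n:ℝ)| ^ m * ‖fCoeff f n‖) := by ring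
    _ ≤ _ := by gcongr
lemma le_Xn {f : ℝ → ℝ} (hf : SP f) (m : ℕ) (n : ℤ) : wt n ^ m * ‖fCoeff f n‖ ≤ Xn m f := by
  obtain ⟨B0, h0⟩ := hf.bdd
  obtain ⟨B1, h1⟩ := (hf.iter m).bdd
  exact le_ciSup (f := fun n : ℤ => wt n ^ m * ‖fCoeff f n‖)
    ⟨_, by rintro _ ⟨n, rfl⟩; exact wt_bd hf h0 h1 n⟩ n
lemma Xn_le {f : ℝ → ℝ} {m : ℕ} {B : ℝ} (h : ∀ n, wt n ^ m * ‖fCoeff f n‖ ≤ B) : Xn m f ≤ B :=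
  ciSup_le h
lemma Xn_nonneg (m : ℕ) (f : ℝ → ℝ) : 0 ≤ Xn m f :=
  Real.iSup_nonneg fun n => mul_nonneg (pow_nonneg (wt0 n).le _) (norm_nonneg _)
lemma An_nonneg (f : ℝ → ℝ) : 0 ≤ An f := tsum_nonneg fun _ => norm_nonneg _
lemma Xn_mono {f : ℝ → ℝ} (hf : SP f) {m m' : ℕ} (h : m ≤ m') : Xn m f ≤ Xn m' f :=
  Xn_le fun n => (mul_le_mul_of_nonneg_right (pow_le_pow_right₀ (wt1 n) h) (norm_nonneg _)).trans
    (le_Xn hf m' n)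
lemma sum_inv : Summable (fun n : ℤ => (wt n ^ 2)⁻¹) := by
  have h := (Real.summable_one_div_int_pow (p := 2)).2 (by norm_num)
  have h0 : Summable (fun n : ℤ => if n = 0 then (1:ℝ) else 0) :=
    summable_of_ne_finset_zero (s := {0}) (by intro b hb; simp at hb; simp [hb])
  refine Summable.of_nonneg_of_le (fun n => by positivity) (fun n => ?_) (h0.add h)
  by_cases hn : n = 0
  · subst hn; simp [wt]
  · have : (0:ℝ) < |(n:ℝ)| := by positivity
    rw [if_neg hn, zero_add, one_div, ← sq_abs (n:ℝ)]
    apply inv_anti₀ (by positivity)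
    have h2 : |(n:ℝ)| ≤ wt n := by unfold wt; linarith
    exact pow_le_pow_left₀ this.le h2 2
lemma Kc_nonneg : 0 ≤ Kc := tsum_nonneg fun n => by positivity
lemma wt_div {f : ℝ → ℝ} {X : ℝ} {m : ℕ} (h : ∀ n, wt n ^ (m+2) * ‖fCoeff f n‖ ≤ X) (n : ℤ) :
    wt n ^ m * ‖fCoeff f n‖ ≤ X * (wt n ^ 2)⁻¹ := by
  have := wt0 n
  rw [le_mul_inv_iff₀ (by positivity)]
  calc _ = wt n ^ (m+2) * ‖fCoeff f n‖ := by ring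
    _ ≤ X := h n
lemma summ_m {f : ℝ → ℝ} (hf : SP f) (m : ℕ) : Summable fun n : ℤ => wt n ^ m * ‖fCoeff f n‖ :=
  Summable.of_nonneg_of_le (fun n => mul_nonneg (pow_nonneg (wt0 n).le _) (norm_nonneg _))
    (wt_div (le_Xn hf (m+2))) (sum_inv.mul_left _)
lemma summ {f : ℝ → ℝ} (hf : SP f) : Summable fun n : ℤ => ‖fCoeff f n‖ := by
  simpa using summ_m hf 0
lemma An_le {f : ℝ → ℝ} (hf : SP f) {m : ℕ} (hm : 2 ≤ m) : An f ≤ Kc * Xn m f := by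
  have h : ∀ n : ℤ, ‖fCoeff f n‖ ≤ Xn m f * (wt n ^ 2)⁻¹ := fun n => by
    have := wt_div (m := 0) (fun n => (le_Xn hf (0+2) n).trans (Xn_mono hf hm)) n
    simpa using this
  calc An f ≤ ∑' n : ℤ, Xn m f * (wt n ^ 2)⁻¹ := (summ hf).tsum_le_tsum h (sum_inv.mul_left _)
    _ = Kc * Xn m f := by rw [tsum_mul_left, Kc, mul_comm]
lemma fc_hasSum {f : ℝ → ℝ} (hf : SP f) (θ : ℝ) :
    HasSum (fun n : ℤ => fCoeff f n * Complex.exp (Complex.I * n * θ)) (f θ : ℂ) := by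
  have : Fact (0 < 2 * π) := ⟨Real.two_pi_pos⟩
  have hper : Function.Periodic (fun θ : ℝ => (f θ : ℂ)) (2 * π) := fun θ => by
    simp only [hf.2]
  let F : C(AddCircle (2 * π), ℂ) := ⟨hper.lift, by
    refine continuous_coinduced_dom.2 ?_
    exact Complex.continuous_ofReal.comp hf.cont⟩
  have hF : ∀ x : ℝ, F (x : AddCircle (2 * π)) = (f x : ℂ) := fun x => rfl
  have hc : ∀ n : ℤ, fourierCoeff F n = fCoeff f n := fun n => by
    rw [fourierCoeff_eq_intervalIntegral F n 0, fCoeff, zero_add, Complex.real_smul]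
    congr 1
    · push_cast; rfl
    · congr 1; funext x
      rw [hF, smul_eq_mul, mul_comm, fourier_coe_apply]
      congr 2
      have : (π : ℂ) ≠ 0 := by exact_mod_cast Real.pi_ne_zero
      push_cast; field_simp
  have hs : Summable (fourierCoeff F) := by
    have : fourierCoeff F = fCoeff f := funext hc
    rw [this]; exact (summ hf).of_norm
  have h := has_pointwise_sum_fourier_series_of_summable hs (θ : AddCircle (2 * π))
  rw [hF] at h
  convert h using 2 with n
  rw [hc, smul_eq_mul, fourier_coe_apply]
  congr 2
  have : (π : ℂ) ≠ 0 := by exact_mod_cast Real.pi_ne_zero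
  push_cast; field_simp
lemma norm_e' (n : ℤ) (θ : ℝ) : ‖Complex.exp (Complex.I * n * θ)‖ = 1 := by
  rw [Complex.norm_exp]; simp
lemma sup_le_An {f : ℝ → ℝ} (hf : SP f) (θ : ℝ) : |f θ| ≤ An f := by
  have h := fc_hasSum hf θ
  have := h.norm_le_of_bounded (summ hf).hasSum (fun n => by rw [norm_mul, norm_e', mul_one])
  simpa [An] using this
lemma fc_mul {f g : ℝ → ℝ} (hf : SP f) (hg : SP g) (n : ℤ) :
    HasSum (fun j : ℤ => fCoeff f (n - j) * fCoeff g j) (fCoeff (fun θ => f θ * g θ) n) := by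
  obtain ⟨B, hB⟩ := hf.bdd
  have h := intervalIntegral.hasSum_integral_of_dominated_convergence (μ := volume) (a := 0)
    (b := 2 * π)
    (F := fun (j : ℤ) (θ : ℝ) => fCoeff g j * ((f θ : ℂ) * Complex.exp (-(Complex.I * (n - j : ℤ) * θ))))
    (f := fun θ : ℝ => ((f θ * g θ : ℝ) : ℂ) * Complex.exp (-(Complex.I * n * θ)))
    (fun j _ => ‖fCoeff g j‖ * B)
    (fun j => ((continuous_const.mul (int_cont hf.cont (n-j))).aestronglyMeasurable))
    (fun j => Eventually.of_forall fun θ _ => by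
      rw [norm_mul, norm_mul, norm_e, mul_one, Complex.norm_real]
      exact mul_le_mul_of_nonneg_left (hB θ) (norm_nonneg _))
    (Eventually.of_forall fun θ _ => (summ hg).mul_right B)
    (by apply Continuous.intervalIntegrable; fun_prop)
    (Eventually.of_forall fun θ _ => by
      have := (fc_hasSum hg θ).mul_left ((f θ : ℂ) * Complex.exp (-(Complex.I * n * θ)))
      have e1 : (fun j : ℤ => (f θ : ℂ) * Complex.exp (-(Complex.I * n * θ)) *
          (fCoeff g j * Complex.exp (Complex.I * j * θ))) = fun j : ℤ => fCoeff g j *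
          ((f θ : ℂ) * Complex.exp (-(Complex.I * (n - j : ℤ) * θ))) := by
        funext j
        rw [show -(Complex.I * ((n - j : ℤ) : ℂ) * θ) = -(Complex.I * n * θ) + Complex.I * j * θ by
          push_cast; ring, Complex.exp_add]
        ring
      have e2 : (f θ : ℂ) * Complex.exp (-(Complex.I * n * θ)) * (g θ : ℂ) =
          ((f θ * g θ : ℝ) : ℂ) * Complex.exp (-(Complex.I * n * θ)) := by push_cast; ring
      rw [e1, e2] at this
      exact this)
  have h2 := h.mul_left (1 / (2 * (π : ℂ)))
  have e : (fun j : ℤ => fCoeff f (n - j) * fCoeff g j) = fun j : ℤ => 1 / (2 * (π : ℂ)) *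
      ∫ θ in (0:ℝ)..(2*π), fCoeff g j * ((f θ : ℂ) * Complex.exp (-(Complex.I * (n - j : ℤ) * θ))) := by
    funext j
    rw [intervalIntegral.integral_const_mul]
    conv_lhs => rw [fCoeff]
    ring
  rw [e]
  exact h2
end PC
namespace PC
open scoped ContDiff Topology
lemma wt_sub (n j : ℤ) : wt n ≤ wt (n - j) + wt j := by
  unfold wt
  have := abs_add_le ((n - j : ℤ) : ℝ) (j : ℝ)
  push_cast at this ⊢
  rw [sub_add_cancel] at this; linarith
lemma conv_bd {f g h : ℝ → ℝ} (hf : SP f) (hg : SP g) (hh : SP h) {m : ℕ} {n : ℤ} {W c : ℝ}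
    (hW : 0 ≤ W) (hc : 0 ≤ c)
    (H : ∀ j, W * ‖fCoeff h j‖ ≤ c * ((wt (n-j) ^ m + wt j ^ m) * ‖fCoeff g j‖)) :
    W * ‖fCoeff (fun θ => f θ * h θ) n‖ ≤ c * (An f * Xn m g + Xn m f * An g) := by
  have e0 : ∀ j : ℤ, ‖fCoeff f (n - j)‖ = (fun j => ‖fCoeff f j‖) (Equiv.subLeft n j) := fun j => rfl
  have s1 : Summable fun j : ℤ => ‖fCoeff f (n - j)‖ := by
    simp only [e0]
    exact (Equiv.subLeft n).summable_iff (f := fun j => ‖fCoeff f j‖) |>.2 (summ hf)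
  have t1 : ∑' j : ℤ, ‖fCoeff f (n - j)‖ = An f := by
    simp only [e0]
    exact (Equiv.subLeft n).tsum_eq (fun j => ‖fCoeff f j‖)
  have h1 : ∀ j : ℤ, W * (‖fCoeff f (n - j) * fCoeff h j‖) ≤
      c * (‖fCoeff f (n - j)‖ * Xn m g + Xn m f * ‖fCoeff g j‖) := fun j => by
    have a1 := le_Xn hf m (n - j)
    have a2 := le_Xn hg m j
    have a3 := norm_nonneg (fCoeff f (n - j))
    have a4 := norm_nonneg (fCoeff g j)
    rw [norm_mul]
    calc W * (‖fCoeff f (n - j)‖ * ‖fCoeff h j‖) = ‖fCoeff f (n - j)‖ * (W * ‖fCoeff h j‖) := by ring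
      _ ≤ ‖fCoeff f (n - j)‖ * (c * ((wt (n-j) ^ m + wt j ^ m) * ‖fCoeff g j‖)) :=
        mul_le_mul_of_nonneg_left (H j) a3
      _ = c * (‖fCoeff f (n - j)‖ * (wt j ^ m * ‖fCoeff g j‖) +
          (wt (n-j) ^ m * ‖fCoeff f (n - j)‖) * ‖fCoeff g j‖) := by ring
      _ ≤ _ := mul_le_mul_of_nonneg_left (add_le_add (mul_le_mul_of_nonneg_left a2 a3)
        (mul_le_mul_of_nonneg_right a1 a4)) hc
  have hs : HasSum (fun j : ℤ => c * (‖fCoeff f (n - j)‖ * Xn m g + Xn m f * ‖fCoeff g j‖))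
      (c * (An f * Xn m g + Xn m f * An g)) := by
    rw [← t1]
    exact (((s1.hasSum).mul_right _).add ((summ hg).hasSum.mul_left _)).mul_left c
  have eW : ‖(W : ℂ)‖ = W := by rw [Complex.norm_real, Real.norm_of_nonneg hW]
  have h2 : HasSum (fun j : ℤ => (W : ℂ) * (fCoeff f (n - j) * fCoeff h j))
    ((W : ℂ) * fCoeff (fun θ => f θ * h θ) n) := (fc_mul hf hh n).mul_left (W : ℂ)
  have h4 : ∀ j : ℤ, ‖(W : ℂ) * (fCoeff f (n - j) * fCoeff h j)‖ ≤
      c * (‖fCoeff f (n - j)‖ * Xn m g + Xn m f * ‖fCoeff g j‖) := fun j => by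
    rw [norm_mul, eW]; exact h1 j
  have h3 := h2.norm_le_of_bounded hs h4
  rwa [norm_mul, eW] at h3
lemma max_pow_le {a b : ℝ} (ha : 0 ≤ a) (hb : 0 ≤ b) (m : ℕ) : (max a b) ^ m ≤ a ^ m + b ^ m := by
  rcases max_choice a b with h | h <;> rw [h]
  · linarith [pow_nonneg hb m]
  · linarith [pow_nonneg ha m]
lemma wt_max (n j : ℤ) : wt n ≤ 2 * max (wt (n-j)) (wt j) := by
  linarith [wt_sub n j, le_max_left (wt (n-j)) (wt j), le_max_right (wt (n-j)) (wt j)]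
lemma conv1 {f g : ℝ → ℝ} (hf : SP f) (hg : SP g) (m : ℕ) (n : ℤ) :
    wt n ^ m * ‖fCoeff (fun θ => f θ * g θ) n‖ ≤ 2 ^ m * (An f * Xn m g + Xn m f * An g) := by
  refine conv_bd (f := f) (g := g) (h := g) (m := m) (n := n) (W := wt n ^ m) (c := 2 ^ m) hf hg hg
    (pow_nonneg (wt0 n).le _) (by positivity) fun j => ?_
  rw [← mul_assoc]
  refine mul_le_mul_of_nonneg_right ?_ (norm_nonneg _)
  refine (pow_le_pow_left₀ (wt0 n).le (wt_max n j) m).trans ?_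
  rw [mul_pow]
  exact mul_le_mul_of_nonneg_left (max_pow_le (wt0 _).le (wt0 _).le m) (by positivity)
lemma conv2 {f g : ℝ → ℝ} (hf : SP f) (hg : SP g) (m : ℕ) (n : ℤ) :
    wt n ^ m * ‖fCoeff (fun θ => f θ * deriv g θ) n‖
      ≤ 2 ^ m * (An f * Xn (m+1) g + Xn (m+1) f * An g) := by
  refine conv_bd (f := f) (g := g) (h := deriv g) (m := m+1) (n := n) (W := wt n ^ m) (c := 2 ^ m)
    hf hg hg.der (pow_nonneg (wt0 n).le _) (by positivity) fun j => ?_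
  rw [fc_der hg, norm_mul, ← mul_assoc, ← mul_assoc]
  refine mul_le_mul_of_nonneg_right ?_ (norm_nonneg _)
  simp only [norm_mul, Complex.norm_I, Complex.norm_intCast, one_mul]
  have h1 : |(j:ℝ)| ≤ max (wt (n-j)) (wt j) := le_trans (by unfold wt; linarith) (le_max_right _ _)
  have h0 : 0 ≤ max (wt (n-j)) (wt j) := (wt0 _).le.trans (le_max_right _ _)
  calc wt n ^ m * |(j:ℝ)| ≤ (2 * max (wt (n-j)) (wt j)) ^ m * max (wt (n-j)) (wt j) :=
      mul_le_mul (pow_le_pow_left₀ (wt0 n).le (wt_max n j) m) h1 (abs_nonneg _) (by positivity)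
    _ = 2 ^ m * (max (wt (n-j)) (wt j)) ^ (m+1) := by rw [mul_pow]; ring
    _ ≤ _ := mul_le_mul_of_nonneg_left (max_pow_le (wt0 _).le (wt0 _).le _) (by positivity)
open ComplexConjugate in
lemma fc_conj (f : ℝ → ℝ) (n : ℤ) : fCoeff f (-n) = conj (fCoeff f n) := by
  unfold fCoeff
  rw [map_mul, ← intervalIntegral.intervalIntegral_conj]
  congr 1
  · rw [map_div₀, map_mul, Complex.conj_ofReal, map_one, map_ofNat]
  · congr 1; funext θ
    simp [← Complex.exp_conj]
lemma bessel {f : ℝ → ℝ} (hf : SP f) {B : ℝ} (hB : ∀ θ, |f θ| ≤ B) (s : Finset ℤ) :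
    ∑ n ∈ s, ‖fCoeff f n‖ ^ 2 ≤ B ^ 2 := by
  have h := fc_mul hf hf 0
  have e : (fun j : ℤ => fCoeff f (0 - j) * fCoeff f j) = fun j => ((‖fCoeff f j‖ ^ 2 : ℝ) : ℂ) := by
    funext j
    rw [zero_sub, fc_conj, Complex.conj_mul', Complex.ofReal_pow]
  rw [e] at h
  have h2 := Complex.reCLM.hasSum h
  simp only [Complex.reCLM_apply, Complex.ofReal_re] at h2
  refine (sum_le_hasSum s (fun i _ => by positivity) h2).trans ((Complex.re_le_norm _).trans ?_)
  refine fc_bd (fun θ => ?_) 0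
  rw [← sq, abs_pow]
  exact pow_le_pow_left₀ (abs_nonneg _) (hB θ) 2
lemma An_small {ε C : ℝ} (hε : 0 < ε) :
    ∃ δ > 0, ∀ f, SP f → (∀ θ, |f θ| ≤ δ) → (∀ θ, |deriv f θ| ≤ C) → An f ≤ ε := by
  obtain ⟨η, hη, hη2⟩ : ∃ η > 0, η * (1 + C^2) = ε / 4 :=
    ⟨ε / (4 * (1 + C^2)), by positivity, by field_simp⟩
  obtain ⟨S, hS⟩ := summable_iff_vanishing_norm.1 sum_inv (η * ε / 2) (by positivity)
  refine ⟨min 1 (ε / (2 * (S.card + 1))), by positivity, fun f hf h0 h1 => ?_⟩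
  have hC : 0 ≤ C := (abs_nonneg _).trans (h1 0)
  refine (summ hf).tsum_le_of_sum_le fun U => ?_
  have a1 : ∑ n ∈ U, ‖fCoeff f n‖ ≤ ∑ n ∈ S, ‖fCoeff f n‖ + ∑ n ∈ U \ S, ‖fCoeff f n‖ := by
    rw [← Finset.sum_union Finset.disjoint_sdiff]
    exact Finset.sum_le_sum_of_subset_of_nonneg (by intro x; simp; tauto) fun _ _ _ => norm_nonneg _
  have a2 : ∑ n ∈ S, ‖fCoeff f n‖ ≤ ε / 2 := by
    calc ∑ n ∈ S, ‖fCoeff f n‖ ≤ ∑ n ∈ S, ε / (2 * (S.card + 1)) :=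
          Finset.sum_le_sum fun n _ => fc_bd (fun θ => (h0 θ).trans (min_le_right _ _)) n
      _ = S.card * (ε / (2 * (S.card + 1))) := by simp
      _ ≤ ε / 2 := by
        rw [mul_div_assoc', div_le_div_iff₀ (by positivity) (by positivity)]
        nlinarith
  have a3 : ∀ n : ℤ, 2 * ‖fCoeff f n‖ ≤ 2 * η * (‖fCoeff f n‖ ^ 2 + ‖fCoeff (deriv f) n‖ ^ 2)
      + η⁻¹ * (wt n ^ 2)⁻¹ := fun n => by
    have b1 := fc_iter hf 1 n
    simp only [Function.iterate_one, pow_one] at b1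
    have b2 : wt n ^ 2 ≤ 2 * (1 + |(n:ℝ)| ^ 2) := by unfold wt; nlinarith [sq_nonneg (1 - |(n:ℝ)|)]
    have hw := wt0 n
    rw [b1]
    set y := ‖fCoeff f n‖
    have b3 : 2 * y ≤ η * (wt n ^ 2 * y ^ 2) + η⁻¹ * (wt n ^ 2)⁻¹ := by
      have : 0 ≤ η * (wt n * y - η⁻¹ * (wt n)⁻¹) ^ 2 := by positivity
      have e : η * (wt n * y - η⁻¹ * (wt n)⁻¹) ^ 2 = η * (wt n ^ 2 * y ^ 2) + η⁻¹ * (wt n ^ 2)⁻¹ - 2 * y := by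
        field_simp; ring
      linarith
    have b4 : η * (wt n ^ 2 * y ^ 2) ≤ η * (2 * (1 + |(n:ℝ)| ^ 2) * y ^ 2) := by gcongr
    calc _ ≤ _ := b3
      _ ≤ η * (2 * (1 + |(n:ℝ)| ^ 2) * y ^ 2) + η⁻¹ * (wt n ^ 2)⁻¹ := by linarith
      _ = _ := by ring
  have a4 := Finset.sum_le_sum (s := U \ S) fun n _ => a3 n
  rw [Finset.sum_add_distrib, ← Finset.mul_sum, ← Finset.mul_sum, ← Finset.mul_sum,
    Finset.sum_add_distrib] at a4
  have a5 := hS (U \ S) Finset.sdiff_disjoint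
  have a6 := (le_abs_self _).trans a5.le
  have a7 := bessel hf (fun θ => (h0 θ).trans (min_le_left _ _)) (U \ S)
  have a8 := bessel hf.der h1 (U \ S)
  have a9 : 2 * η * (∑ n ∈ U \ S, ‖fCoeff f n‖ ^ 2 + ∑ n ∈ U \ S, ‖fCoeff (deriv f) n‖ ^ 2)
      ≤ 2 * η * (1 + C^2) := by gcongr; linarith
  have a10 : η⁻¹ * ∑ n ∈ U \ S, (wt n ^ 2)⁻¹ ≤ η⁻¹ * (η * ε / 2) := by gcongr
  have e10 : η⁻¹ * (η * ε / 2) = ε / 2 := by field_simp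
  linarith
lemma der_le {f : ℝ → ℝ} (hf : SP f) (l : ℕ) (θ : ℝ) : |deriv^[l] f θ| ≤ Kc * Xn (l+2) f := by
  have h1 : Xn 2 (deriv^[l] f) ≤ Xn (l+2) f := by
   refine Xn_le fun n => ?_
   rw [fc_iter hf]
   refine le_trans ?_ (le_Xn hf (l+2) n)
   have : |(n:ℝ)| ^ l ≤ wt n ^ l := pow_le_pow_left₀ (abs_nonneg _) (by unfold wt; linarith) l
   have hw := (wt0 n).le
   calc wt n ^ 2 * (|(n:ℝ)| ^ l * ‖fCoeff f n‖) ≤ wt n ^ 2 * (wt n ^ l * ‖fCoeff f n‖) := by gcongr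
     _ = _ := by ring
  exact (sup_le_An (hf.iter l) θ).trans ((An_le (hf.iter l) le_rfl).trans
    (mul_le_mul_of_nonneg_left h1 Kc_nonneg))
end PC
namespace PC
open scoped ContDiff Topology
noncomputable def rh (κ : ℝ → ℝ) : ℝ → ℝ := fun θ => 1 - (κ θ)⁻¹
noncomputable def xx (p : ℕ) (κ : ℝ → ℝ) : ℝ → ℝ := fun θ => κ θ ^ p - 1
noncomputable def NN (p : ℕ) (κ : ℝ → ℝ) : ℝ → ℝ := fun θ => xx p κ θ - p * rh κ θ
noncomputable def zz (κ : ℝ → ℝ) : ℝ → ℝ := fun θ => κ θ - 1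
variable {p : ℕ} {κ : ℝ → ℝ}
lemma sp_rh (hκ : SP κ) (h0 : ∀ θ, 0 < κ θ) : SP (rh κ) :=
  ⟨contDiff_const.sub (hκ.1.inv fun θ => (h0 θ).ne'), fun θ => by simp only [rh, hκ.2]⟩
lemma sp_xx (hκ : SP κ) : SP (xx p κ) :=
  ⟨(hκ.1.pow p).sub contDiff_const, fun θ => by simp only [xx, hκ.2]⟩
lemma sp_NN (hκ : SP κ) (h0 : ∀ θ, 0 < κ θ) : SP (NN p κ) :=
  (sp_xx hκ).sub ((SP.cst (p:ℝ)).mul (sp_rh hκ h0))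
lemma sp_zz (hκ : SP κ) : SP (zz κ) := hκ.sub (SP.cst 1)
lemma hd_rh (hκ : SP κ) (h0 : ∀ θ, 0 < κ θ) (θ : ℝ) :
    deriv (rh κ) θ = deriv κ θ / κ θ ^ 2 := by
  have := ((hκ.hd θ).inv (h0 θ).ne').const_sub 1
  refine (HasDerivAt.deriv (f := rh κ) this).trans ?_
  ring
lemma hd_xx (hκ : SP κ) (θ : ℝ) : deriv (xx p κ) θ = p * κ θ ^ (p-1) * deriv κ θ :=
  (((hκ.hd θ).pow p).sub_const 1).deriv
lemma hd_NN (hp : 1 ≤ p) (hκ : SP κ) (h0 : ∀ θ, 0 < κ θ) (θ : ℝ) :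
    deriv (NN p κ) θ = rh κ θ * deriv (xx p κ) θ + p * (xx p κ θ * deriv (rh κ) θ) := by
  have h := (((sp_xx (p := p) hκ).hd θ).sub (((sp_rh hκ h0).hd θ).const_mul (p:ℝ))).deriv
  have e : deriv (NN p κ) θ = deriv (xx p κ) θ - p * deriv (rh κ) θ := h
  rw [e, hd_xx hκ, hd_rh hκ h0]
  unfold rh xx
  have := (h0 θ).ne'
  obtain ⟨q, rfl⟩ : ∃ q, p = q + 1 := ⟨p - 1, by omega⟩
  simp only [Nat.add_sub_cancel]
  field_simp
  ring
lemma pow_sub_le {y : ℝ} (h0 : 0 ≤ y) (h2 : y ≤ 2) (m : ℕ) : |y ^ m - 1| ≤ (2 ^ m - 1) * |y - 1| := by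
  induction m with
  | zero => simp
  | succ m ih =>
    have e : y ^ (m+1) - 1 = y * (y ^ m - 1) + (y - 1) := by ring
    rw [e]
    refine (abs_add_le _ _).trans ?_
    rw [abs_mul, abs_of_nonneg h0]
    have := mul_le_mul h2 ih (abs_nonneg _) (by norm_num)
    calc _ ≤ 2 * ((2 ^ m - 1) * |y - 1|) + |y - 1| := by linarith
      _ = _ := by ring
lemma NN_quad (h0 : ∀ θ, 0 < κ θ) (h2 : ∀ θ, κ θ ≤ 2) (p : ℕ) (θ : ℝ) :
    |NN p κ θ| ≤ (2 ^ (p+2) - 4) * rh κ θ ^ 2 := by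
  induction p with
  | zero => simp [NN, xx]; norm_num
  | succ p ih =>
    have hk := (h0 θ).ne'
    have e : NN (p+1) κ θ = NN p κ θ + rh κ θ * (κ θ ^ (p+1) - 1) := by
      simp only [NN, xx, rh]; push_cast; field_simp; ring
    have e2 : κ θ - 1 = κ θ * rh κ θ := by unfold rh; field_simp
    rw [e]
    refine (abs_add_le _ _).trans ?_
    have h3 := pow_sub_le (h0 θ).le (h2 θ) (p+1)
    rw [e2, abs_mul, abs_of_pos (h0 θ)] at h3
    have h4 : |κ θ ^ (p+1) - 1| ≤ 2 ^ (p+1) * (2 * |rh κ θ|) := by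
      refine h3.trans (mul_le_mul (by linarith) ?_ (by have := h0 θ; positivity) (by positivity))
      exact mul_le_mul_of_nonneg_right (h2 θ) (abs_nonneg _)
    rw [abs_mul]
    have h5 := mul_le_mul_of_nonneg_left h4 (abs_nonneg (rh κ θ))
    have e5 : |rh κ θ| * (2 ^ (p+1) * (2 * |rh κ θ|)) = 2 ^ (p+2) * rh κ θ ^ 2 := by
      rw [← sq_abs (rh κ θ)]; ring
    rw [e5] at h5
    calc _ ≤ _ := add_le_add ih h5
      _ = _ := by ring
noncomputable def DD (p m : ℕ) : ℝ := 2 * (2 ^ m * (1 + p) * (p + 1) + 2 ^ (p+2) * Kc)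
lemma DD_nonneg (p m : ℕ) : 0 ≤ DD p m := by
  unfold DD; have := Kc_nonneg; positivity
lemma X_xx (hκ : SP κ) (h0 : ∀ θ, 0 < κ θ) (m : ℕ) :
    Xn m (xx p κ) ≤ p * Xn m (rh κ) + Xn m (NN p κ) := by
  refine Xn_le fun n => ?_
  have e : xx p κ = fun θ => (p:ℝ) * rh κ θ + 1 * NN p κ θ := by funext θ; simp only [NN]; ring
  have e2 : fCoeff (xx p κ) n = p * fCoeff (rh κ) n + fCoeff (NN p κ) n := by
    rw [e, fc_lin (sp_rh hκ h0).cont (sp_NN hκ h0).cont]; simp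
  have h1 : ‖fCoeff (xx p κ) n‖ ≤ p * ‖fCoeff (rh κ) n‖ + ‖fCoeff (NN p κ) n‖ := by
    rw [e2]; refine (norm_add_le _ _).trans ?_
    rw [norm_mul]; simp
  have h2 := le_Xn (sp_rh hκ h0) m n
  have h3 := le_Xn (sp_NN (p := p) hκ h0) m n
  calc _ ≤ wt n ^ m * (p * ‖fCoeff (rh κ) n‖ + ‖fCoeff (NN p κ) n‖) :=
        mul_le_mul_of_nonneg_left h1 (pow_nonneg (wt0 n).le _)
    _ = p * (wt n ^ m * ‖fCoeff (rh κ) n‖) + wt n ^ m * ‖fCoeff (NN p κ) n‖ := by ring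
    _ ≤ _ := add_le_add (mul_le_mul_of_nonneg_left h2 (Nat.cast_nonneg p)) h3
lemma NN_est (hp : 1 ≤ p) (hκ : SP κ) (h0 : ∀ θ, 0 < κ θ) (h2 : ∀ θ, κ θ ≤ 2) {m : ℕ} (hm : 2 ≤ m)
    (ha : 2 ^ m * (1 + p) * An (rh κ) ≤ 1 / 2) :
    Xn m (NN p κ) ≤ DD p m * (An (rh κ) + An (xx p κ)) * Xn m (rh κ) := by
  have sρ := sp_rh hκ h0
  have sx := sp_xx (p := p) hκ
  have sN := sp_NN (p := p) hκ h0
  have K0 := Kc_nonneg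
  have hX := X_xx (p := p) hκ h0 m
  have a0 := An_nonneg (rh κ)
  have b0 := An_nonneg (xx p κ)
  have X0 := Xn_nonneg m (xx p κ)
  have Y0 := Xn_nonneg m (rh κ)
  have N0 := Xn_nonneg m (NN p κ)
  have haY := An_le sρ hm
  have hsup := sup_le_An sρ
  have key : Xn m (NN p κ) ≤ 2 ^ m * (1 + p) * (An (rh κ) * Xn m (xx p κ) + An (xx p κ) * Xn m (rh κ))
      + 2 ^ (p+2) * (An (rh κ) * (Kc * Xn m (rh κ))) := by
    refine Xn_le fun n => ?_
    by_cases hn : n = 0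
    · subst hn
      have w0 : wt 0 = 1 := by simp [wt]
      have h1 : ∀ θ, |NN p κ θ| ≤ 2 ^ (p+2) * (An (rh κ) * An (rh κ)) := fun θ => by
        refine (NN_quad h0 h2 p θ).trans ?_
        rw [← sq, ← sq_abs]
        have := pow_le_pow_left₀ (abs_nonneg _) (hsup θ) 2
        exact mul_le_mul (by linarith) this (by positivity) (by positivity)
      rw [w0, one_pow, one_mul]
      refine (fc_bd h1 0).trans ?_
      have := mul_le_mul_of_nonneg_left haY a0
      have h5 : 2 ^ (p+2) * (An (rh κ) * An (rh κ)) ≤ 2 ^ (p+2) * (An (rh κ) * (Kc * Xn m (rh κ))) :=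
        mul_le_mul_of_nonneg_left this (by positivity)
      have h6 : 0 ≤ (2:ℝ) ^ m * (1 + p) * (An (rh κ) * Xn m (xx p κ) + An (xx p κ) * Xn m (rh κ)) := by
        positivity
      linarith
    · obtain ⟨q, rfl⟩ : ∃ q, m = q + 1 := ⟨m - 1, by omega⟩
      have hw : wt n ≤ 2 * |(n:ℝ)| := by
        have : (1:ℝ) ≤ |(n:ℝ)| := by exact_mod_cast Int.one_le_abs hn
        unfold wt; linarith
      have e1 := fc_iter sN 1 n
      simp only [Function.iterate_one, pow_one] at e1
      have e2 : deriv (NN p κ) = fun θ => 1 * (rh κ θ * deriv (xx p κ) θ) +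
          (p:ℝ) * (xx p κ θ * deriv (rh κ) θ) := by
        funext θ; rw [hd_NN hp hκ h0, one_mul]
      have c1 := conv2 sρ sx q n
      have c2 := conv2 sx sρ q n
      have e3 : ‖fCoeff (deriv (NN p κ)) n‖ ≤ ‖fCoeff (fun θ => rh κ θ * deriv (xx p κ) θ) n‖ +
          p * ‖fCoeff (fun θ => xx p κ θ * deriv (rh κ) θ) n‖ := by
        rw [e2, fc_lin (sρ.mul sx.der).cont (sx.mul sρ.der).cont]
        refine (norm_add_le _ _).trans ?_
        rw [norm_mul, norm_mul]; simp
      have wp : 0 ≤ wt n ^ q := pow_nonneg (wt0 n).le _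
      calc wt n ^ (q+1) * ‖fCoeff (NN p κ) n‖ = wt n ^ q * (wt n * ‖fCoeff (NN p κ) n‖) := by ring
        _ ≤ wt n ^ q * (2 * |(n:ℝ)| * ‖fCoeff (NN p κ) n‖) := by gcongr
        _ = 2 * (wt n ^ q * ‖fCoeff (deriv (NN p κ)) n‖) := by rw [e1]; ring
        _ ≤ 2 * (wt n ^ q * (‖fCoeff (fun θ => rh κ θ * deriv (xx p κ) θ) n‖ +
          p * ‖fCoeff (fun θ => xx p κ θ * deriv (rh κ) θ) n‖)) := by gcongr
        _ = 2 * (wt n ^ q * ‖fCoeff (fun θ => rh κ θ * deriv (xx p κ) θ) n‖ +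
          p * (wt n ^ q * ‖fCoeff (fun θ => xx p κ θ * deriv (rh κ) θ) n‖)) := by ring
        _ ≤ 2 * (2 ^ q * (An (rh κ) * Xn (q+1) (xx p κ) + Xn (q+1) (rh κ) * An (xx p κ)) +
          p * (2 ^ q * (An (xx p κ) * Xn (q+1) (rh κ) + Xn (q+1) (xx p κ) * An (rh κ)))) := by gcongr
        _ = 2 ^ (q+1) * (1 + p) * (An (rh κ) * Xn (q+1) (xx p κ) + An (xx p κ) * Xn (q+1) (rh κ)) := by
          ring
        _ ≤ _ := le_add_of_nonneg_right (by positivity)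
  generalize An (rh κ) = a at *
  generalize An (xx p κ) = b at *
  generalize Xn m (xx p κ) = X at *
  generalize Xn m (rh κ) = Y at *
  generalize Xn m (NN p κ) = N at *
  have hM : (0:ℝ) ≤ 2 ^ m * (1 + p) := by positivity
  have h1 : 2 ^ m * (1 + p) * (a * X) ≤ 2 ^ m * (1 + p) * a * (p * Y) + 1/2 * N := by
    calc 2 ^ m * (1 + p) * (a * X) = 2 ^ m * (1 + p) * a * X := by ring
      _ ≤ 2 ^ m * (1 + p) * a * (p * Y + N) := mul_le_mul_of_nonneg_left hX (by positivity)
      _ = 2 ^ m * (1 + p) * a * (p * Y) + 2 ^ m * (1 + p) * a * N := by ring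
      _ ≤ _ := by gcongr
  have h3 : 0 ≤ 2 ^ m * (1 + p) * (a * Y) := by positivity
  have h4 : 0 ≤ 2 ^ m * (1 + p) * (p * (b * Y)) := by positivity
  have h5 : 0 ≤ (2:ℝ) ^ (p+2) * Kc * (b * Y) := by positivity
  have h6 : DD p m * (a + b) * Y = 2 * (2 ^ m * (1 + p) * a * (p * Y) + 2 ^ m * (1 + p) * (a * Y) +
    2 ^ m * (1 + p) * (p * (b * Y)) + 2 ^ m * (1 + p) * (b * Y) + 2 ^ (p+2) * (a * (Kc * Y)) +
    2 ^ (p+2) * Kc * (b * Y)) := by unfold DD; ring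
  rw [h6]
  linarith
lemma zz_est (hκ : SP κ) (h0 : ∀ θ, 0 < κ θ) {m : ℕ} (ha : 2 ^ m * An (rh κ) ≤ 1 / 2)
    (hz : An (zz κ) ≤ 1) : Xn m (zz κ) ≤ 2 * (1 + 2 ^ m) * Xn m (rh κ) := by
  have sρ := sp_rh hκ h0
  have sz := sp_zz hκ
  have e : zz κ = fun θ => 1 * rh κ θ + 1 * (rh κ θ * zz κ θ) := by
    funext θ; have := (h0 θ).ne'; unfold zz rh; field_simp; ring
  have Y0 := Xn_nonneg m (rh κ)
  have Z0 := Xn_nonneg m (zz κ)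
  have key : Xn m (zz κ) ≤ Xn m (rh κ) + 2 ^ m * (An (rh κ) * Xn m (zz κ) + Xn m (rh κ) * An (zz κ)) := by
    refine Xn_le fun n => ?_
    have h1 : ‖fCoeff (zz κ) n‖ ≤ ‖fCoeff (rh κ) n‖ + ‖fCoeff (fun θ => rh κ θ * zz κ θ) n‖ := by
      conv_lhs => rw [e, fc_lin sρ.cont (sρ.mul sz).cont]
      refine (norm_add_le _ _).trans ?_
      simp
    have h2 := le_Xn sρ m n
    have h3 := conv1 sρ sz m n
    have h4 := mul_le_mul_of_nonneg_left h1 (pow_nonneg (wt0 n).le m)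
    rw [mul_add] at h4
    linarith
  have h1 : 2 ^ m * (Xn m (rh κ) * An (zz κ)) ≤ 2 ^ m * (Xn m (rh κ) * 1) := by gcongr
  have h2 : 2 ^ m * An (rh κ) * Xn m (zz κ) ≤ 1/2 * Xn m (zz κ) := by gcongr
  linarith
lemma small_all (hp : 1 ≤ p) {ε C : ℝ} (hε : 0 < ε) :
    ∃ δ > 0, ∀ κ, SP κ → (∀ θ, 0 < κ θ) → (∀ θ, |κ θ ^ p - 1| ≤ δ) →
      (∀ θ, |deriv (fun θ => κ θ ^ p) θ| ≤ C) →
      (∀ θ, 1/2 ≤ κ θ) ∧ (∀ θ, κ θ ≤ 2) ∧ An (rh κ) ≤ ε ∧ An (xx p κ) ≤ ε ∧ An (zz κ) ≤ ε := by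
  obtain ⟨d1, hd1, H1⟩ := An_small (ε := ε) (C := 2 ^ (p+1) * C) hε
  obtain ⟨d2, hd2, H2⟩ := An_small (ε := ε) (C := C) hε
  obtain ⟨d3, hd3, H3⟩ := An_small (ε := ε) (C := 4 * (2 ^ (p+1) * C)) hε
  refine ⟨min (1/2) (min (d1/2) (min d2 d3)), by positivity, fun κ hκ h0 hv hv' => ?_⟩
  simp only [le_min_iff] at hv
  have hC : 0 ≤ C := (abs_nonneg _).trans (hv' 0)
  have hz : ∀ θ, |κ θ - 1| ≤ |κ θ ^ p - 1| := fun θ => by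
    have hk := h0 θ
    rcases le_total 1 (κ θ) with h | h
    · have := le_self_pow₀ h (by omega : p ≠ 0)
      rw [abs_of_nonneg (by linarith), abs_of_nonneg (by linarith)]; linarith
    · have := pow_le_of_le_one hk.le h (by omega : p ≠ 0)
      rw [abs_of_nonpos (by linarith), abs_of_nonpos (by linarith)]; linarith
  have hl : ∀ θ, 1/2 ≤ κ θ := fun θ => by
    have := (abs_le.1 ((hz θ).trans (hv θ).1)).1; linarith
  have hu : ∀ θ, κ θ ≤ 2 := fun θ => by
    have := (abs_le.1 ((hz θ).trans (hv θ).1)).2; linarith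
  have hx' : ∀ θ, deriv (xx p κ) θ = deriv (fun θ => κ θ ^ p) θ := fun θ => by
    rw [hd_xx hκ]; exact ((hκ.hd θ).pow p).deriv.symm
  have hρ' : ∀ θ, |deriv (rh κ) θ| ≤ 2 ^ (p+1) * C := fun θ => by
    have h1 : deriv (xx p κ) θ = p * κ θ ^ (p+1) * deriv (rh κ) θ := by
      rw [hd_xx hκ, hd_rh hκ h0]
      obtain ⟨q, rfl⟩ : ∃ q, p = q + 1 := ⟨p - 1, by omega⟩
      have := (h0 θ).ne'
      simp only [Nat.add_sub_cancel]; field_simp; ring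
    have h2 := hv' θ
    rw [← hx', h1, abs_mul] at h2
    have hp' : (1:ℝ) ≤ p := by exact_mod_cast hp
    have h3 : (1/2:ℝ) ^ (p+1) ≤ |(p:ℝ) * κ θ ^ (p+1)| := by
      rw [abs_of_pos (by have := h0 θ; positivity)]
      have := pow_le_pow_left₀ (by norm_num) (hl θ) (p+1)
      have h9 : κ θ ^ (p+1) ≤ p * κ θ ^ (p+1) :=
        le_mul_of_one_le_left (pow_nonneg (h0 θ).le _) hp'
      linarith
    have h4 : (1/2:ℝ) ^ (p+1) * |deriv (rh κ) θ| ≤ C :=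
      (mul_le_mul_of_nonneg_right h3 (abs_nonneg _)).trans h2
    have h5 := mul_le_mul_of_nonneg_left h4 (by positivity : (0:ℝ) ≤ 2 ^ (p+1))
    rwa [← mul_assoc, ← mul_pow, mul_one_div_cancel two_ne_zero, one_pow, one_mul] at h5
  refine ⟨hl, hu, H1 _ (sp_rh hκ h0) (fun θ => ?_) hρ', H2 _ (sp_xx hκ) (fun θ => (hv θ).2.2.1)
    (fun θ => by rw [hx']; exact hv' θ), H3 _ (sp_zz hκ) (fun θ => (hz θ).trans (hv θ).2.2.2)
    (fun θ => ?_)⟩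
  · have e : rh κ θ = (κ θ)⁻¹ * (κ θ - 1) := by unfold rh; have := (h0 θ).ne'; field_simp
    rw [e, abs_mul, abs_of_pos (inv_pos.2 (h0 θ))]
    have h1 : (κ θ)⁻¹ ≤ 2 := by
      have := inv_anti₀ (by norm_num) (hl θ); norm_num at this; exact this
    have := mul_le_mul h1 ((hz θ).trans (hv θ).2.1) (abs_nonneg _) (by norm_num)
    linarith
  · have e : deriv (zz κ) θ = κ θ ^ 2 * deriv (rh κ) θ := by
      have e1 : deriv (zz κ) θ = deriv κ θ := ((hκ.hd θ).sub_const 1).deriv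
      rw [hd_rh hκ h0, e1]
      have := (h0 θ).ne'; field_simp
    rw [e, abs_mul, abs_of_pos (by have := h0 θ; positivity)]
    have h4 : κ θ ^ 2 ≤ 4 := by nlinarith [hu θ, h0 θ]
    exact mul_le_mul h4 (hρ' θ) (abs_nonneg _) (by norm_num)
end PC
namespace PC
open scoped ContDiff Topology
lemma ode1 {g f : ℝ → ℂ} {b b' : ℝ → ℝ} {L s t : ℝ} (hst : s ≤ t)
    (hg : ∀ u ∈ Icc s t, HasDerivAt g (-(L : ℂ) * g u + f u) u)
    (hb : ∀ u, HasDerivAt b (b' u) u) (hf : ∀ u ∈ Icc s t, ‖f u‖ ≤ b' u + L * b u)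
    (hs : ‖g s‖ ≤ b s) : ‖g t‖ ≤ b t := by
  have hE : ∀ u : ℝ, HasDerivAt (fun u => rexp (L * u)) (rexp (L * u) * L) u := fun u => by
    have := ((hasDerivAt_id u).const_mul L).exp
    simpa using this
  have hG : ∀ u ∈ Icc s t, HasDerivAt (fun u => (rexp (L * u) : ℂ) * g u)
      ((rexp (L * u) : ℂ) * f u) u := fun u hu => by
    refine (((hE u).ofReal_comp).mul (hg u hu)).congr_deriv ?_
    push_cast; ring
  have hB : ∀ u, HasDerivAt (fun u => rexp (L * u) * b u)
      (rexp (L * u) * (b' u + L * b u)) u := fun u => by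
    refine ((hE u).mul (hb u)).congr_deriv ?_
    ring
  have nE : ∀ u : ℝ, ‖(rexp (L * u) : ℂ)‖ = rexp (L * u) := fun u => by
    rw [Complex.norm_real, Real.norm_of_nonneg (Real.exp_pos _).le]
  have key := image_norm_le_of_norm_deriv_right_le_deriv_boundary (a := s) (b := t)
    (f := fun u => (rexp (L * u) : ℂ) * g u) (f' := fun u => (rexp (L * u) : ℂ) * f u)
    (fun u hu => (hG u hu).continuousAt.continuousWithinAt)
    (fun u hu => (hG u ⟨hu.1, hu.2.le⟩).hasDerivWithinAt)
    (by
      show ‖(rexp (L * s) : ℂ) * g s‖ ≤ rexp (L * s) * b s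
      rw [norm_mul, nE]; exact mul_le_mul_of_nonneg_left hs (Real.exp_pos _).le) hB
    (fun u hu => by
      rw [norm_mul, nE]
      exact mul_le_mul_of_nonneg_left (hf u ⟨hu.1, hu.2.le⟩) (Real.exp_pos _).le)
    (right_mem_Icc.2 hst)
  rw [norm_mul, nE] at key
  exact le_of_mul_le_mul_left key (Real.exp_pos _)
lemma ode0 {g f : ℝ → ℂ} {μ F M t : ℝ} (hμ : 0 < μ)
    (hg : ∀ u ≥ t, HasDerivAt g ((μ : ℂ) * g u + f u) u)
    (hf : ∀ u ≥ t, ‖f u‖ ≤ F) (hM : ∀ u ≥ t, ‖g u‖ ≤ M) : ‖g t‖ ≤ F / μ := by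
  have hE : ∀ u : ℝ, HasDerivAt (fun u => rexp (μ * (u - t))) (rexp (μ * (u - t)) * μ) u :=
    fun u => by
    have := (((hasDerivAt_id u).sub_const t).const_mul μ).exp
    simpa using this
  have nE : ∀ u : ℝ, ‖(rexp (μ * (u - t)) : ℂ)‖ = rexp (μ * (u - t)) := fun u => by
    rw [Complex.norm_real, Real.norm_of_nonneg (Real.exp_pos _).le]
  have key : ∀ T ≥ t, ‖g t‖ ≤ F / μ + M * rexp (-(μ * (T - t))) := fun T hT => by
    have h1 := ode1 (g := fun u => g u - (rexp (μ * (u - t)) : ℂ) * g t) (f := f) (L := -μ)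
      (b := fun u => F / μ * (rexp (μ * (u - t)) - 1))
      (b' := fun u => F / μ * (rexp (μ * (u - t)) * μ)) hT
      (fun u hu => by
        refine ((hg u hu.1).sub (((hE u).ofReal_comp).mul_const (g t))).congr_deriv ?_
        push_cast; ring)
      (fun u => ((hE u).sub_const 1).const_mul _)
      (fun u hu => by
        refine (hf u hu.1).trans (le_of_eq ?_)
        field_simp; ring)
      (by simp)
    set E := rexp (μ * (T - t)) with hEd
    have hE0 : 0 < E := Real.exp_pos _
    have h2 : E * ‖g t‖ ≤ M + F / μ * (E - 1) := by
      have h3 : (E : ℂ) * g t = g T - (g T - (E : ℂ) * g t) := by ring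
      have h4 : E * ‖g t‖ = ‖(E : ℂ) * g t‖ := by rw [norm_mul, nE]
      rw [h4, h3]
      exact (norm_sub_le _ _).trans (add_le_add (hM T hT) h1)
    have hF : 0 ≤ F / μ := div_nonneg ((norm_nonneg _).trans (hf t le_rfl)) hμ.le
    rw [Real.exp_neg, ← hEd]
    have h5 : E * ‖g t‖ ≤ E * (F / μ + M * E⁻¹) := by
      have : E * (F / μ + M * E⁻¹) = E * (F / μ) + M := by field_simp
      rw [this]; nlinarith
    exact le_of_mul_le_mul_left h5 hE0
  have h6 : Tendsto (fun T => F / μ + M * rexp (-(μ * (T - t)))) atTop (𝓝 (F / μ + M * 0)) := by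
    refine (Tendsto.const_mul M (Real.tendsto_exp_neg_atTop_nhds_zero.comp ?_)).const_add _
    exact (tendsto_atTop_add_const_right atTop (-t) tendsto_id).const_mul_atTop hμ
  rw [mul_zero, add_zero] at h6
  exact ge_of_tendsto h6 (eventually_atTop.2 ⟨t, key⟩)
namespace NF
variable {p : ℕ} {C τ1 : ℝ} {κ : ℝ → ℝ → ℝ} (h : NF p C τ1 κ)
include h
lemma sp {t : ℝ} (ht : t ∈ Ioi τ1) : SP (fun θ => κ θ t) :=
  ⟨h.fl.sm.contDiff ht, fun θ => h.fl.per θ t ht⟩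
lemma ps {t : ℝ} (ht : t ∈ Ioi τ1) : ∀ θ, 0 < (fun θ => κ θ t) θ := fun θ => h.fl.pos θ t ht
lemma fc_G {t : ℝ} (ht : t ∈ Ioi τ1) (n : ℤ) : fCoeff (fun θ => G p κ θ t) n =
    ((p + 1 - p * n ^ 2 : ℝ) : ℂ) * fCoeff (rh fun θ => κ θ t) n +
      ((1 - n ^ 2 : ℝ) : ℂ) * fCoeff (NN p fun θ => κ θ t) n := by
  have hs := h.sp ht
  have hp := h.ps ht
  set k := fun θ => κ θ t with hk
  have sx := sp_xx (p := p) hs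
  have sρ := sp_rh hs hp
  have e0 : (fun θ => V p κ θ t) = fun θ => xx p k θ + 1 := by
    funext θ; simp [V, xx, hk]
  have e1 : ∀ θ, dx (V p κ) θ t = deriv (xx p k) θ := fun θ => by
    unfold dx; rw [e0, deriv_add_const]
  have e2 : ∀ θ, dx (dx (V p κ)) θ t = deriv (deriv (xx p k)) θ := fun θ => by
    rw [dx]; congr 1; funext y; exact e1 y
  have e3 : (fun θ => G p κ θ t) = fun θ => 1 * deriv (deriv (xx p k)) θ +
      1 * ((1:ℝ) * xx p k θ + 1 * rh k θ) := by
    funext θ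
    rw [G, e2]; simp only [V, xx, rh, hk]; ring
  have e4 : xx p k = fun θ => (p:ℝ) * rh k θ + 1 * NN p k θ := by funext θ; simp only [NN]; ring
  have e5 : fCoeff (xx p k) n = p * fCoeff (rh k) n + fCoeff (NN p k) n := by
    rw [e4, fc_lin sρ.cont (sp_NN hs hp).cont]; simp
  rw [e3, fc_lin sx.der.der.cont (by have := sx.cont; have := sρ.cont; fun_prop), fc_lin sx.cont sρ.cont,
    fc_der sx.der, fc_der sx, e5]
  push_cast
  linear_combination (n ^ 2 * (p * fCoeff (rh k) n + fCoeff (NN p k) n)) * Complex.I_sq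
lemma hode {t : ℝ} (ht : t ∈ Ioi τ1) (n : ℤ) :
    HasDerivAt (fun s => fCoeff (rh fun θ => κ θ s) n)
      (((p + 1 - p * n ^ 2 : ℝ) : ℂ) * fCoeff (rh fun θ => κ θ t) n +
      ((1 - n ^ 2 : ℝ) : ℂ) * fCoeff (NN p fun θ => κ θ t) n) t := by
  rw [← h.fc_G ht]
  unfold fCoeff
  refine HasDerivAt.const_mul _ ?_
  refine hasDerivAt_integral_param (I := Ioi τ1)
    (g := fun θ s => ((rh (fun θ => κ θ s) θ : ℝ) : ℂ) * Complex.exp (-(Complex.I * n * θ)))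
    (g' := fun θ s => ((G p κ θ s : ℝ) : ℂ) * Complex.exp (-(Complex.I * n * θ)))
    h.fl.io ?_ ?_ ?_ ht _ _
  · exact (Complex.continuous_ofReal.comp_continuousOn h.fl.smH.contOn).mul
      (Continuous.continuousOn (by fun_prop))
  · intro s hs
    exact int_cont (sp_rh (h.sp hs) (h.ps hs)).cont n
  · intro θ s hs
    refine HasDerivAt.mul_const ?_ _
    have := ((h.fl.hinv hs θ).const_sub 1).ofReal_comp
    rwa [neg_neg] at this
lemma fc1 {t : ℝ} (ht : t ∈ Ioi τ1) : fCoeff (rh fun θ => κ θ t) 1 = 0 := by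
  have hc := h.ccos t ht
  have hs := h.csin t ht
  have ci : Continuous fun θ => (κ θ t)⁻¹ := h.fl.smInv.cont ht
  have i1 : ∫ θ in (0:ℝ)..(2*π), (rh (fun θ => κ θ t) θ * Real.cos θ) = 0 := by
    have e : (fun θ => rh (fun θ => κ θ t) θ * Real.cos θ) =
      fun θ => Real.cos θ - Real.cos θ * (κ θ t)⁻¹ := by funext θ; unfold rh; ring
    have c3 : Continuous fun θ => Real.cos θ * (κ θ t)⁻¹ := Real.continuous_cos.mul ci
    rw [e, intervalIntegral.integral_sub (Real.continuous_cos.intervalIntegrable _ _)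
      (c3.intervalIntegrable _ _), hc]
    simp
  have i2 : ∫ θ in (0:ℝ)..(2*π), (rh (fun θ => κ θ t) θ * Real.sin θ) = 0 := by
    have e : (fun θ => rh (fun θ => κ θ t) θ * Real.sin θ) =
      fun θ => Real.sin θ - Real.sin θ * (κ θ t)⁻¹ := by funext θ; unfold rh; ring
    have c3 : Continuous fun θ => Real.sin θ * (κ θ t)⁻¹ := Real.continuous_sin.mul ci
    rw [e, intervalIntegral.integral_sub (Real.continuous_sin.intervalIntegrable _ _)
      (c3.intervalIntegrable _ _), hs]
    simp
  have sρ := (sp_rh (h.sp ht) (h.ps ht)).cont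
  unfold fCoeff
  have e : (fun θ : ℝ => ((rh (fun θ => κ θ t) θ : ℝ) : ℂ) * Complex.exp (-(Complex.I * (1:ℤ) * θ))) =
    fun θ : ℝ => ((rh (fun θ => κ θ t) θ * Real.cos θ : ℝ) : ℂ) -
      Complex.I * ((rh (fun θ => κ θ t) θ * Real.sin θ : ℝ) : ℂ) := by
    funext θ
    rw [show -(Complex.I * ((1:ℤ):ℂ) * (θ:ℂ)) = ((-θ : ℝ) : ℂ) * Complex.I by push_cast; ring,
      Complex.exp_mul_I, ← Complex.ofReal_cos, ← Complex.ofReal_sin, Real.cos_neg, Real.sin_neg]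
    push_cast; ring
  have c1 : Continuous fun θ : ℝ => ((rh (fun θ => κ θ t) θ * Real.cos θ : ℝ) : ℂ) :=
    Complex.continuous_ofReal.comp (sρ.mul Real.continuous_cos)
  have c2 : Continuous fun θ : ℝ => Complex.I * ((rh (fun θ => κ θ t) θ * Real.sin θ : ℝ) : ℂ) :=
    continuous_const.mul (Complex.continuous_ofReal.comp (sρ.mul Real.continuous_sin))
  rw [e, intervalIntegral.integral_sub (c1.intervalIntegrable _ _) (c2.intervalIntegrable _ _),
    intervalIntegral.integral_const_mul, intervalIntegral.integral_ofReal,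
    intervalIntegral.integral_ofReal, i1, i2]
  simp
lemma fcm1 {t : ℝ} (ht : t ∈ Ioi τ1) : fCoeff (rh fun θ => κ θ t) (-1) = 0 := by
  rw [fc_conj, h.fc1 ht, map_zero]
end NF
end PC
namespace PC
open scoped ContDiff Topology
lemma iter_dx (g : ℝ → ℝ → ℝ) (m : ℕ) (t : ℝ) :
    (fun θ => (dx^[m] g) θ t) = deriv^[m] (fun θ => g θ t) := by
  induction m with
  | zero => rfl
  | succ m ih =>
    rw [Function.iterate_succ_apply', Function.iterate_succ_apply', ← ih]; rfl
lemma SM_iter {I : Set ℝ} (hI : UniqueDiffOn ℝ I) {g : ℝ → ℝ → ℝ} (hg : SM I g) (m : ℕ) :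
    SM I (dx^[m] g) := by
  induction m with
  | zero => exact hg
  | succ m ih => rw [Function.iterate_succ_apply']; exact ih.dx hI
lemma SM_bd {I K : Set ℝ} (hI : UniqueDiffOn ℝ I) {g : ℝ → ℝ → ℝ} (hg : SM I g) (hK : IsCompact K)
    (hKI : K ⊆ I) (m : ℕ) :
    ∃ B, ∀ t ∈ K, ∀ θ ∈ Icc (0:ℝ) (2 * π), |deriv^[m] (fun θ => g θ t) θ| ≤ B := by
  obtain ⟨B, hB⟩ := ((isCompact_Icc (a := (0:ℝ)) (b := 2 * π)).prod hK).exists_bound_of_continuousOn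
    ((SM_iter hI hg m).contOn.mono (prod_mono (subset_univ _) hKI))
  refine ⟨B, fun t ht θ hθ => ?_⟩
  rw [← iter_dx]
  exact hB (θ, t) ⟨hθ, ht⟩
lemma SP.ext_bd {f : ℝ → ℝ} (hf : SP f) {B : ℝ} (h : ∀ θ ∈ Icc (0:ℝ) (2 * π), |f θ| ≤ B) (θ : ℝ) :
    |f θ| ≤ B := by
  obtain ⟨y, hy, e⟩ := Function.Periodic.exists_mem_Ico₀ (f := f) hf.2 Real.two_pi_pos θ
  rw [e]; exact h y ⟨hy.1, hy.2.le⟩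
lemma n_cases (n : ℤ) : n = 0 ∨ n = 1 ∨ n = -1 ∨ (4:ℝ) ≤ (n:ℝ) ^ 2 := by
  by_cases h : n ^ 2 < 4
  · have h1 : n < 2 := by nlinarith
    have h2 : -2 < n := by nlinarith
    omega
  · right; right; right; exact_mod_cast not_lt.1 h
namespace NF
variable {p : ℕ} {C τ1 : ℝ} {κ : ℝ → ℝ → ℝ} (h : NF p C τ1 κ)
include h
lemma start {m : ℕ} (hm : 2 ≤ m) : ∃ τ0 > τ1, ∃ D E : ℝ, 0 ≤ D ∧ 0 ≤ E ∧ ∀ t ≥ τ0,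
    (∀ θ, |rh (fun θ => κ θ t) θ| ≤ 1) ∧
    Xn m (NN p fun θ => κ θ t) ≤ 1/12 * Xn m (rh fun θ => κ θ t) ∧
    Xn m (NN p fun θ => κ θ t) ≤ D * Xn m (rh fun θ => κ θ t) ^ 2 ∧
    Xn m (zz fun θ => κ θ t) ≤ E * Xn m (rh fun θ => κ θ t) := by
  have D0 := DD_nonneg p m
  have K0 := Kc_nonneg
  obtain ⟨ε, hε, e1, e2, e3⟩ : ∃ ε > (0:ℝ), 2 ^ m * (1 + p) * ε ≤ 1 / 2 ∧ DD p m * (2 * ε) ≤ 1 / 12 ∧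
      ε ≤ 1 := by
    have hq : (0:ℝ) < 2 ^ m * (1 + p) := by positivity
    refine ⟨min 1 (min (1 / (2 * (2 ^ m * (1 + p)))) (1 / (24 * (DD p m + 1)))), by positivity, ?_, ?_,
      min_le_left _ _⟩
    · refine (mul_le_mul_of_nonneg_left ((min_le_right _ _).trans (min_le_left _ _)) hq.le).trans ?_
      apply le_of_eq; field_simp
    · have : min 1 (min (1 / (2 * (2 ^ m * (1 + (p:ℝ))))) (1 / (24 * (DD p m + 1)))) ≤
        1 / (24 * (DD p m + 1)) := (min_le_right _ _).trans (min_le_right _ _)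
      calc _ ≤ DD p m * (2 * (1 / (24 * (DD p m + 1)))) := by gcongr
        _ = (DD p m / (DD p m + 1)) * (1/12) := by field_simp; ring
        _ ≤ 1 * (1/12) := by gcongr; rw [div_le_one (by positivity)]; linarith
        _ = _ := by norm_num
  obtain ⟨δ, hδ, H⟩ := small_all h.fl.hp (ε := ε) (C := C) hε
  obtain ⟨τ0, h0, hc⟩ := h.conv hδ
  refine ⟨τ0, h0, DD p m * (Kc * (p + 2)), 2 * (1 + 2 ^ m), by positivity, by positivity, fun t ht => ?_⟩
  have htm : t ∈ Ioi τ1 := lt_of_lt_of_le h0 ht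
  have hs := h.sp htm
  have hp := h.ps htm
  have h1 := H _ hs hp (hc t ht) (h.hv1 t htm)
  obtain ⟨-, hu, ha, hb, hz⟩ := h1
  obtain ⟨k, hk⟩ : ∃ k, k = fun θ => κ θ t := ⟨_, rfl⟩
  have hu : ∀ θ, k θ ≤ 2 := fun θ => by rw [hk]; exact hu θ
  have hp : ∀ θ, 0 < k θ := fun θ => by rw [hk]; exact hp θ
  rw [← hk] at ha hb hz hs ⊢
  have a0 := An_nonneg (rh k)
  have b0 := An_nonneg (xx p k)
  have Y0 := Xn_nonneg m (rh k)
  have q1 : 2 ^ m * (1 + p) * An (rh k) ≤ 1 / 2 :=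
    (mul_le_mul_of_nonneg_left ha (by positivity)).trans e1
  have N1 := NN_est h.fl.hp hs hp hu hm q1
  have N2 : Xn m (NN p k) ≤ 1/12 * Xn m (rh k) := by
    refine N1.trans (mul_le_mul_of_nonneg_right ((mul_le_mul_of_nonneg_left ?_ D0).trans e2) Y0)
    linarith
  refine ⟨fun θ => (sup_le_An (sp_rh hs hp) θ).trans (ha.trans e3), N2, ?_, ?_⟩
  · have x1 := X_xx (p := p) hs hp m
    have x2 := An_le (sp_xx (p := p) hs) hm
    have x3 := An_le (sp_rh hs hp) hm
    have x4 : An (rh k) + An (xx p k) ≤ Kc * (p + 2) * Xn m (rh k) := by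
      have : Xn m (xx p k) ≤ (p + 1) * Xn m (rh k) := by linarith
      have := mul_le_mul_of_nonneg_left this K0
      linarith
    refine N1.trans ?_
    calc _ ≤ DD p m * (Kc * (p + 2) * Xn m (rh k)) * Xn m (rh k) := by gcongr
      _ = _ := by ring
  · refine zz_est hs hp (le_trans ?_ q1) (hz.trans e3)
    refine mul_le_mul_of_nonneg_right ?_ a0
    exact le_mul_of_one_le_right (by positivity) (by linarith [(Nat.cast_nonneg p : (0:ℝ) ≤ p)])
lemma mode2 {m : ℕ} {n : ℤ} {b b' : ℝ → ℝ} {s t : ℝ} (hs : τ1 < s) (hst : s ≤ t) (hn : (4:ℝ) ≤ (n:ℝ)^2)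
    (hb : ∀ u, HasDerivAt b (b' u) u)
    (hf : ∀ u ∈ Icc s t, ((n:ℝ) ^ 2 - 1) * (wt n ^ m * ‖fCoeff (NN p fun θ => κ θ u) n‖) ≤
      b' u + (p * n ^ 2 - p - 1) * b u)
    (h0 : wt n ^ m * ‖fCoeff (rh fun θ => κ θ s) n‖ ≤ b s) :
    wt n ^ m * ‖fCoeff (rh fun θ => κ θ t) n‖ ≤ b t := by
  have hw : 0 ≤ wt n ^ m := pow_nonneg (wt0 n).le _
  have nw : ‖((wt n ^ m : ℝ) : ℂ)‖ = wt n ^ m := by rw [Complex.norm_real, Real.norm_of_nonneg hw]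
  have := ode1 (g := fun u => ((wt n ^ m : ℝ) : ℂ) * fCoeff (rh fun θ => κ θ u) n)
    (f := fun u => ((wt n ^ m : ℝ) : ℂ) * (((1 - n ^ 2 : ℝ) : ℂ) * fCoeff (NN p fun θ => κ θ u) n))
    (L := p * n ^ 2 - p - 1) (b := b) (b' := b') hst
    (fun u hu => by
      refine ((h.hode (lt_of_lt_of_le hs hu.1) n).const_mul _).congr_deriv ?_
      push_cast; ring) hb
    (fun u hu => by
      refine le_trans (le_of_eq ?_) (hf u hu)
      rw [norm_mul, norm_mul, nw, Complex.norm_real, Real.norm_eq_abs, abs_sub_comm,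
        abs_of_nonneg (by linarith)]
      ring)
    (by rw [norm_mul, nw]; exact h0)
  rwa [norm_mul, nw] at this
lemma Lfacts {n : ℤ} (hn : (4:ℝ) ≤ (n:ℝ)^2) : 3 * (p:ℝ) - 1 ≤ p * n ^ 2 - p - 1 ∧
    (n:ℝ) ^ 2 - 1 ≤ 3/2 * (p * n ^ 2 - p - 1) ∧ (2:ℝ) ≤ 3 * p - 1 := by
  have hp : (1:ℝ) ≤ p := by exact_mod_cast h.fl.hp
  refine ⟨by nlinarith, by nlinarith, by linarith⟩
lemma bddY {m : ℕ} {τ0 : ℝ} (h0 : τ1 < τ0) (H1 : ∀ t ≥ τ0, ∀ θ, |rh (fun θ => κ θ t) θ| ≤ 1)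
    (H2 : ∀ t ≥ τ0, Xn m (NN p fun θ => κ θ t) ≤ 1/12 * Xn m (rh fun θ => κ θ t)) :
    ∃ B, ∀ t ≥ τ0, Xn m (rh fun θ => κ θ t) ≤ B := by
  refine ⟨2 * (1 + Xn m (rh fun θ => κ θ τ0)), fun T hT => ?_⟩
  have hmem : ∀ t ≥ τ0, t ∈ Ioi τ1 := fun t ht => lt_of_lt_of_le h0 ht
  have hsub : Icc τ0 T ⊆ Ioi τ1 := fun t ht => hmem t ht.1
  have sm : SM (Ioi τ1) (fun θ t => 1 - (κ θ t)⁻¹) := (SM.cst 1).sub h.fl.smInv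
  obtain ⟨B1, hB1⟩ := SM_bd h.fl.io.uniqueDiffOn sm isCompact_Icc hsub m
  have bdd : BddAbove ((fun t => Xn m (rh fun θ => κ θ t)) '' Icc τ0 T) := by
    refine ⟨2 ^ m * (1 + B1), ?_⟩
    rintro _ ⟨t, ht, rfl⟩
    have sρ := sp_rh (h.sp (hsub ht)) (h.ps (hsub ht))
    exact Xn_le (wt_bd sρ (H1 t ht.1) ((sρ.iter m).ext_bd (hB1 t ht)))
  set S := sSup ((fun t => Xn m (rh fun θ => κ θ t)) '' Icc τ0 T) with hS
  have leS : ∀ t ∈ Icc τ0 T, Xn m (rh fun θ => κ θ t) ≤ S := fun t ht => le_csSup bdd ⟨t, ht, rfl⟩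
  have S0 : 0 ≤ S := (Xn_nonneg _ _).trans (leS τ0 ⟨le_rfl, hT⟩)
  have Y0 := Xn_nonneg m (rh fun θ => κ θ τ0)
  have key : S ≤ 1 + Xn m (rh fun θ => κ θ τ0) + S/2 := by
    refine csSup_le ⟨_, ⟨τ0, ⟨le_rfl, hT⟩, rfl⟩⟩ ?_
    rintro _ ⟨t, ht, rfl⟩
    refine Xn_le fun n => ?_
    rcases n_cases n with rfl | rfl | rfl | hn
    · have w0 : wt 0 = 1 := by simp [wt]
      rw [w0, one_pow, one_mul]
      linarith [fc_bd (H1 t ht.1) 0]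
    · rw [h.fc1 (hsub ht), norm_zero, mul_zero]; positivity
    · rw [h.fcm1 (hsub ht), norm_zero, mul_zero]; positivity
    · obtain ⟨l1, l2, l3⟩ := h.Lfacts hn
      have := h.mode2 (m := m) (b := fun _ => Xn m (rh fun θ => κ θ τ0) + S/2) (b' := fun _ => 0) h0 ht.1 hn
        (fun u => hasDerivAt_const u _) (fun u hu => by
          have hu' : u ∈ Icc τ0 T := ⟨hu.1, hu.2.trans ht.2⟩
          have r1 := (le_Xn (sp_NN (p := p) (h.sp (hsub hu')) (h.ps (hsub hu'))) m n).trans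
            ((H2 u hu.1).trans (mul_le_mul_of_nonneg_left (leS u hu') (by norm_num)))
          have r2 := mul_le_mul l2 r1 (mul_nonneg (pow_nonneg (wt0 n).le _) (norm_nonneg _)) (by linarith)
          refine r2.trans ?_
          have r3 : 0 ≤ (p * (n:ℝ) ^ 2 - p - 1) * S := mul_nonneg (by linarith) S0
          have r4 : 0 ≤ (p * (n:ℝ) ^ 2 - p - 1) * Xn m (rh fun θ => κ θ τ0) := mul_nonneg (by linarith) Y0
          linarith)
        (by have := le_Xn (sp_rh (h.sp (hmem τ0 le_rfl)) (h.ps (hmem τ0 le_rfl))) m n; linarith)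
      linarith
  have := leS T ⟨hT, le_rfl⟩
  linarith
lemma mode0 {m : ℕ} {t F : ℝ} (ht : τ1 < t) (H1 : ∀ u ≥ t, ∀ θ, |rh (fun θ => κ θ u) θ| ≤ 1)
    (H2 : ∀ u ≥ t, Xn m (NN p fun θ => κ θ u) ≤ F) :
    wt 0 ^ m * ‖fCoeff (rh fun θ => κ θ t) 0‖ ≤ F / 2 := by
  have hp : (1:ℝ) ≤ p := by exact_mod_cast h.fl.hp
  have w0 : wt 0 = 1 := by simp [wt]
  have F0 : 0 ≤ F := (Xn_nonneg _ _).trans (H2 t le_rfl)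
  rw [w0, one_pow, one_mul]
  have := ode0 (g := fun u => fCoeff (rh fun θ => κ θ u) 0) (f := fun u => fCoeff (NN p fun θ => κ θ u) 0)
    (μ := p + 1) (F := F) (M := 1) (t := t) (by positivity)
    (fun u hu => by
      refine (h.hode (lt_of_lt_of_le ht hu) 0).congr_deriv ?_
      push_cast; ring)
    (fun u hu => by
      have hm : u ∈ Ioi τ1 := lt_of_lt_of_le ht hu
      have := le_Xn (sp_NN (p := p) (h.sp hm) (h.ps hm)) m 0
      rw [w0, one_pow, one_mul] at this
      exact this.trans (H2 u hu))
    (fun u hu => fc_bd (H1 u hu) 0)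
  refine this.trans (div_le_div_of_nonneg_left F0 (by norm_num) (by linarith))
lemma decay1 {m : ℕ} {τ0 : ℝ} (h0 : τ1 < τ0) (H1 : ∀ t ≥ τ0, ∀ θ, |rh (fun θ => κ θ t) θ| ≤ 1)
    (H2 : ∀ t ≥ τ0, Xn m (NN p fun θ => κ θ t) ≤ 1/12 * Xn m (rh fun θ => κ θ t)) :
    ∃ D, 0 ≤ D ∧ ∀ t ≥ τ0, Xn m (rh fun θ => κ θ t) ≤ D * rexp (-(3/4 * (3 * p - 1)) * t) := by
  obtain ⟨B, hB⟩ := h.bddY h0 H1 H2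
  have hp : (1:ℝ) ≤ p := by exact_mod_cast h.fl.hp
  set β := 3/4 * (3 * (p:ℝ) - 1) with hβ
  have β0 : 0 < β := by rw [hβ]; linarith
  have hmem : ∀ t ≥ τ0, t ∈ Ioi τ1 := fun t ht => lt_of_lt_of_le h0 ht
  set Y := fun t => Xn m (rh fun θ => κ θ t) with hY
  have Y0 : ∀ t, 0 ≤ Y t := fun t => Xn_nonneg _ _
  set D := Y τ0 * rexp (β * τ0) with hD
  have D0 : 0 ≤ D := mul_nonneg (Y0 _) (Real.exp_pos _).le
  have main : ∀ η > 0, ∀ t ≥ τ0, Y t ≤ 2 * D * (rexp (-β * t) + η) := by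
    intro η hη
    set w := fun t => rexp (-β * t) + η with hw
    have w0 : ∀ t, 0 < w t := fun t => by have := Real.exp_pos (-β * t); simp only [hw]; linarith
    have bdd : BddAbove ((fun t => Y t / w t) '' Ici τ0) := by
      refine ⟨B / η, ?_⟩
      rintro _ ⟨t, ht, rfl⟩
      refine div_le_div₀ ((Y0 t).trans (hB t ht)) (hB t ht) hη ?_
      have := Real.exp_pos (-β * t); simp only [hw]; linarith
    set S := sSup ((fun t => Y t / w t) '' Ici τ0) with hS
    have leS : ∀ t ≥ τ0, Y t ≤ S * w t := fun t ht => by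
      rw [← div_le_iff₀ (w0 t)]; exact le_csSup bdd ⟨t, ht, rfl⟩
    have S0 : 0 ≤ S := by
      have := (Y0 τ0).trans (leS τ0 le_rfl)
      exact nonneg_of_mul_nonneg_left this (w0 τ0)
    have key : S ≤ D + S/2 := by
      refine csSup_le ⟨_, ⟨τ0, mem_Ici.2 le_rfl, rfl⟩⟩ ?_
      rintro _ ⟨t, ht, rfl⟩
      have ht : τ0 ≤ t := ht
      show Y t / w t ≤ _
      rw [div_le_iff₀ (w0 t)]
      have P0 : 0 ≤ (D + S/2) * w t := mul_nonneg (by positivity) (w0 t).le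
      have SW : 0 ≤ S * w t := mul_nonneg S0 (w0 t).le
      refine Xn_le fun n => ?_
      rcases n_cases n with rfl | rfl | rfl | hn
      · have := h.mode0 (m := m) (t := t) (F := 1/12 * (S * w t)) (hmem t ht) (fun u hu => H1 u (ht.trans hu))
          (fun u hu => by
            refine (H2 u (ht.trans hu)).trans (mul_le_mul_of_nonneg_left ((leS u (ht.trans hu)).trans
              (mul_le_mul_of_nonneg_left ?_ S0)) (by norm_num))
            have : rexp (-β * u) ≤ rexp (-β * t) := Real.exp_le_exp.2 (by nlinarith)
            simp only [hw]; linarith)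
        have : 0 ≤ D * w t := mul_nonneg D0 (w0 t).le
        linarith
      · rw [h.fc1 (hmem t ht), norm_zero, mul_zero]; exact P0
      · rw [h.fcm1 (hmem t ht), norm_zero, mul_zero]; exact P0
      · obtain ⟨l1, l2, l3⟩ := h.Lfacts hn
        refine h.mode2 (m := m) (b := fun t => (D + S/2) * w t)
          (b' := fun t => (D + S/2) * (rexp (-β * t) * (-β))) h0 ht hn (fun u => ?_) (fun u hu => ?_) ?_
        · refine HasDerivAt.const_mul _ ?_
          have := (((hasDerivAt_id u).const_mul (-β)).exp).add_const η
          simp only [id, mul_one] at this; exact this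
        · have r1 := (le_Xn (sp_NN (p := p) (h.sp (hmem u hu.1)) (h.ps (hmem u hu.1))) m n).trans
            ((H2 u hu.1).trans (mul_le_mul_of_nonneg_left (leS u hu.1) (by norm_num)))
          have r2 := mul_le_mul l2 r1 (mul_nonneg (pow_nonneg (wt0 n).le _) (norm_nonneg _)) (by linarith)
          refine r2.trans ?_
          set L := p * (n:ℝ) ^ 2 - p - 1 with hL
          have L0 : 0 ≤ L := by linarith
          have r3 : rexp (-β * u) ≤ w u := by simp only [hw]; linarith
          have r4 : (D + S/2) * (rexp (-β * u) * β) ≤ (D + S/2) * (w u * (3/4 * L)) := by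
            refine mul_le_mul_of_nonneg_left (mul_le_mul r3 ?_ β0.le (w0 u).le) (by positivity)
            rw [hβ]; linarith
          have r5 : 0 ≤ L * (D * w u) := mul_nonneg L0 (mul_nonneg D0 (w0 u).le)
          linarith
        · refine (le_Xn (sp_rh (h.sp (hmem τ0 le_rfl)) (h.ps (hmem τ0 le_rfl))) m n).trans ?_
          have r1 : Y τ0 = D * rexp (-β * τ0) := by
            rw [hD, mul_assoc, ← Real.exp_add]; simp
          have r2 : D * rexp (-β * τ0) ≤ (D + S/2) * w τ0 :=
            mul_le_mul (by linarith) (by simp only [hw]; linarith) (Real.exp_pos _).le (by positivity)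
          exact r1.le.trans r2
    intro t ht
    refine (leS t ht).trans (mul_le_mul_of_nonneg_right (by linarith) (w0 t).le)
  refine ⟨2 * D, by positivity, fun t ht => le_of_forall_pos_le_add fun ε hε => ?_⟩
  have := main (ε / (2 * D + 1)) (by positivity) t ht
  refine this.trans ?_
  rw [mul_add]
  have : 2 * D * (ε / (2 * D + 1)) ≤ ε := by
    rw [mul_div_assoc', div_le_iff₀ (by positivity)]; nlinarith
  linarith
lemma decay2 (hτ : 0 ≤ τ1) (m : ℕ) : ∃ τ0 > τ1, ∃ M : ℝ, 0 ≤ M ∧ ∀ t ≥ τ0,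
    Xn m (rh fun θ => κ θ t) ≤ M * rexp (-(3 * p - 1) * t) := by
  obtain ⟨τ0, h0, D, E, hD0, hE0, H⟩ := h.start (m := m + 2) (by omega)
  obtain ⟨B, hB0, hB⟩ := h.decay1 h0 (fun t ht => (H t ht).1) (fun t ht => (H t ht).2.1)
  have hp : (1:ℝ) ≤ p := by exact_mod_cast h.fl.hp
  have hmem : ∀ t ≥ τ0, t ∈ Ioi τ1 := fun t ht => lt_of_lt_of_le h0 ht
  set Γ := 3 * (p:ℝ) - 1 with hΓ
  have Γ2 : 2 ≤ Γ := by rw [hΓ]; linarith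
  have Γ0 : 0 < Γ := by linarith
  set F := D * B ^ 2 with hF
  have F0 : 0 ≤ F := by positivity
  have hN : ∀ t ≥ τ0, Xn (m+2) (NN p fun θ => κ θ t) ≤ F * rexp (-(3/2 * Γ) * t) := fun t ht => by
    refine (H t ht).2.2.1.trans ?_
    have := pow_le_pow_left₀ (Xn_nonneg _ _) (hB t ht) 2
    refine (mul_le_mul_of_nonneg_left this hD0).trans (le_of_eq ?_)
    rw [mul_pow, ← Real.exp_nat_mul, hF, mul_assoc]
    congr 3; push_cast; ring
  have Y0 := Xn_nonneg m (rh fun θ => κ θ τ0)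
  set K := 2 * F / Γ with hK
  have K0 : 0 ≤ K := by positivity
  have hKF : Γ / 2 * K = F := by rw [hK]; field_simp
  set M := (Xn m (rh fun θ => κ θ τ0) + K) * rexp (Γ * τ0) with hM
  have hE1 : 1 ≤ rexp (Γ * τ0) := Real.one_le_exp (mul_nonneg Γ0.le (by linarith))
  have hMK : K ≤ M := by
    rw [hM]
    have : K ≤ Xn m (rh fun θ => κ θ τ0) + K := by linarith
    exact this.trans (le_mul_of_one_le_right (by positivity) hE1)
  have M0 : 0 ≤ M := K0.trans hMK
  have hcmp : ∀ t ≥ τ0, rexp (-(3/2 * Γ) * t) ≤ rexp (-Γ * t) := fun t ht =>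
    Real.exp_le_exp.2 (by nlinarith)
  refine ⟨τ0, h0, M + F, by positivity, fun t ht => ?_⟩
  have E0 := Real.exp_pos (-Γ * t)
  refine Xn_le fun n => ?_
  rcases n_cases n with rfl | rfl | rfl | hn
  · have := h.mode0 (m := m+2) (t := t) (F := F * rexp (-(3/2 * Γ) * t)) (hmem t ht)
      (fun u hu => (H u (ht.trans hu)).1)
      (fun u hu => (hN u (ht.trans hu)).trans (mul_le_mul_of_nonneg_left
        (Real.exp_le_exp.2 (by nlinarith)) F0))
    have w0 : wt 0 = 1 := by simp [wt]
    rw [w0, one_pow, one_mul] at this ⊢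
    have r := mul_le_mul_of_nonneg_left (hcmp t ht) F0
    have : 0 ≤ M * rexp (-Γ * t) := by positivity
    have : 0 ≤ F * rexp (-(3/2 * Γ) * t) := by positivity
    linarith
  · rw [h.fc1 (hmem t ht), norm_zero, mul_zero]; positivity
  · rw [h.fcm1 (hmem t ht), norm_zero, mul_zero]; positivity
  · obtain ⟨l1, l2, l3⟩ := h.Lfacts hn
    have key := h.mode2 (m := m) (b := fun t => M * rexp (-Γ * t) - K * rexp (-(3/2 * Γ) * t))
      (b' := fun t => M * (rexp (-Γ * t) * (-Γ)) - K * (rexp (-(3/2 * Γ) * t) * (-(3/2 * Γ))))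
      h0 ht hn (fun u => ?_) (fun u hu => ?_) ?_
    · refine key.trans ?_
      have : 0 ≤ K * rexp (-(3/2 * Γ) * t) := by positivity
      have : 0 ≤ F * rexp (-Γ * t) := by positivity
      linarith
    · have e1 : HasDerivAt (fun u => rexp (-Γ * u)) (rexp (-Γ * u) * (-Γ)) u := by
        simpa using ((hasDerivAt_id u).const_mul (-Γ)).exp
      have e2 : HasDerivAt (fun u => rexp (-(3/2 * Γ) * u))
          (rexp (-(3/2 * Γ) * u) * (-(3/2 * Γ))) u := by
        have := ((hasDerivAt_id u).const_mul (-(3/2 * Γ))).exp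
        simp only [id, mul_one] at this; exact this
      exact (e1.const_mul M).sub (e2.const_mul K)
    · have r1 := le_Xn (sp_NN (p := p) (h.sp (hmem u hu.1)) (h.ps (hmem u hu.1))) (m+2) n
      have r2 : ((n:ℝ) ^ 2 - 1) * (wt n ^ m * ‖fCoeff (NN p fun θ => κ θ u) n‖) ≤
          wt n ^ (m+2) * ‖fCoeff (NN p fun θ => κ θ u) n‖ := by
        rw [pow_add, mul_comm (wt n ^ m) (wt n ^ 2), mul_assoc]
        refine mul_le_mul_of_nonneg_right ?_ (mul_nonneg (pow_nonneg (wt0 n).le _) (norm_nonneg _))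
        unfold wt; nlinarith [sq_abs (n:ℝ), abs_nonneg (n:ℝ)]
      refine (r2.trans (r1.trans (hN u hu.1))).trans ?_
      set L := p * (n:ℝ) ^ 2 - p - 1 with hL
      set a := rexp (-Γ * u)
      set c := rexp (-(3/2 * Γ) * u) with hc
      have r3 : 0 ≤ (L - Γ) * (M * a - K * c) := by
        refine mul_nonneg (by linarith) (sub_nonneg.2 ?_)
        exact mul_le_mul hMK (hcmp u hu.1) (Real.exp_pos _).le M0
      rw [← hKF]
      linarith
    · refine (le_Xn (sp_rh (h.sp (hmem τ0 le_rfl)) (h.ps (hmem τ0 le_rfl))) m n).trans ?_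
      have r1 : M * rexp (-Γ * τ0) = Xn m (rh fun θ => κ θ τ0) + K := by
        rw [hM, mul_assoc, ← Real.exp_add]; simp
      have r2 : K * rexp (-(3/2 * Γ) * τ0) ≤ K * 1 :=
        mul_le_mul_of_nonneg_left (Real.exp_le_one_iff.2 (by nlinarith)) K0
      show _ ≤ M * rexp (-Γ * τ0) - K * rexp (-(3/2 * Γ) * τ0)
      rw [r1]; linarith
lemma decay (hτ : 0 ≤ τ1) (l : ℕ) : ∃ τ0 > τ1, ∃ M : ℝ, 0 ≤ M ∧ ∀ t ≥ τ0, ∀ θ,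
    |deriv^[l] (fun θ => κ θ t - 1) θ| ≤ M * rexp (-(3 * p - 1) * t) := by
  obtain ⟨τ2, h2, D, E, hD0, hE0, H⟩ := h.start (m := l + 2) (by omega)
  obtain ⟨τ3, h3, M, hM0, hM⟩ := h.decay2 hτ (l + 2)
  have K0 := Kc_nonneg
  refine ⟨max τ2 τ3, lt_max_of_lt_left h2, Kc * (E * M), by positivity, fun t ht θ => ?_⟩
  have ht2 := (le_max_left _ _).trans ht
  have ht3 := (le_max_right _ _).trans ht
  refine (der_le (sp_zz (h.sp (lt_of_lt_of_le h2 ht2))) l θ).trans ?_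
  rw [mul_assoc, mul_assoc]
  exact mul_le_mul_of_nonneg_left ((H t ht2).2.2.2.trans (mul_le_mul_of_nonneg_left (hM t ht3) hE0)) K0
end NF
end PC
namespace PC
open scoped ContDiff Topology
lemma iter_const_mul (a : ℝ) (f : ℝ → ℝ) (m : ℕ) :
    deriv^[m] (fun θ => a * f θ) = fun θ => a * deriv^[m] f θ := by
  induction m with
  | zero => rfl
  | succ m ih =>
    rw [Function.iterate_succ_apply', ih, Function.iterate_succ_apply']
    funext θ
    rw [deriv_const_mul_field]
lemma iter_sub_one (f : ℝ → ℝ) (m : ℕ) (θ : ℝ) :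
    |deriv^[m] (fun θ => f θ - 1) θ| ≤ |deriv^[m] f θ| + 1 := by
  cases m with
  | zero =>
    have := abs_sub (f θ) 1
    simp only [abs_one] at this
    exact this
  | succ m =>
    have : deriv (fun θ => f θ - 1) = deriv f := by funext x; rw [deriv_sub_const]
    rw [Function.iterate_succ_apply, Function.iterate_succ_apply, this]
    linarith
lemma one_order {p : ℕ} (hp : 1 ≤ p) {T : ℝ} (hT : 0 < T) {k : ℝ → ℝ → ℝ} {ψ : ℝ → ℝ}
    (hk : IsPCSF p T k ψ) (j : ℕ) : ∃ C, 0 ≤ C ∧ ∀ τ : ℝ, 0 ≤ τ → ∀ θ ∈ Icc (0:ℝ) (2 * π),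
      |iteratedDeriv j (fun θ => ktilde p T k θ τ - 1) θ| ≤ C * rexp (-(3 * (p : ℝ) - 1) * τ) := by
  obtain ⟨C, τ1, h1, nf⟩ := nf_of (uf_of hp hT hk)
  obtain ⟨τ0, h0, M, M0, hM⟩ := nf.decay h1.le j
  have hp1 : (1:ℝ) ≤ p := by exact_mod_cast hp
  have sm : SM (Ico 0 T) k := hk.1
  have tm : ∀ τ, 0 ≤ τ → 0 ≤ tOf p T τ := fun τ hτ => by
    have : rexp (-((p : ℝ) + 1) * τ) ≤ 1 := Real.exp_le_one_iff.2 (by nlinarith)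
    exact mul_nonneg hT.le (by linarith)
  obtain ⟨B, hB⟩ := SM_bd (uniqueDiffOn_Ico 0 T) sm (isCompact_Icc (a := 0) (b := tOf p T τ0))
    (fun t ht => ⟨ht.1, lt_of_le_of_lt ht.2 (by
      have := Real.exp_pos (-((p : ℝ) + 1) * τ0)
      unfold tOf; nlinarith)⟩) j
  set A : ℝ := (((p : ℝ) + 1) / (p : ℝ)) ^ ((1 : ℝ) / ((p : ℝ) + 1)) with hA
  have A0 : 0 ≤ A := by positivity
  set A2 : ℝ := T ^ ((1 : ℝ) / ((p : ℝ) + 1)) with hA2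
  have A20 : 0 ≤ A2 := by positivity
  have N0 : 0 ≤ A * A2 * |B| + 1 := by positivity
  refine ⟨M + (A * A2 * |B| + 1) * rexp ((3 * (p:ℝ) - 1) * τ0), by positivity, fun τ hτ θ hθ => ?_⟩
  rw [iteratedDeriv_eq_iterate]
  have E0 := Real.exp_pos (-(3 * (p : ℝ) - 1) * τ)
  have E1 := Real.exp_pos ((3 * (p:ℝ) - 1) * τ0)
  rcases le_total τ0 τ with hc | hc
  · refine (hM τ hc θ).trans (mul_le_mul_of_nonneg_right ?_ E0.le)
    linarith [mul_nonneg N0 E1.le]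
  · have e1 : 1 ≤ rexp ((3 * (p:ℝ) - 1) * τ0) * rexp (-(3 * (p : ℝ) - 1) * τ) := by
      rw [← Real.exp_add]; exact Real.one_le_exp (by nlinarith)
    have e2 : |deriv^[j] (fun θ => ktilde p T k θ τ - 1) θ| ≤ A * A2 * |B| + 1 := by
      refine (iter_sub_one _ j θ).trans ?_
      unfold ktilde
      rw [iter_const_mul]
      have f1 : tOf p T τ ≤ tOf p T τ0 := by
        unfold tOf
        have : rexp (-((p : ℝ) + 1) * τ0) ≤ rexp (-((p : ℝ) + 1) * τ) :=
          Real.exp_le_exp.2 (by nlinarith)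
        exact mul_le_mul_of_nonneg_left (by linarith) hT.le
      have f2 := hB _ ⟨tm τ hτ, f1⟩ θ hθ
      have f3 : 0 ≤ T - tOf p T τ := by
        have := mul_pos hT (Real.exp_pos (-((p : ℝ) + 1) * τ))
        unfold tOf; linarith
      have f4 : (T - tOf p T τ) ^ ((1 : ℝ) / ((p : ℝ) + 1)) ≤ A2 :=
        Real.rpow_le_rpow f3 (by linarith [tm τ hτ]) (by positivity)
      have f5 : 0 ≤ (T - tOf p T τ) ^ ((1 : ℝ) / ((p : ℝ) + 1)) := Real.rpow_nonneg f3 _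
      rw [abs_mul, abs_mul, abs_of_nonneg A0, abs_of_nonneg f5]
      have f6 := f2.trans (le_abs_self B)
      gcongr
    refine e2.trans ?_
    have := mul_le_mul_of_nonneg_left e1 N0
    nlinarith [mul_nonneg M0 E0.le]
lemma main {p : ℕ} (hp : 1 ≤ p) {T : ℝ} (hT : 0 < T) {k : ℝ → ℝ → ℝ} {ψ : ℝ → ℝ}
    (hk : IsPCSF p T k ψ) (l : ℕ) : ∃ C > (0:ℝ), ∀ τ : ℝ, 0 ≤ τ →
      ClNorm l (fun θ => ktilde p T k θ τ - 1) ≤ C * rexp (-(3 * (p : ℝ) - 1) * τ) := by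
  choose C C0 hC using one_order hp hT hk
  have S0 : 0 ≤ ∑ j ∈ Finset.range (l + 1), C j := Finset.sum_nonneg fun j _ => C0 j
  refine ⟨1 + ∑ j ∈ Finset.range (l + 1), C j, by linarith, fun τ hτ => ?_⟩
  have : Nonempty (Set.Icc (0:ℝ) (2 * π)) := ⟨⟨0, le_rfl, Real.two_pi_pos.le⟩⟩
  refine ciSup_le fun j => ciSup_le fun θ => (hC j τ hτ θ θ.2).trans ?_
  refine mul_le_mul_of_nonneg_right ?_ (Real.exp_pos _).le
  have := Finset.single_le_sum (f := C) (fun i _ => C0 i) (Finset.mem_range.2 j.2)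
  linarith
end PC

/-- For any solution of the normalized `p`-curve shortening flow starting
from the curvature of a simple closed convex curve (no smallness condition on `ψ`),
for every `l` there is `C_{p,l} > 0` with
`‖k̃(·,τ) - 1‖_{C^l[0,2π]} ≤ C_{p,l} e^{-(3p-1)τ}` for all `τ ≥ 0`. -/
theorem statement1 (p : ℕ) (hp : 1 ≤ p) (T : ℝ) (hT : 0 < T)
    (k : ℝ → ℝ → ℝ) (ψ : ℝ → ℝ) (hk : IsPCSF p T k ψ) (l : ℕ) :
    ∃ C > (0:ℝ), ∀ τ : ℝ, 0 ≤ τ →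
      ClNorm l (fun θ => ktilde p T k θ τ - 1)
        ≤ C * Real.exp (-(3 * (p : ℝ) - 1) * τ) := by
  exact PC.main hp hT hk l
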